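/- Let D ⊆ ℂ^N be a strictly pseudoconvex domain and let γ : bD × [0,1] → cl(D) be a C¹ map with γ(x,r) ∈ D for r < 1, γ(x,1) = x and transversal approach, satisfying assumption (†). Let ε > 0, let K ⊆ D be a compact 𝒪(D)-convex set, let h ∈ 𝒪(D), and let φ be a continuous function on bD. Then there exists r_0 ∈ (0,1) such that for every r ∈ (r_0, 1) there exist a compact set E ⊆ bD and f ∈ 𝒪(D) satisfying: (1) m(bD \ E) < ε; (2) sup_{x ∈ E} |f(γ(x,r)) − φ(x)| < ε; (3) sup_{z ∈ K} |f(z) − h(z)| < ε; here m is the normalized surface ((2N−1)-dimensional Hausdorff) measure on bD. -/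

import Mathlib

open Set Filter Topology Metric MeasureTheory
open scoped ENNReal NNReal InnerProductSpace ComplexConjugate

noncomputable section

/-- `ℂ^N` with the Euclidean structure. -/
abbrev EN (N : ℕ) := EuclideanSpace ℂ (Fin N)

instance {N : ℕ} : MeasurableSpace (EN N) := borel _
instance {N : ℕ} : BorelSpace (EN N) := ⟨rfl⟩

/-- A domain: a nonempty open connected subset. -/
def IsDomainSet {N : ℕ} (D : Set (EN N)) : Prop := IsOpen D ∧ IsConnected D

/-- `u` is plurisubharmonic on `D`: upper semicontinuous on `D`, and its restriction to
every complex affine line satisfies the sub-mean value inequality on every closed disc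
(of that line) contained in `D`. -/
def PlurisubharmonicOn {N : ℕ} (u : EN N → ℝ) (D : Set (EN N)) : Prop :=
  UpperSemicontinuousOn u D ∧
  ∀ (a b : EN N) (t₀ : ℂ) (r : ℝ), 0 < r →
    (fun t : ℂ => a + t • b) '' Metric.closedBall t₀ r ⊆ D →
    u (a + t₀ • b) ≤ (2 * Real.pi)⁻¹ *
      ∫ θ in (0:ℝ)..(2 * Real.pi), u (a + (t₀ + r * Complex.exp (θ * Complex.I)) • b)

/-- `D` is a pseudoconvex domain: a domain carrying a continuous plurisubharmonic
exhaustion function. -/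
def Pseudoconvex {N : ℕ} (D : Set (EN N)) : Prop :=
  IsDomainSet D ∧ ∃ u : EN N → ℝ, ContinuousOn u D ∧ PlurisubharmonicOn u D ∧
    ∀ c : ℝ, IsCompact (closure {z ∈ D | u z < c}) ∧ closure {z ∈ D | u z < c} ⊆ D

/-- The space `𝒪(D)` of holomorphic functions on `D`, as a submodule of `ℂ^N → ℂ`. -/
def Hol {N : ℕ} (D : Set (EN N)) : Submodule ℂ (EN N → ℂ) where
  carrier := {f | DifferentiableOn ℂ f D}
  add_mem' hf hg := hf.add hg
  zero_mem' := differentiableOn_const 0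
  smul_mem' c f hf := hf.const_smul c

/-- The topology of uniform convergence on compact subsets of `D`, on `𝒪(D)`. -/
instance holTopology {N : ℕ} (D : Set (EN N)) : TopologicalSpace ↥(Hol D) :=
  TopologicalSpace.induced
    (fun f => UniformOnFun.ofFun {K : Set (EN N) | K ⊆ D ∧ IsCompact K} f.1)
    inferInstance

/-- A set is residual if it contains a dense `G_δ` set. -/
def ResidualIn {X : Type*} [TopologicalSpace X] (S : Set X) : Prop :=
  ∃ T : Set X, T ⊆ S ∧ IsGδ T ∧ Dense T

/-- `S` is densely lineable: `S ∪ {0}` contains a dense vector subspace. -/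
def DenselyLineableIn {X : Type*} [TopologicalSpace X] [AddCommMonoid X] [Module ℂ X]
    (S : Set X) : Prop :=
  ∃ p : Submodule ℂ X, Dense (p : Set X) ∧ (p : Set X) ⊆ S ∪ {0}

/-- `S` is spaceable: `S ∪ {0}` contains a closed infinite-dimensional vector subspace. -/
def SpaceableIn {X : Type*} [TopologicalSpace X] [AddCommMonoid X] [Module ℂ X]
    (S : Set X) : Prop :=
  ∃ p : Submodule ℂ X, IsClosed (p : Set X) ∧ ¬ Module.Finite ℂ ↥p ∧ (p : Set X) ⊆ S ∪ {0}

/-- A finite length path to `bD`: continuous and piecewise `C¹` on `[0,1)`, with values in `D`,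
finite length (total variation), converging to a boundary point of `D` as `r → 1`. -/
def FiniteLengthPathTo {N : ℕ} (D : Set (EN N)) (γ : ℝ → EN N) : Prop :=
  MapsTo γ (Ico (0:ℝ) 1) D ∧ ContinuousOn γ (Ico (0:ℝ) 1) ∧
  (∃ u : ℕ → ℝ, u 0 = 0 ∧ StrictMono u ∧ (∀ n, u n < 1) ∧ Tendsto u atTop (𝓝 1) ∧
    ∀ n, ContDiffOn ℝ 1 γ (Icc (u n) (u (n+1)))) ∧
  eVariationOn γ (Ico (0:ℝ) 1) < ⊤ ∧
  ∃ ζ ∈ frontier D, Tendsto γ (𝓝[<] (1:ℝ)) (𝓝 ζ)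

/-- The set of `f ∈ 𝒪(D)` with maximal cluster set along every finite length path to `bD`. -/
def WildSet {N : ℕ} (D : Set (EN N)) : Set ↥(Hol D) :=
  {f | ∀ γ : ℝ → EN N, FiniteLengthPathTo D γ → ∀ c : ℂ,
    ∃ r : ℕ → ℝ, (∀ n, r n ∈ Ico (0:ℝ) 1) ∧ Tendsto r atTop (𝓝 1) ∧
      Tendsto (fun n => f.1 (γ (r n))) atTop (𝓝 c)}

/-- The `𝒪(D)`-hull of `K`. -/
def holHull {N : ℕ} (D K : Set (EN N)) : Set (EN N) :=
  {z ∈ D | ∀ φ : EN N → ℂ, DifferentiableOn ℂ φ D → ‖φ z‖ ≤ ⨆ w ∈ K, ‖φ w‖}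

/-- `K` is `𝒪(D)`-convex. -/
def HolConvexIn {N : ℕ} (D K : Set (EN N)) : Prop := K ⊆ D ∧ holHull D K = K

/-- The polynomial hull of a compact subset of `ℂ`. -/
def polyHull1 (E : Set ℂ) : Set ℂ :=
  {z | ∀ p : Polynomial ℂ, ‖p.eval z‖ ≤ ⨆ w ∈ E, ‖p.eval w‖}

/-- The polynomial hull of a subset of `ℂ^N`. -/
def polyHull {N : ℕ} (E : Set (EN N)) : Set (EN N) :=
  {z | ∀ p : MvPolynomial (Fin N) ℂ,
    ‖MvPolynomial.eval (fun j => z j) p‖ ≤ ⨆ w ∈ E, ‖MvPolynomial.eval (fun j => w j) p‖}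

/-- `E ⊆ ℂ^N` is polynomially convex. -/
def PolynomiallyConvex {N : ℕ} (E : Set (EN N)) : Prop := polyHull E = E

/-- The (real) Hessian of `ρ` at `p`, applied to the pair `(v, w)`. -/
def Hess {N : ℕ} (ρ : EN N → ℝ) (p v w : EN N) : ℝ :=
  fderiv ℝ (fderiv ℝ ρ) p v w

/-- The Levi form `∑_{j,k} ∂²ρ/∂z_j∂z̄_k (p) w_j w̄_k`, expressed through the real Hessian. -/
def LeviForm {N : ℕ} (ρ : EN N → ℝ) (p w : EN N) : ℝ :=
  (Hess ρ p w w + Hess ρ p (Complex.I • w) (Complex.I • w)) / 4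

/-- `w` belongs to the complex tangent space `{w : ∑_j ∂ρ/∂z_j(p) w_j = 0}` at `p`. -/
def ComplexTangent {N : ℕ} (ρ : EN N → ℝ) (p w : EN N) : Prop :=
  fderiv ℝ ρ p w = 0 ∧ fderiv ℝ ρ p (Complex.I • w) = 0

/-- `ρ` is a `C²` defining function for `D` on the open neighborhood `V` of `cl D`. -/
def IsDefiningFunctionOn {N : ℕ} (D : Set (EN N)) (ρ : EN N → ℝ) (V : Set (EN N)) : Prop :=
  IsOpen V ∧ closure D ⊆ V ∧ ContDiffOn ℝ 2 ρ V ∧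
  D = {z ∈ V | ρ z < 0} ∧ ∀ p ∈ frontier D, fderiv ℝ ρ p ≠ 0

/-- `D` is a strictly pseudoconvex domain with defining function `ρ`. -/
def StrictPSCWith {N : ℕ} (D : Set (EN N)) (ρ : EN N → ℝ) : Prop :=
  IsDomainSet D ∧ Bornology.IsBounded D ∧ (∃ V, IsDefiningFunctionOn D ρ V) ∧
  ∀ p ∈ frontier D, ∀ w : EN N, w ≠ 0 → ComplexTangent ρ p w → 0 < LeviForm ρ p w

/-- `D` is a strictly pseudoconvex domain. -/
def StrictlyPseudoconvex {N : ℕ} (D : Set (EN N)) : Prop := ∃ ρ, StrictPSCWith D ρ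

/-- `ρ` and `σ` are at `C²`-distance `< ε` on `V`. -/
def C2DistLt {N : ℕ} (V : Set (EN N)) (ρ σ : EN N → ℝ) (ε : ℝ) : Prop :=
  ∀ z ∈ V, |ρ z - σ z| + ‖fderiv ℝ ρ z - fderiv ℝ σ z‖ +
    ‖fderiv ℝ (fderiv ℝ ρ) z - fderiv ℝ (fderiv ℝ σ) z‖ < ε

/-- The standing assumptions on the map `γ : bD × [0,1] → cl D`: it is `C^k`, maps
`bD × [0,1)` into `D`, satisfies `γ(x,1) = x`, and the curves `r ↦ γ(x,r)` hit `bD`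
transversally at `x` (the `r`-derivative at `1` is not annihilated by `dρ(x)`,
i.e. it is not tangent to `bD` at `x`). -/
def GammaMap {N : ℕ} (D : Set (EN N)) (ρ : EN N → ℝ) (γ : EN N × ℝ → EN N) (k : ℕ) : Prop :=
  ContDiffOn ℝ k γ ((frontier D) ×ˢ Icc (0:ℝ) 1) ∧
  (∀ x ∈ frontier D, ∀ r ∈ Ico (0:ℝ) 1, γ (x, r) ∈ D) ∧
  (∀ x ∈ frontier D, γ (x, 1) = x) ∧
  ∀ x ∈ frontier D, fderiv ℝ ρ x (derivWithin (fun r => γ (x, r)) (Icc (0:ℝ) 1) 1) ≠ 0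

/-- Assumption (†): for all `r` close enough to `1`, `bD_r := γ(bD × {r})` bounds a strictly
pseudoconvex domain `D_r ⊆ D` whose defining function converges to `ρ` in `C²` norm on a
neighborhood `V` of `cl D` as `r → 1`. -/
def Dagger {N : ℕ} (D : Set (EN N)) (ρ : EN N → ℝ) (γ : EN N × ℝ → EN N) : Prop :=
  ∃ V : Set (EN N), IsOpen V ∧ closure D ⊆ V ∧
  ∃ (Dr : ℝ → Set (EN N)) (ρr : ℝ → EN N → ℝ),
    ∀ ε > 0, ∃ r₀ ∈ Ico (0:ℝ) 1, ∀ r ∈ Ioo r₀ 1,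
      StrictPSCWith (Dr r) (ρr r) ∧ Dr r ⊆ D ∧
      frontier (Dr r) = (fun x => γ (x, r)) '' frontier D ∧
      C2DistLt V (ρr r) ρ ε

/-- The `(2N-1)`-dimensional Hausdorff (surface) measure on `bD`. -/
def surfMeasure {N : ℕ} (D : Set (EN N)) : Measure (EN N) :=
  (Measure.hausdorffMeasure (2 * (N:ℝ) - 1)).restrict (frontier D)

/-- The normalized surface measure on `bD`. -/
def surfMeasureNorm {N : ℕ} (D : Set (EN N)) : Measure (EN N) :=
  ((Measure.hausdorffMeasure (2 * (N:ℝ) - 1) : Measure (EN N)) (frontier D))⁻¹ • surfMeasure D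

/-- The set `𝒲((r_j))` of `f ∈ 𝒪(D)` such that every measurable function on `bD` is an
a.e. limit of `f ∘ γ(·, r_{j_k})` along some subsequence of `(r_j)`. -/
def WSet {N : ℕ} (D : Set (EN N)) (γ : EN N × ℝ → EN N) (r : ℕ → ℝ) : Set ↥(Hol D) :=
  {f | ∀ h : EN N → ℂ, Measurable h → ∃ φ : ℕ → ℕ, StrictMono φ ∧
    ∀ᵐ x ∂ surfMeasure D, Tendsto (fun k => f.1 (γ (x, r (φ k)))) atTop (𝓝 (h x))}

/-- `Γ` is a closed cap of a convex set `V`: the closure of a connected component of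
`V \ H` for some real affine hyperplane `H` (for convex `V`, a nonempty open half-space
slice of `V`). -/
def IsClosedCap {N : ℕ} (V : Set (EN N)) (Γ : Set (EN N)) : Prop :=
  ∃ (l : EN N →L[ℝ] ℝ) (c : ℝ), l ≠ 0 ∧ (V ∩ {z | c < l z}).Nonempty ∧
    Γ = closure (V ∩ {z | c < l z})

/-- `V` is a strictly convex domain: a bounded convex domain with `C²` boundary whose
defining function has positive definite real Hessian on the real tangent space. -/
def StrictlyConvexDomain {N : ℕ} (V : Set (EN N)) : Prop :=
  IsDomainSet V ∧ Bornology.IsBounded V ∧ Convex ℝ V ∧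
  ∃ (ρ : EN N → ℝ) (W : Set (EN N)), IsDefiningFunctionOn V ρ W ∧
    ∀ p ∈ frontier V, ∀ w : EN N, w ≠ 0 → fderiv ℝ ρ p w = 0 → 0 < Hess ρ p w w

/-- The defining function `‖z‖² - 1` of the unit ball. -/
def ballRho {N : ℕ} : EN N → ℝ := fun z => ‖z‖ ^ 2 - 1

/-- The normalized surface measure on the unit sphere of `ℂ^N`. -/
def sphMeasure (N : ℕ) : Measure (EN N) :=
  ((Measure.hausdorffMeasure (2 * (N:ℝ) - 1) : Measure (EN N)) (Metric.sphere 0 1))⁻¹ •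
    (Measure.hausdorffMeasure (2 * (N:ℝ) - 1)).restrict (Metric.sphere 0 1)

/-- `v` is a weight: increasing on `[0,∞)`, nonnegative, and tending to `∞`. -/
def IsWeight (v : ℝ → ℝ) : Prop :=
  (∀ x ∈ Ici (0:ℝ), 0 ≤ v x) ∧ MonotoneOn v (Ici 0) ∧ Tendsto v atTop atTop

/-- The norm `‖f‖ = sup_{z ∈ 𝔹_N} |f z| / v(|z|)` of `H_v^0`. -/
def hvNorm {N : ℕ} (v : ℝ → ℝ) (f : EN N → ℂ) : ℝ :=
  ⨆ z ∈ Metric.ball (0:EN N) 1, ‖f z‖ / v ‖z‖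

/-- Membership in `H_v^0`: `f` is holomorphic on `𝔹_N` and `sup_{|z|=r} |f z| / v(r) → 0`
as `r → 1⁻`. -/
def MemHv {N : ℕ} (v : ℝ → ℝ) (f : EN N → ℂ) : Prop :=
  DifferentiableOn ℂ f (Metric.ball 0 1) ∧
  Tendsto (fun r : ℝ => ⨆ z ∈ Metric.sphere (0:EN N) r, ‖f z‖ / v r) (𝓝[<] 1) (𝓝 0)

/-- `S` contains, relatively to `H_v^0` with its norm topology, a dense `G_δ` subset:
there are countably many relatively norm-open sets `U n` whose intersection with `H_v^0`
is norm-dense in `H_v^0` and contained in `S`. -/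
def ResidualInHv {N : ℕ} (v : ℝ → ℝ) (S : Set (EN N → ℂ)) : Prop :=
  ∃ U : ℕ → Set (EN N → ℂ),
    (∀ n, ∀ f, MemHv v f → f ∈ U n →
      ∃ δ > 0, ∀ g, MemHv v g → hvNorm v (g - f) < δ → g ∈ U n) ∧
    (∀ f, MemHv v f → ∀ δ > 0, ∃ g, MemHv v g ∧ (∀ n, g ∈ U n) ∧ hvNorm v (g - f) < δ) ∧
    ∀ f, MemHv v f → (∀ n, f ∈ U n) → f ∈ S

/-- `S` is densely lineable in `H_v^0`: `S ∪ {0}` contains a norm-dense subspace of `H_v^0`. -/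
def DenselyLineableInHv {N : ℕ} (v : ℝ → ℝ) (S : Set (EN N → ℂ)) : Prop :=
  ∃ p : Submodule ℂ (EN N → ℂ), (↑p ⊆ {f : EN N → ℂ | MemHv v f}) ∧ (↑p ⊆ S ∪ {0}) ∧
    ∀ f, MemHv v f → ∀ δ > 0, ∃ g ∈ p, hvNorm v (g - f) < δ

/-- `S` is spaceable in `H_v^0`: `S ∪ {0}` contains a norm-closed infinite-dimensional
subspace of `H_v^0`. -/
def SpaceableInHv {N : ℕ} (v : ℝ → ℝ) (S : Set (EN N → ℂ)) : Prop :=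
  ∃ p : Submodule ℂ (EN N → ℂ), (↑p ⊆ {f : EN N → ℂ | MemHv v f}) ∧ (↑p ⊆ S ∪ {0}) ∧
    ¬ Module.Finite ℂ ↥p ∧
    ∀ f, MemHv v f → (∀ δ > 0, ∃ g ∈ p, hvNorm v (g - f) < δ) → f ∈ p

/-- The standing assumptions on the family `{γ_z : z ∈ 𝔹_N}`: each `γ_z` is a `C¹` map
`b𝔹_N × [0,1] → cl 𝔹_N` into `𝔹_N` for `r < 1` with `γ_z(x,1) = x`, transversal approach
and (†), with joint continuity of `(z,x,r) ↦ γ_z(x,r)` and of `(z,r) ↦ ∂γ_z(x,r)/∂r`. -/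
def BallGammaFamily {N : ℕ} (γ : EN N → EN N × ℝ → EN N) : Prop :=
  (∀ z ∈ Metric.ball (0:EN N) 1,
    GammaMap (Metric.ball 0 1) ballRho (γ z) 1 ∧ Dagger (Metric.ball 0 1) ballRho (γ z)) ∧
  ContinuousOn (fun p : EN N × (EN N × ℝ) => γ p.1 p.2)
    (Metric.ball 0 1 ×ˢ (Metric.sphere 0 1 ×ˢ Icc (0:ℝ) 1)) ∧
  ∀ x ∈ Metric.sphere (0:EN N) 1,
    ContinuousOn (fun p : EN N × ℝ => derivWithin (fun r => γ p.1 (x, r)) (Icc (0:ℝ) 1) p.2)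
      (Metric.ball 0 1 ×ˢ Icc (0:ℝ) 1)

/-- The set of `f` such that for every `z ∈ 𝔹_N`, every measurable function on `b𝔹_N` is an
a.e. limit of `f ∘ γ_z(·, r_{j_k})` along some subsequence of `(r_j)`. -/
def WSetHv {N : ℕ} (γ : EN N → EN N × ℝ → EN N) (r : ℕ → ℝ) : Set (EN N → ℂ) :=
  {f | ∀ z ∈ Metric.ball (0:EN N) 1, ∀ h : EN N → ℂ, Measurable h →
    ∃ φ : ℕ → ℕ, StrictMono φ ∧
      ∀ᵐ x ∂ sphMeasure N, Tendsto (fun k => f (γ z (x, r (φ k)))) atTop (𝓝 (h x))}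

/-- The set `E_L^* = {γ_z(x,r) : x ∈ E, r ∈ [0,1], z ∈ L}`. -/
def EStarSet {N : ℕ} (γ : EN N → EN N × ℝ → EN N) (L E : Set (EN N)) : Set (EN N) :=
  {w | ∃ z ∈ L, ∃ x ∈ E, ∃ r ∈ Icc (0:ℝ) 1, w = γ z (x, r)}

/-- The Korányi approach region `D_α(x)`. -/
def Koranyi {N : ℕ} (α : ℝ) (x : EN N) : Set (EN N) :=
  {z ∈ Metric.ball (0:EN N) 1 | ‖1 - (⟪x, z⟫_ℂ : ℂ)‖ < α / 2 * (1 - ‖z‖ ^ 2)}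

/-- `h` has a `K`-limit at `x`: for every `α > 1` the values of `h` converge along every
sequence in `D_α(x)` converging to `x`. -/
def HasKLimitAt {N : ℕ} (h : EN N → ℂ) (x : EN N) : Prop :=
  ∀ α > (1:ℝ), ∃ c : ℂ, ∀ z : ℕ → EN N, (∀ i, z i ∈ Koranyi α x) →
    Tendsto z atTop (𝓝 x) → Tendsto (fun i => h (z i)) atTop (𝓝 c)

/-- The circle `bL_x = L_x ∩ b𝔹_N` cut out on the complex line through `x` and `0`. -/
def lineCircle {N : ℕ} (x : EN N) : Set (EN N) :=
  {z | ∃ t : ℂ, z = t • x} ∩ Metric.sphere 0 1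

end

open Set Filter Topology Metric MeasureTheory
open scoped ENNReal NNReal InnerProductSpace ComplexConjugate

noncomputable section

/-- Wirtinger derivative in direction `v`. -/
def dz {N : ℕ} (v : EN N) (f : EN N → ℂ) (x : EN N) : ℂ :=
  (fderiv ℝ f x v - Complex.I * fderiv ℝ f x (Complex.I • v)) / 2

/-- Conjugate Wirtinger derivative in direction `v`. -/
def dzb {N : ℕ} (v : EN N) (f : EN N → ℂ) (x : EN N) : ℂ :=
  (fderiv ℝ f x v + Complex.I * fderiv ℝ f x (Complex.I • v)) / 2

/-- Reference Haar measure. -/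
abbrev vol (N : ℕ) : Measure (EN N) := Measure.addHaar

section wirt
variable {N : ℕ} {f g : EN N → ℂ} {x u v : EN N}

lemma dz_mul (hf : DifferentiableAt ℝ f x) (hg : DifferentiableAt ℝ g x) :
    dz v (fun y => f y * g y) x = dz v f x * g x + f x * dz v g x := by
  simp only [dz, fderiv_fun_mul hf hg, add_apply, smul_apply,
    smul_eq_mul]
  ring

lemma dzb_mul (hf : DifferentiableAt ℝ f x) (hg : DifferentiableAt ℝ g x) :
    dzb v (fun y => f y * g y) x = dzb v f x * g x + f x * dzb v g x := by
  simp only [dzb, fderiv_fun_mul hf hg, add_apply, smul_apply,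
    smul_eq_mul]
  ring

lemma dz_sub (hf : DifferentiableAt ℝ f x) (hg : DifferentiableAt ℝ g x) :
    dz v (fun y => f y - g y) x = dz v f x - dz v g x := by
  simp only [dz, fderiv_fun_sub hf hg, sub_apply]
  ring

lemma dzb_sub (hf : DifferentiableAt ℝ f x) (hg : DifferentiableAt ℝ g x) :
    dzb v (fun y => f y - g y) x = dzb v f x - dzb v g x := by
  simp only [dzb, fderiv_fun_sub hf hg, sub_apply]
  ring

lemma dzb_add (hf : DifferentiableAt ℝ f x) (hg : DifferentiableAt ℝ g x) :
    dzb v (fun y => f y + g y) x = dzb v f x + dzb v g x := by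
  simp only [dzb, fderiv_fun_add hf hg, add_apply]
  ring

lemma dzb_const_mul (c : ℂ) (hf : DifferentiableAt ℝ f x) :
    dzb v (fun y => c * f y) x = c * dzb v f x := by
  simp only [dzb, fderiv_const_mul hf, smul_apply, smul_eq_mul]
  ring

lemma fderiv_conj_comp (hf : DifferentiableAt ℝ f x) (v : EN N) :
    fderiv ℝ (fun y => conj (f y)) x v = conj (fderiv ℝ f x v) := by
  have h := (Complex.conjCLE.toContinuousLinearMap.hasFDerivAt (x := f x)).comp x hf.hasFDerivAt
  have : HasFDerivAt (fun y => conj (f y)) (Complex.conjCLE.toContinuousLinearMap.comp (fderiv ℝ f x)) x := h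
  rw [this.fderiv]; simp

lemma dz_conj (hf : DifferentiableAt ℝ f x) :
    dz v (fun y => conj (f y)) x = conj (dzb v f x) := by
  simp only [dz, dzb, fderiv_conj_comp hf]
  simp only [map_div₀, map_sub, map_add, map_mul, Complex.conj_I, map_ofNat]; ring

lemma dzb_conj (hf : DifferentiableAt ℝ f x) :
    dzb v (fun y => conj (f y)) x = conj (dz v f x) := by
  simp only [dz, dzb, fderiv_conj_comp hf]
  simp only [map_div₀, map_sub, map_add, map_mul, Complex.conj_I, map_ofNat]; ring

lemma contDiff_dz {n : ℕ} (hf : ContDiff ℝ (n + 1 : ℕ) f) (v : EN N) : ContDiff ℝ n (dz v f) := by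
  have h : ContDiff ℝ n (fderiv ℝ f) := hf.fderiv_right (by norm_cast)
  unfold dz
  fun_prop

lemma contDiff_dzb {n : ℕ} (hf : ContDiff ℝ (n + 1 : ℕ) f) (v : EN N) : ContDiff ℝ n (dzb v f) := by
  have h : ContDiff ℝ n (fderiv ℝ f) := hf.fderiv_right (by norm_cast)
  unfold dzb
  fun_prop

lemma hcs_dz (hf : HasCompactSupport f) (v : EN N) : HasCompactSupport (dz v f) := by
  have h := hf.fderiv (𝕜 := ℝ)
  refine h.mono ?_
  intro y hy
  simp only [Function.mem_support, ne_eq] at hy ⊢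
  intro h0; exact hy (by simp [dz, h0])

lemma hcs_dzb (hf : HasCompactSupport f) (v : EN N) : HasCompactSupport (dzb v f) := by
  have h := hf.fderiv (𝕜 := ℝ)
  refine h.mono ?_
  intro y hy
  simp only [Function.mem_support, ne_eq] at hy ⊢
  intro h0; exact hy (by simp [dzb, h0])

lemma fderiv_dir_apply (hf : ContDiff ℝ 2 f) (a b : EN N) :
    fderiv ℝ (fun y => fderiv ℝ f y a) x b = fderiv ℝ (fderiv ℝ f) x b a := by
  have h : DifferentiableAt ℝ (fderiv ℝ f) x :=
    (hf.fderiv_right (m := 1) (by norm_num)).differentiable (by norm_num) x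
  rw [fderiv_clm_apply h (differentiableAt_const _)]
  simp

lemma hess_symm_C (hf : ContDiff ℝ 2 f) (a b : EN N) :
    fderiv ℝ (fderiv ℝ f) x a b = fderiv ℝ (fderiv ℝ f) x b a := by
  have := (hf.contDiffAt (x := x)).isSymmSndFDerivAt (by simp)
  exact this a b

lemma diff_fderiv_apply (hf : ContDiff ℝ 2 f) (a : EN N) :
    DifferentiableAt ℝ (fun y => fderiv ℝ f y a) x := by
  have h : DifferentiableAt ℝ (fderiv ℝ f) x :=
    (hf.fderiv_right (m := 1) (by norm_num)).differentiable (by norm_num) x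
  fun_prop

lemma fderiv_dz (hf : ContDiff ℝ 2 f) (b : EN N) :
    fderiv ℝ (dz v f) x b = (fderiv ℝ (fderiv ℝ f) x b v
      - Complex.I * fderiv ℝ (fderiv ℝ f) x b (Complex.I • v)) / 2 := by
  have h1 := diff_fderiv_apply (x := x) hf v
  have h2 := diff_fderiv_apply (x := x) hf (Complex.I • v)
  have : dz v f = fun y => (1/2 : ℂ) * (fderiv ℝ f y v - Complex.I * fderiv ℝ f y (Complex.I • v)) := by
    ext y; simp [dz]; ring
  rw [this, fderiv_const_mul (by fun_prop), fderiv_fun_sub h1 (by fun_prop), fderiv_const_mul h2]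
  simp only [smul_apply, sub_apply, smul_eq_mul,
    fderiv_dir_apply hf]
  ring

lemma fderiv_dzb (hf : ContDiff ℝ 2 f) (b : EN N) :
    fderiv ℝ (dzb v f) x b = (fderiv ℝ (fderiv ℝ f) x b v
      + Complex.I * fderiv ℝ (fderiv ℝ f) x b (Complex.I • v)) / 2 := by
  have h1 := diff_fderiv_apply (x := x) hf v
  have h2 := diff_fderiv_apply (x := x) hf (Complex.I • v)
  have : dzb v f = fun y => (1/2 : ℂ) * (fderiv ℝ f y v + Complex.I * fderiv ℝ f y (Complex.I • v)) := by
    ext y; simp [dzb]; ring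
  rw [this, fderiv_const_mul (by fun_prop), fderiv_fun_add h1 (by fun_prop), fderiv_const_mul h2]
  simp only [smul_apply, add_apply, smul_eq_mul,
    fderiv_dir_apply hf]
  ring

lemma dzb_dz_comm (hf : ContDiff ℝ 2 f) : dzb u (dz v f) x = dz v (dzb u f) x := by
  rw [dzb, dz, fderiv_dz hf, fderiv_dz hf, fderiv_dzb hf, fderiv_dzb hf]
  rw [hess_symm_C hf v u, hess_symm_C hf (Complex.I • v) u, hess_symm_C hf v (Complex.I • u),
    hess_symm_C hf (Complex.I • v) (Complex.I • u)]
  ring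

lemma dzb_dzb_comm (hf : ContDiff ℝ 2 f) : dzb u (dzb v f) x = dzb v (dzb u f) x := by
  rw [dzb, dzb, fderiv_dzb hf, fderiv_dzb hf, fderiv_dzb hf, fderiv_dzb hf]
  rw [hess_symm_C hf v u, hess_symm_C hf (Complex.I • v) u, hess_symm_C hf v (Complex.I • u),
    hess_symm_C hf (Complex.I • v) (Complex.I • u)]
  ring

lemma integrable_C1cs (hf : Continuous f) (hs : HasCompactSupport f) : Integrable f (vol N) :=
  hf.integrable_of_hasCompactSupport hs

lemma integral_fderiv_zero (hf : ContDiff ℝ 1 f) (hs : HasCompactSupport f) (v : EN N) :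
    ∫ x, fderiv ℝ f x v ∂(vol N) = 0 := by
  have hd : Continuous (fun x => fderiv ℝ f x v) := by
    have := hf.continuous_fderiv (by norm_num)
    fun_prop
  have hds : HasCompactSupport (fun x => fderiv ℝ f x v) := hs.fderiv_apply (𝕜 := ℝ) v
  have := integral_smul_fderiv_eq_neg_fderiv_smul_of_integrable (μ := vol N) (𝕜 := ℝ)
    (f := fun _ : EN N => (1:ℝ)) (g := f) (v := v) (by simp)
    (by simpa using hd.integrable_of_hasCompactSupport hds)
    (by simpa using hf.continuous.integrable_of_hasCompactSupport hs)
    (by fun_prop) (fun x _ => hf.differentiable (by norm_num) x)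
  simpa using this

lemma integral_dz_zero (hf : ContDiff ℝ 1 f) (hs : HasCompactSupport f) (v : EN N) :
    ∫ x, dz v f x ∂(vol N) = 0 := by
  have hd : ∀ v, Continuous (fun x => fderiv ℝ f x v) := by
    have := hf.continuous_fderiv (by norm_num)
    fun_prop
  have hi : ∀ v, Integrable (fun x => fderiv ℝ f x v) (vol N) := fun v =>
    (hd v).integrable_of_hasCompactSupport (hs.fderiv_apply (𝕜 := ℝ) v)
  simp only [dz]
  rw [integral_div, integral_sub (hi v) ((hi _).const_mul _), integral_const_mul,
    integral_fderiv_zero hf hs, integral_fderiv_zero hf hs]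
  simp

lemma integral_dzb_zero (hf : ContDiff ℝ 1 f) (hs : HasCompactSupport f) (v : EN N) :
    ∫ x, dzb v f x ∂(vol N) = 0 := by
  have hd : ∀ v, Continuous (fun x => fderiv ℝ f x v) := by
    have := hf.continuous_fderiv (by norm_num)
    fun_prop
  have hi : ∀ v, Integrable (fun x => fderiv ℝ f x v) (vol N) := fun v =>
    (hd v).integrable_of_hasCompactSupport (hs.fderiv_apply (𝕜 := ℝ) v)
  simp only [dzb]
  rw [integral_div, integral_add (hi v) ((hi _).const_mul _), integral_const_mul,
    integral_fderiv_zero hf hs, integral_fderiv_zero hf hs]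
  simp
end wirt
end

open Set Filter Topology Metric MeasureTheory
open scoped ENNReal NNReal InnerProductSpace ComplexConjugate

noncomputable section
section p1
variable {N : ℕ} {f g a b : EN N → ℂ} {x u v : EN N} {ψ : EN N → ℝ}

lemma dz_smul (c : ℂ) (v : EN N) (f : EN N → ℂ) (x : EN N) : dz (c • v) f x = c * dz v f x := by
  have e1 : c • v = c.re • v + c.im • (Complex.I • v) := by
    conv_lhs => rw [← Complex.re_add_im c]
    rw [add_smul, mul_smul]; rfl
  have e2 : Complex.I • (c • v) = c.re • (Complex.I • v) - c.im • v := by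
    rw [e1, smul_add, smul_comm, smul_comm Complex.I c.im, smul_smul Complex.I Complex.I,
      Complex.I_mul_I]
    simp [sub_eq_add_neg]
  simp only [dz]
  rw [e2, e1]
  simp only [map_add, map_sub, map_smul, Complex.real_smul]
  conv_rhs => rw [← Complex.re_add_im c]
  linear_combination ((c.im : ℂ) * fderiv ℝ f x (Complex.I • v) / 2) * Complex.I_mul_I

lemma dzb_smul (c : ℂ) (v : EN N) (f : EN N → ℂ) (x : EN N) :
    dzb (c • v) f x = conj c * dzb v f x := by
  have e1 : c • v = c.re • v + c.im • (Complex.I • v) := by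
    conv_lhs => rw [← Complex.re_add_im c]
    rw [add_smul, mul_smul]; rfl
  have e2 : Complex.I • (c • v) = c.re • (Complex.I • v) - c.im • v := by
    rw [e1, smul_add, smul_comm, smul_comm Complex.I c.im, smul_smul Complex.I Complex.I,
      Complex.I_mul_I]
    simp [sub_eq_add_neg]
  have e3 : conj c = (c.re : ℂ) - c.im * Complex.I := by
    apply Complex.ext <;> simp
  simp only [dzb]
  rw [e2, e1, e3]
  simp only [map_add, map_sub, map_smul, Complex.real_smul]
  linear_combination ((c.im : ℂ) * fderiv ℝ f x (Complex.I • v) / 2) * Complex.I_mul_I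

lemma dz_add_dir (u v : EN N) (f : EN N → ℂ) (x : EN N) :
    dz (u + v) f x = dz u f x + dz v f x := by
  simp only [dz, smul_add, map_add]; ring

lemma dzb_add_dir (u v : EN N) (f : EN N → ℂ) (x : EN N) :
    dzb (u + v) f x = dzb u f x + dzb v f x := by
  simp only [dzb, smul_add, map_add]; ring

/-- standard basis vectors -/
abbrev bas {N : ℕ} (j : Fin N) : EN N := EuclideanSpace.single j (1:ℂ)

lemma sum_bas (w : EN N) : w = ∑ j, w j • (bas j) := by
  ext i
  simp [Pi.single_apply]

lemma dz_sum_dir (w : EN N) (f : EN N → ℂ) (x : EN N) :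
    dz w f x = ∑ j, w j * dz (bas j) f x := by
  have key : ∀ s : Finset (Fin N), dz (∑ j ∈ s, w j • (bas j : EN N)) f x
      = ∑ j ∈ s, w j * dz (bas j) f x := by
    intro s
    induction s using Finset.induction_on with
    | empty => simp [dz]
    | insert i s hi ih => rw [Finset.sum_insert hi, Finset.sum_insert hi, dz_add_dir, ih, dz_smul]
  conv_lhs => rw [sum_bas w]
  exact key _

lemma dzb_sum_dir (w : EN N) (f : EN N → ℂ) (x : EN N) :
    dzb w f x = ∑ j, conj (w j) * dzb (bas j) f x := by
  have key : ∀ s : Finset (Fin N), dzb (∑ j ∈ s, w j • (bas j : EN N)) f x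
      = ∑ j ∈ s, conj (w j) * dzb (bas j) f x := by
    intro s
    induction s using Finset.induction_on with
    | empty => simp [dzb]
    | insert i s hi ih => rw [Finset.sum_insert hi, Finset.sum_insert hi, dzb_add_dir, ih, dzb_smul]
  conv_lhs => rw [sum_bas w]
  exact key _

lemma contDiff_ofReal_comp {n : ℕ∞} (hψ : ContDiff ℝ n ψ) : ContDiff ℝ n (fun y => (ψ y : ℂ)) :=
  Complex.ofRealCLM.contDiff.comp hψ

lemma fderiv_ofReal_comp (h : DifferentiableAt ℝ ψ x) :
    fderiv ℝ (fun y => (ψ y : ℂ)) x = Complex.ofRealCLM.comp (fderiv ℝ ψ x) :=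
  (Complex.ofRealCLM.hasFDerivAt.comp x h.hasFDerivAt).fderiv

lemma fderiv2_ofReal_comp (hψ : ContDiff ℝ 2 ψ) :
    fderiv ℝ (fderiv ℝ (fun y => (ψ y : ℂ))) x u v = (Hess ψ x u v : ℂ) := by
  have h1 : fderiv ℝ (fun y => (ψ y : ℂ)) = fun y => Complex.ofRealCLM.comp (fderiv ℝ ψ y) := by
    ext1 y; exact fderiv_ofReal_comp (hψ.differentiable (by norm_num) y)
  have h : DifferentiableAt ℝ (fderiv ℝ ψ) x :=
    (hψ.fderiv_right (m := 1) (by norm_num)).differentiable (by norm_num) x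
  rw [h1, fderiv_clm_comp (differentiableAt_const _) h]
  simp [Hess]

lemma levi_eq_dzb_dz (hψ : ContDiff ℝ 2 ψ) (w : EN N) :
    dzb w (dz w (fun y => (ψ y : ℂ))) x = (LeviForm ψ x w : ℂ) := by
  have hC : ContDiff ℝ 2 (fun y => (ψ y : ℂ)) := contDiff_ofReal_comp (n := 2) hψ
  rw [dzb, fderiv_dz hC, fderiv_dz hC]
  rw [hess_symm_C hC w (Complex.I • w)]
  simp only [fderiv2_ofReal_comp hψ, LeviForm]
  push_cast
  linear_combination (-(Hess ψ x (Complex.I • w) (Complex.I • w) : ℂ)/4) * Complex.I_mul_I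

lemma levi_sum (hψ : ContDiff ℝ 2 ψ) (w : EN N) :
    (LeviForm ψ x w : ℂ) = ∑ j, ∑ k, dzb (bas k) (dz (bas j) (fun y => (ψ y : ℂ))) x
      * w j * conj (w k) := by
  have hC : ContDiff ℝ 2 (fun y => (ψ y : ℂ)) := contDiff_ofReal_comp (n := 2) hψ
  rw [← levi_eq_dzb_dz hψ, dzb_sum_dir]
  rw [Finset.sum_comm]
  refine Finset.sum_congr rfl fun k _ => ?_
  have : ∀ k : Fin N, dzb (bas k) (dz w (fun y => (ψ y : ℂ))) x =
      ∑ j, w j * dzb (bas k) (dz (bas j) (fun y => (ψ y : ℂ))) x := by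
    intro k
    rw [dzb_dz_comm hC, dz_sum_dir]
    simp_rw [dzb_dz_comm hC]
  rw [this, Finset.mul_sum]
  refine Finset.sum_congr rfl fun j _ => ?_
  ring

/-- The weighted adjoint derivative. -/
def dlt {N : ℕ} (ψ : EN N → ℝ) (v : EN N) (a : EN N → ℂ) (x : EN N) : ℂ :=
  dz v a x - dz v (fun y => (ψ y : ℂ)) x * a x

/-- complex-valued weight -/
def wt {N : ℕ} (ψ : EN N → ℝ) (x : EN N) : ℂ := (Real.exp (-ψ x) : ℂ)

lemma contDiff_wt (hψ : ContDiff ℝ 2 ψ) : ContDiff ℝ 2 (wt ψ) := by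
  have : ContDiff ℝ 2 (fun y => Real.exp (-ψ y)) := by fun_prop
  exact contDiff_ofReal_comp (n := 2) this

lemma fderiv_wt (hψ : ContDiff ℝ 2 ψ) : fderiv ℝ (wt ψ) x v
    = - (fderiv ℝ (fun y => (ψ y : ℂ)) x v) * wt ψ x := by
  have h1 : DifferentiableAt ℝ ψ x := hψ.differentiable (by norm_num) x
  have : DifferentiableAt ℝ (fun y => Real.exp (-ψ y)) x := by fun_prop
  unfold wt
  rw [fderiv_ofReal_comp this, fderiv_ofReal_comp h1]
  rw [fderiv_exp (by fun_prop)]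
  simp
  ring

lemma dz_wt (hψ : ContDiff ℝ 2 ψ) : dz v (wt ψ) x = - dz v (fun y => (ψ y : ℂ)) x * wt ψ x := by
  simp only [dz, fderiv_wt hψ]; ring

lemma dzb_wt (hψ : ContDiff ℝ 2 ψ) : dzb v (wt ψ) x = - dzb v (fun y => (ψ y : ℂ)) x * wt ψ x := by
  simp only [dzb, fderiv_wt hψ]; ring

lemma conj_dz_real (hψ : ContDiff ℝ 2 ψ) :
    conj (dz v (fun y => (ψ y : ℂ)) x) = dzb v (fun y => (ψ y : ℂ)) x := by
  have hC : ContDiff ℝ 2 (fun y => (ψ y : ℂ)) := contDiff_ofReal_comp (n := 2) hψ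
  rw [← dzb_conj (hC.differentiable (by norm_num) x)]
  simp

lemma contDiff_dlt (hψ : ContDiff ℝ 2 ψ) (ha : ContDiff ℝ 2 a) (v : EN N) :
    ContDiff ℝ 1 (dlt ψ v a) := by
  have hC : ContDiff ℝ 2 (fun y => (ψ y : ℂ)) := contDiff_ofReal_comp (n := 2) hψ
  have h1 := contDiff_dz (n := 1) hC v
  have h2 := contDiff_dz (n := 1) ha v
  have h3 : ContDiff ℝ 1 a := ha.of_le (by norm_num)
  unfold dlt
  exact h2.sub (h1.mul h3)

lemma p1_pointwise (hψ : ContDiff ℝ 2 ψ) (ha : ContDiff ℝ 2 a) (hb : ContDiff ℝ 2 b) :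
    dzb u (fun y => dlt ψ v a y * (conj (b y) * wt ψ y)) x
      - dz v (fun y => dzb u a y * (conj (b y) * wt ψ y)) x
    = dlt ψ v a x * conj (dlt ψ u b x) * wt ψ x
      - dzb u a x * conj (dzb v b x) * wt ψ x
      - dzb u (dz v (fun y => (ψ y : ℂ))) x * a x * conj (b x) * wt ψ x := by
  have hC : ContDiff ℝ 2 (fun y => (ψ y : ℂ)) := contDiff_ofReal_comp (n := 2) hψ
  have d1 : DifferentiableAt ℝ (dlt ψ v a) x := (contDiff_dlt hψ ha v).differentiable (by norm_num) x
  have d2 : DifferentiableAt ℝ (dzb u a) x :=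
    (contDiff_dzb (n := 1) ha u).differentiable (by norm_num) x
  have d2' : DifferentiableAt ℝ (dz v a) x :=
    (contDiff_dz (n := 1) ha v).differentiable (by norm_num) x
  have d2'' : DifferentiableAt ℝ (dz v (fun y => (ψ y : ℂ))) x :=
    (contDiff_dz (n := 1) hC v).differentiable (by norm_num) x
  have da : DifferentiableAt ℝ a x := ha.differentiable (by norm_num) x
  have db : DifferentiableAt ℝ b x := hb.differentiable (by norm_num) x
  have d3 : DifferentiableAt ℝ (fun y => conj (b y)) x :=
    Complex.conjCLE.toContinuousLinearMap.differentiableAt.comp x db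
  have d4 : DifferentiableAt ℝ (wt ψ) x := (contDiff_wt hψ).differentiable (by norm_num) x
  have d34 : DifferentiableAt ℝ (fun y => conj (b y) * wt ψ y) x := d3.mul d4
  have d5 : DifferentiableAt ℝ (fun y => dz v (fun y => (ψ y : ℂ)) y * a y) x := d2''.mul da
  rw [dzb_mul d1 d34, dz_mul d2 d34, dzb_mul d3 d4, dz_mul d3 d4, dz_conj db,
    dzb_conj db, dz_wt hψ, dzb_wt hψ]
  have e1 : dzb u (dlt ψ v a) x = dzb u (dz v a) x - (dzb u (dz v (fun y => (ψ y : ℂ))) x * a x +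
      dz v (fun y => (ψ y : ℂ)) x * dzb u a x) := by
    rw [← dzb_mul d2'' da, ← dzb_sub d2' d5]; rfl
  rw [e1, dzb_dz_comm ha]
  have e2 : conj (dlt ψ u b x) = conj (dz u b x) - dzb u (fun y => (ψ y : ℂ)) x * conj (b x) := by
    simp only [dlt, map_sub, map_mul, conj_dz_real hψ]
  rw [e2]
  ring

lemma conj_comp_contDiff {n : ℕ∞} (hb : ContDiff ℝ n b) : ContDiff ℝ n (fun y => conj (b y)) :=
  Complex.conjCLE.toContinuousLinearMap.contDiff.comp hb

lemma p1_pair (hψ : ContDiff ℝ 2 ψ) (ha : ContDiff ℝ 2 a) (hb : ContDiff ℝ 2 b)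
    (sb : HasCompactSupport b) :
    ∫ x, (dlt ψ v a x * conj (dlt ψ u b x) * wt ψ x
      - dzb u a x * conj (dzb v b x) * wt ψ x
      - dzb u (dz v (fun y => (ψ y : ℂ))) x * a x * conj (b x) * wt ψ x) ∂(vol N) = 0 := by
  simp_rw [← p1_pointwise hψ ha hb]
  have hw : ContDiff ℝ 1 (wt ψ) := (contDiff_wt hψ).of_le (by norm_num)
  have hcb : ContDiff ℝ 1 (fun y => conj (b y)) :=
    (conj_comp_contDiff (n := 2) hb).of_le (by norm_num)
  have sb' : HasCompactSupport (fun y => conj (b y)) := sb.comp_left (g := conj) (by simp)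
  have c1 : ContDiff ℝ 1 (fun y => dlt ψ v a y * (conj (b y) * wt ψ y)) :=
    (contDiff_dlt hψ ha v).mul (hcb.mul hw)
  have c2 : ContDiff ℝ 1 (fun y => dzb u a y * (conj (b y) * wt ψ y)) :=
    (contDiff_dzb (n := 1) ha u).mul (hcb.mul hw)
  have s1 : HasCompactSupport (fun y => dlt ψ v a y * (conj (b y) * wt ψ y)) :=
    (sb'.mul_right (f' := wt ψ)).mul_left
  have s2 : HasCompactSupport (fun y => dzb u a y * (conj (b y) * wt ψ y)) :=
    (sb'.mul_right (f' := wt ψ)).mul_left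
  rw [integral_sub, integral_dzb_zero c1 s1, integral_dz_zero c2 s2, sub_zero]
  · exact (contDiff_dzb (n := 0) c1 u).continuous.integrable_of_hasCompactSupport (hcs_dzb s1 u)
  · exact (contDiff_dz (n := 0) c2 v).continuous.integrable_of_hasCompactSupport (hcs_dz s2 v)
end p1
end

open Set Filter Topology Metric MeasureTheory
open scoped ENNReal NNReal InnerProductSpace ComplexConjugate

noncomputable section
section p1b
variable {N : ℕ} {ψ : EN N → ℝ}

/-- vector from a family of components -/
abbrev vec {N : ℕ} (α : Fin N → EN N → ℂ) (x : EN N) : EN N := WithLp.toLp 2 (fun j => α j x)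

lemma alg_curl (A : Fin N → Fin N → ℂ) :
    -(1/2) * ∑ j, ∑ k, ‖A j k - A k j‖^2 ≤ (∑ j, ∑ k, A j k * conj (A k j)).re := by
  rw [Complex.re_sum, Finset.mul_sum]
  refine Finset.sum_le_sum fun j _ => ?_
  rw [Complex.re_sum, Finset.mul_sum]
  refine Finset.sum_le_sum fun k _ => ?_
  rw [Complex.sq_norm, Complex.normSq_apply]
  simp only [Complex.mul_re, Complex.conj_re, Complex.conj_im, Complex.sub_re, Complex.sub_im]
  nlinarith [sq_nonneg (A j k).re, sq_nonneg (A j k).im, sq_nonneg (A k j).re, sq_nonneg (A k j).im]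

lemma p1_ineq (hψ : ContDiff ℝ 2 ψ) (α : Fin N → EN N → ℂ) (hα : ∀ j, ContDiff ℝ 2 (α j))
    (sα : ∀ j, HasCompactSupport (α j)) (c : EN N → ℝ)
    (hc : ∀ x w, (∃ j, α j x ≠ 0) → c x * ‖w‖^2 ≤ LeviForm ψ x w)
    (hci : Integrable (fun x => c x * (∑ j, ‖α j x‖^2) * Real.exp (-ψ x)) (vol N)) :
    ∫ x, c x * (∑ j, ‖α j x‖^2) * Real.exp (-ψ x) ∂(vol N) ≤
    ∫ x, (‖∑ j, dlt ψ (bas j) (α j) x‖^2 + (1/2) * ∑ j, ∑ k, ‖dzb (bas k) (α j) x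
      - dzb (bas j) (α k) x‖^2) * Real.exp (-ψ x) ∂(vol N) := by
  have hC : ContDiff ℝ 2 (fun y => (ψ y : ℂ)) := contDiff_ofReal_comp (n := 2) hψ
  set F : Fin N → Fin N → EN N → ℂ := fun j k x =>
    (dlt ψ (bas j) (α j) x * conj (dlt ψ (bas k) (α k) x) * wt ψ x
      - dzb (bas k) (α j) x * conj (dzb (bas j) (α k) x) * wt ψ x
      - dzb (bas k) (dz (bas j) (fun y => (ψ y : ℂ))) x * α j x * conj (α k x) * wt ψ x) with hF
  have cw : Continuous (wt ψ) := (contDiff_wt hψ).continuous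
  have cα : ∀ j, Continuous (α j) := fun j => (hα j).continuous
  have cd : ∀ j k, Continuous (dzb (bas k) (α j)) := fun j k =>
    (contDiff_dzb (n := 1) (hα j) _).continuous
  have cdl : ∀ j k, Continuous (dlt ψ (bas k) (α j)) := fun j k =>
    (contDiff_dlt hψ (hα j) _).continuous
  have cH : ∀ j k : Fin N, Continuous (dzb (bas k) (dz (bas j) (fun y => (ψ y : ℂ)))) := fun j k =>
    (contDiff_dzb (n := 0) (contDiff_dz (n := 1) hC _) _).continuous
  have cconj : Continuous (fun z : ℂ => conj z) := Complex.continuous_conj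
  have sdl : ∀ j, HasCompactSupport (dlt ψ (bas j) (α j)) := fun j =>
    (hcs_dz (sα j) _).sub ((sα j).mul_left)
  have sd : ∀ j k, HasCompactSupport (dzb (bas k) (α j)) := fun j k => hcs_dzb (sα j) _
  have iF : ∀ j k, Integrable (F j k) (vol N) := by
    intro j k
    apply Continuous.integrable_of_hasCompactSupport
    · simp only [hF]
      have := cdl; have := cd; have := cα; have := cH
      fun_prop
    · refine HasCompactSupport.sub (HasCompactSupport.sub ?_ ?_) ?_
      · exact (((sdl j).mul_right).mul_right)
      · exact (((sd j k).mul_right).mul_right)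
      · exact ((((sα j).mul_left).mul_right).mul_right)
  have h0 : ∫ x, (∑ j, ∑ k, F j k x).re ∂(vol N) = 0 := by
    have e : ∫ x, (∑ j, ∑ k, F j k x) ∂(vol N) = 0 := by
      rw [integral_finset_sum _ (fun j _ => integrable_finset_sum _ fun k _ => iF j k)]
      refine Finset.sum_eq_zero fun j _ => ?_
      rw [integral_finset_sum _ (fun k _ => iF j k)]
      exact Finset.sum_eq_zero fun k _ => p1_pair hψ (hα j) (hα k) (sα k)
    have iS : Integrable (fun x => ∑ j, ∑ k, F j k x) (vol N) :=
      integrable_finset_sum _ (fun j _ => integrable_finset_sum _ fun k _ => iF j k)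
    have := integral_re iS
    simp only [RCLike.re_eq_complex_re] at this
    rw [this, e]; simp
  have iR : Integrable (fun x => (‖∑ j, dlt ψ (bas j) (α j) x‖^2 + (1/2) * ∑ j, ∑ k,
      ‖dzb (bas k) (α j) x - dzb (bas j) (α k) x‖^2) * Real.exp (-ψ x)) (vol N) := by
    apply Continuous.integrable_of_hasCompactSupport
    · have := cdl; have := cd; have := hψ.continuous
      fun_prop
    · have hK : ∀ s : Finset (Fin N), HasCompactSupport (fun x => ∑ j ∈ s, dlt ψ (bas j) (α j) x) := by
        intro s
        induction s using Finset.induction_on with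
        | empty => simp [HasCompactSupport.zero, Pi.zero_def.symm]
        | insert i s hi ih => simp only [Finset.sum_insert hi]; exact (sdl i).add ih
      have hK2 : ∀ s t : Finset (Fin N), HasCompactSupport (fun x => ∑ j ∈ s, ∑ k ∈ t,
          ‖dzb (bas k) (α j) x - dzb (bas j) (α k) x‖^2) := by
        intro s t
        induction s using Finset.induction_on with
        | empty => simp [HasCompactSupport.zero, Pi.zero_def.symm]
        | insert i s hi ih =>
          simp only [Finset.sum_insert hi]; refine HasCompactSupport.add ?_ ih
          clear ih hi
          induction t using Finset.induction_on with
          | empty => simp [HasCompactSupport.zero, Pi.zero_def.symm]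
          | insert k t hk ih =>
            simp only [Finset.sum_insert hk]; refine HasCompactSupport.add ?_ ih
            exact ((sd i k).sub (sd k i)).comp_left (g := fun z : ℂ => ‖z‖^2) (by simp)
      refine HasCompactSupport.mul_right (HasCompactSupport.add ?_ ?_)
      · exact (hK _).comp_left (g := fun z : ℂ => ‖z‖^2) (by simp)
      · exact (hK2 _ _).mul_left
  rw [← sub_nonneg, ← integral_sub iR hci, ← h0]
  refine integral_mono ?_ (iR.sub hci) ?_
  · have iS : Integrable (fun x => ∑ j, ∑ k, F j k x) (vol N) :=
      integrable_finset_sum _ (fun j _ => integrable_finset_sum _ fun k _ => iF j k)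
    exact iS.re
  · intro x
    have hw : wt ψ x = ((Real.exp (-ψ x) : ℝ) : ℂ) := rfl
    have e1 : ∑ j, ∑ k, F j k x = (((∑ j, dlt ψ (bas j) (α j) x) * conj (∑ j, dlt ψ (bas j) (α j) x)
        - ∑ j, ∑ k, dzb (bas k) (α j) x * conj (dzb (bas j) (α k) x)
        - (LeviForm ψ x (vec α x) : ℂ))) * ((Real.exp (-ψ x) : ℝ) : ℂ) := by
      rw [levi_sum hψ, map_sum, Finset.sum_mul_sum, ← hw, sub_mul, sub_mul, Finset.sum_mul,
        Finset.sum_mul, Finset.sum_mul, ← Finset.sum_sub_distrib, ← Finset.sum_sub_distrib]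
      refine Finset.sum_congr rfl fun j _ => ?_
      rw [Finset.sum_mul, Finset.sum_mul, Finset.sum_mul, ← Finset.sum_sub_distrib,
        ← Finset.sum_sub_distrib]
    have hn : ‖vec α x‖^2 = ∑ j, ‖α j x‖^2 := by
      rw [EuclideanSpace.norm_sq_eq]
    have h1 : c x * (∑ j, ‖α j x‖^2) ≤ LeviForm ψ x (vec α x) := by
      by_cases hx : ∃ j, α j x ≠ 0
      · rw [← hn]; exact hc x _ hx
      · push Not at hx
        have : vec α x = 0 := by ext j; simp [hx]
        simp [this, hx, LeviForm, Hess]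
    have h2 := alg_curl (fun j k => dzb (bas k) (α j) x)
    dsimp only
    rw [e1, Complex.re_mul_ofReal, Complex.mul_conj, ← sub_mul]
    refine mul_le_mul_of_nonneg_right ?_ (Real.exp_pos _).le
    simp only [Complex.sub_re, Complex.ofReal_re, Complex.normSq_eq_norm_sq]
    linarith
end p1b
end

open Set Filter Topology Metric MeasureTheory
open scoped ENNReal NNReal InnerProductSpace ComplexConjugate ContDiff

noncomputable section
section kern
variable {N : ℕ} {δ : ℝ}

/-- unnormalized radial bump -/
def kern0 (N : ℕ) (δ : ℝ) (y : EN N) : ℝ := Real.smoothTransition (1 - ‖y‖^2 / δ^2)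

lemma kern0_contDiff : ContDiff ℝ ∞ (kern0 N δ) := by
  have h : ContDiff ℝ ∞ (fun y : EN N => 1 - ‖y‖^2 / δ^2) :=
    contDiff_const.sub ((contDiff_norm_sq ℂ).div_const _)
  exact Real.smoothTransition.contDiff.comp h

lemma kern0_nonneg (y : EN N) : 0 ≤ kern0 N δ y := Real.smoothTransition.nonneg _

lemma kern0_zero (hδ : 0 < δ) {y : EN N} (hy : δ ≤ ‖y‖) : kern0 N δ y = 0 := by
  apply Real.smoothTransition.zero_of_nonpos
  have : δ^2 ≤ ‖y‖^2 := by gcongr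
  have : 1 ≤ ‖y‖^2 / δ^2 := by rw [le_div_iff₀ (by positivity)]; linarith
  linarith

lemma kern0_pos (hδ : 0 < δ) {y : EN N} (hy : ‖y‖ < δ) : 0 < kern0 N δ y := by
  apply Real.smoothTransition.pos_of_pos
  have : ‖y‖^2 < δ^2 := by gcongr
  have : ‖y‖^2 / δ^2 < 1 := by rw [div_lt_iff₀ (by positivity)]; linarith
  linarith

lemma kern0_hcs (hδ : 0 < δ) : HasCompactSupport (kern0 N δ) := by
  refine HasCompactSupport.of_support_subset_isCompact (isCompact_closedBall (0 : EN N) δ) ?_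
  intro y hy
  simp only [mem_closedBall, dist_zero_right]
  by_contra h
  exact hy (kern0_zero hδ (not_le.mp h).le)

lemma kern0_int_pos (hδ : 0 < δ) : 0 < ∫ y, kern0 N δ y ∂(vol N) := by
  have hc : Continuous (kern0 N δ) := kern0_contDiff.continuous
  refine hc.integral_pos_of_hasCompactSupport_nonneg_nonzero (kern0_hcs hδ) kern0_nonneg (x := 0) ?_
  exact (kern0_pos hδ (by simpa using hδ)).ne'

/-- normalized radial bump -/
def kern (N : ℕ) (δ : ℝ) (y : EN N) : ℝ := kern0 N δ y / ∫ y, kern0 N δ y ∂(vol N)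

lemma kern_contDiff : ContDiff ℝ ∞ (kern N δ) := kern0_contDiff.div_const _

lemma kern_nonneg (y : EN N) : 0 ≤ kern N δ y :=
  div_nonneg (kern0_nonneg y) (integral_nonneg kern0_nonneg)

lemma kern_zero (hδ : 0 < δ) {y : EN N} (hy : δ ≤ ‖y‖) : kern N δ y = 0 := by
  simp [kern, kern0_zero hδ hy]

lemma kern_hcs (hδ : 0 < δ) : HasCompactSupport (kern N δ) := by
  refine HasCompactSupport.of_support_subset_isCompact (isCompact_closedBall (0 : EN N) δ) ?_
  intro y hy
  simp only [mem_closedBall, dist_zero_right]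
  by_contra h
  exact hy (kern_zero hδ (not_le.mp h).le)

lemma kern_integrable (hδ : 0 < δ) : Integrable (kern N δ) (vol N) :=
  kern_contDiff.continuous.integrable_of_hasCompactSupport (kern_hcs hδ)

lemma kern_int (hδ : 0 < δ) : ∫ y, kern N δ y ∂(vol N) = 1 := by
  simp only [kern]
  rw [integral_div, div_self (kern0_int_pos hδ).ne']

lemma kern_norm_eq {y z : EN N} (h : ‖y‖ = ‖z‖) : kern N δ y = kern N δ z := by
  simp [kern, kern0, h]

/-- complex-valued bump -/
def kc (N : ℕ) (δ : ℝ) (y : EN N) : ℂ := (kern N δ y : ℂ)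

lemma kc_contDiff : ContDiff ℝ ∞ (kc N δ) := contDiff_ofReal_comp (n := ⊤) kern_contDiff

lemma kc_hcs (hδ : 0 < δ) : HasCompactSupport (kc N δ) :=
  (kern_hcs hδ).comp_left (g := fun z : ℝ => (z : ℂ)) (by simp)

lemma kc_zero (hδ : 0 < δ) {y : EN N} (hy : δ ≤ ‖y‖) : kc N δ y = 0 := by
  simp [kc, kern_zero hδ hy]

lemma kc_integrable (hδ : 0 < δ) : Integrable (kc N δ) (vol N) :=
  kc_contDiff.continuous.integrable_of_hasCompactSupport (kc_hcs hδ)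

lemma kc_int (hδ : 0 < δ) : ∫ y, kc N δ y ∂(vol N) = 1 := by
  simp only [kc]
  rw [integral_complex_ofReal, kern_int hδ]; simp

lemma kc_norm_eq {y z : EN N} (h : ‖y‖ = ‖z‖) : kc N δ y = kc N δ z := by
  simp [kc, kern_norm_eq h]

/-- mollification -/
def moll {N : ℕ} (δ : ℝ) (f : EN N → ℂ) (x : EN N) : ℂ := ∫ y, kc N δ (x - y) * f y ∂(vol N)

lemma moll_eq_conv (f : EN N → ℂ) :
    moll δ f = convolution (kc N δ) f (ContinuousLinearMap.mul ℝ ℂ) (vol N) := by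
  ext x
  rw [convolution_eq_swap]
  rfl

lemma moll_eq_conv' (f : EN N → ℂ) (x : EN N) :
    moll δ f x = ∫ t, kc N δ t * f (x - t) ∂(vol N) := by
  rw [moll_eq_conv]; rfl

lemma moll_contDiff (hδ : 0 < δ) {f : EN N → ℂ} (hf : LocallyIntegrable f (vol N)) :
    ContDiff ℝ ∞ (moll δ f) := by
  rw [moll_eq_conv]
  exact (kc_hcs hδ).contDiff_convolution_left (n := ⊤) _ kc_contDiff hf

lemma kc_fderiv_hcs (hδ : 0 < δ) (v : EN N) : HasCompactSupport (fun y => fderiv ℝ (kc N δ) y v) :=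
  (kc_hcs hδ).fderiv_apply (𝕜 := ℝ) v

lemma kc_fderiv_cont (v : EN N) : Continuous (fun y => fderiv ℝ (kc N δ) y v) := by
  have := (kc_contDiff (N := N) (δ := δ)).continuous_fderiv (by norm_num)
  fun_prop

lemma cs_mul_integrable {η f : EN N → ℂ} (hη : Continuous η) (hs : HasCompactSupport η)
    (hf : LocallyIntegrable f (vol N)) : Integrable (fun y => η y * f y) (vol N) :=
  hf.integrable_smul_left_of_hasCompactSupport (g := η) hη hs

lemma hcs_reflect {η : EN N → ℂ} (hs : HasCompactSupport η) (x : EN N) :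
    HasCompactSupport (fun y => η (x - y)) :=
  hs.comp_homeomorph (Homeomorph.subLeft x)

lemma moll_fderiv (hδ : 0 < δ) {f : EN N → ℂ} (hf : LocallyIntegrable f (vol N)) (x v : EN N) :
    fderiv ℝ (moll δ f) x v = ∫ y, fderiv ℝ (kc N δ) (x - y) v * f y ∂(vol N) := by
  rw [moll_eq_conv, ((kc_hcs hδ).hasFDerivAt_convolution_left (ContinuousLinearMap.mul ℝ ℂ)
    (kc_contDiff.of_le (by norm_num)) hf x).fderiv, convolution_eq_swap]
  rw [ContinuousLinearMap.integral_apply]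
  · rfl
  · have h := ((kc_hcs (N := N) hδ).fderiv (𝕜 := ℝ)).convolutionExists_left
      (ContinuousLinearMap.precompL (EN N) (ContinuousLinearMap.mul ℝ ℂ))
      (kc_contDiff.continuous_fderiv (by norm_num)) hf x
    exact h.integrable_swap

lemma dzb_kc_reflect (x y v : EN N) :
    dzb v (fun y => kc N δ (x - y)) y = - dzb v (kc N δ) (x - y) := by
  have h : ∀ u, fderiv ℝ (fun y => kc N δ (x - y)) y u = - fderiv ℝ (kc N δ) (x - y) u := by
    intro u
    have hd : HasFDerivAt (kc N δ) (fderiv ℝ (kc N δ) (x - y)) (x - y) :=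
      ((kc_contDiff.differentiable (by norm_num)) _).hasFDerivAt
    have h2 : HasFDerivAt (fun y => x - y) (-(ContinuousLinearMap.id ℝ (EN N))) y := by
      simpa using (hasFDerivAt_id (𝕜 := ℝ) y).const_sub x
    have := (hd.comp y h2).fderiv
    change fderiv ℝ (kc N δ ∘ fun y => x - y) y u = _
    rw [this]; simp
  simp only [dzb, h]; ring

lemma dz_kc_reflect (x y v : EN N) :
    dz v (fun y => kc N δ (x - y)) y = - dz v (kc N δ) (x - y) := by
  have h : ∀ u, fderiv ℝ (fun y => kc N δ (x - y)) y u = - fderiv ℝ (kc N δ) (x - y) u := by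
    intro u
    have hd : HasFDerivAt (kc N δ) (fderiv ℝ (kc N δ) (x - y)) (x - y) :=
      ((kc_contDiff.differentiable (by norm_num)) _).hasFDerivAt
    have h2 : HasFDerivAt (fun y => x - y) (-(ContinuousLinearMap.id ℝ (EN N))) y := by
      simpa using (hasFDerivAt_id (𝕜 := ℝ) y).const_sub x
    have := (hd.comp y h2).fderiv
    change fderiv ℝ (kc N δ ∘ fun y => x - y) y u = _
    rw [this]; simp
  simp only [dz, h]; ring

lemma moll_dzb (hδ : 0 < δ) {f : EN N → ℂ} (hf : LocallyIntegrable f (vol N)) (x v : EN N) :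
    dzb v (moll δ f) x = - ∫ y, dzb v (fun y => kc N δ (x - y)) y * f y ∂(vol N) := by
  have i : ∀ v, Integrable (fun y => fderiv ℝ (kc N δ) (x - y) v * f y) (vol N) := fun v =>
    cs_mul_integrable ((kc_fderiv_cont v).comp (continuous_const.sub continuous_id))
      (hcs_reflect (kc_fderiv_hcs hδ v) x) hf
  simp_rw [dzb_kc_reflect]
  rw [dzb, moll_fderiv hδ hf, moll_fderiv hδ hf, ← integral_const_mul,
    ← integral_add (i _) ((i _).const_mul _), ← integral_div, ← integral_neg]
  refine integral_congr_ae (Eventually.of_forall fun y => ?_)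
  simp only [dzb]; ring

lemma moll_dz (hδ : 0 < δ) {f : EN N → ℂ} (hf : LocallyIntegrable f (vol N)) (x v : EN N) :
    dz v (moll δ f) x = - ∫ y, dz v (fun y => kc N δ (x - y)) y * f y ∂(vol N) := by
  have i : ∀ v, Integrable (fun y => fderiv ℝ (kc N δ) (x - y) v * f y) (vol N) := fun v =>
    cs_mul_integrable ((kc_fderiv_cont v).comp (continuous_const.sub continuous_id))
      (hcs_reflect (kc_fderiv_hcs hδ v) x) hf
  simp_rw [dz_kc_reflect]
  rw [dz, moll_fderiv hδ hf, moll_fderiv hδ hf, ← integral_const_mul,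
    ← integral_sub (i _) ((i _).const_mul _), ← integral_div, ← integral_neg]
  refine integral_congr_ae (Eventually.of_forall fun y => ?_)
  simp only [dz]; ring

lemma moll_support (hδ : 0 < δ) {f : EN N → ℂ} {S : Set (EN N)} (hf : ∀ y ∉ S, f y = 0)
    {x : EN N} (hx : ∀ y ∈ S, δ ≤ dist x y) : moll δ f x = 0 := by
  rw [moll]
  rw [integral_eq_zero_of_ae]
  refine Eventually.of_forall fun y => ?_
  by_cases hy : y ∈ S
  · have := hx y hy
    rw [dist_eq_norm] at this
    simp [kc_zero hδ this]
  · simp [hf y hy]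
end kern
end

open Set Filter Topology Metric MeasureTheory
open scoped ENNReal NNReal InnerProductSpace ComplexConjugate ContDiff

noncomputable section
section l2
variable {N : ℕ} {δ : ℝ}

lemma eLpNorm_two_sq {α : Type*} [MeasurableSpace α] {μ : Measure α} {F : Type*}
    [NormedAddCommGroup F] (f : α → F) :
    eLpNorm f 2 μ ^ 2 = ∫⁻ x, ‖f x‖ₑ ^ 2 ∂μ := by
  rw [eLpNorm_eq_lintegral_rpow_enorm_toReal (by norm_num) (by norm_num)]
  rw [← ENNReal.rpow_natCast, ← ENNReal.rpow_mul]
  norm_num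

lemma translation_tendsto {f : EN N → ℂ} (hf : MemLp f 2 (vol N)) :
    Tendsto (fun t : EN N => eLpNorm (fun x => f (x - t) - f x) 2 (vol N)) (𝓝 0) (𝓝 0) := by
  let g : EN N → C(EN N, EN N) := fun t => ⟨fun x => x - t, by fun_prop⟩
  have hg : Continuous g := ContinuousMap.continuous_of_continuous_uncurry _ (by
    simp only [g, Function.uncurry_def]; exact continuous_snd.sub continuous_fst)
  have hgm : ∀ t, MeasurePreserving (g t) (vol N) (vol N) := fun t => measurePreserving_sub_right _ t
  have := (continuous_const (y := hf.toLp f)).compMeasurePreservingLp hg hgm (by norm_num)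
  have h0 := this.tendsto 0
  rw [tendsto_iff_edist_tendsto_0] at h0
  refine h0.congr fun t => ?_
  have e1 : ∀ t, Lp.compMeasurePreserving (g t) (hgm t) (hf.toLp f)
      = (hf.comp_measurePreserving (hgm t)).toLp _ := fun t =>
    Lp.toLp_compMeasurePreserving hf (hgm t)
  rw [e1, e1, Lp.edist_toLp_toLp]
  refine eLpNorm_congr_ae (Eventually.of_forall fun x => ?_)
  simp [g]

lemma moll_congr_ae {f g : EN N → ℂ} (h : f =ᵐ[vol N] g) : moll δ f = moll δ g := by
  ext x
  refine integral_congr_ae ?_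
  filter_upwards [h] with y hy
  rw [hy]

lemma memLp_locInt {f : EN N → ℂ} (hf : MemLp f 2 (vol N)) : LocallyIntegrable f (vol N) :=
  hf.locallyIntegrable (by norm_num)

lemma moll_sub_bound (hδ : 0 < δ) {f : EN N → ℂ} (hf : MemLp f 2 (vol N)) (C : ℝ≥0∞)
    (hC : ∀ t : EN N, ‖t‖ < δ → eLpNorm (fun x => f (x - t) - f x) 2 (vol N) ≤ C) :
    eLpNorm (fun x => moll δ f x - f x) 2 (vol N) ≤ C := by
  wlog hm : StronglyMeasurable f generalizing f
  · have hae := hf.1.ae_eq_mk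
    have h1 : MemLp (hf.1.mk f) 2 (vol N) := (memLp_congr_ae hae).mp hf
    have key := this h1 (fun t ht => ?_) hf.1.stronglyMeasurable_mk
    · refine le_trans (le_of_eq ?_) key
      rw [moll_congr_ae hae]
      refine eLpNorm_congr_ae ?_
      filter_upwards [hae] with x hx
      rw [hx]
    · refine le_trans (le_of_eq ?_) (hC t ht)
      refine eLpNorm_congr_ae ?_
      have h2 : (fun x => f (x - t)) =ᵐ[vol N] fun x => hf.1.mk f (x - t) :=
        (measurePreserving_sub_right (vol N) t).quasiMeasurePreserving.ae_eq hae
      filter_upwards [hae, h2] with x hx hx2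
      rw [hx, hx2]
  have hk : Measurable (fun t : EN N => ENNReal.ofReal (kern N δ t)) :=
    (kern_contDiff.continuous.measurable).ennreal_ofReal
  set ν : Measure (EN N) := (vol N).withDensity (fun t => ENNReal.ofReal (kern N δ t)) with hν
  have hνp : IsProbabilityMeasure ν := ⟨by
    rw [hν, withDensity_apply _ MeasurableSet.univ, Measure.restrict_univ,
      ← ofReal_integral_eq_lintegral_ofReal (kern_integrable hδ)
        (Eventually.of_forall kern_nonneg), kern_int hδ, ENNReal.ofReal_one]⟩
  have hloc := memLp_locInt hf
  have hsub : ∀ x, Measurable (fun t => f (x - t) - f x) := fun x =>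
    (hm.measurable.comp (measurable_const.sub measurable_id)).sub measurable_const
  have hjen : ∀ x, ‖moll δ f x - f x‖ₑ ^ 2 ≤ ∫⁻ t, ‖f (x - t) - f x‖ₑ ^ 2 ∂ν := by
    intro x
    have e : moll δ f x - f x = ∫ t, kc N δ t * (f (x - t) - f x) ∂(vol N) := by
      have i1 : Integrable (fun t => kc N δ t * f (x - t)) (vol N) := by
        have := cs_mul_integrable (η := fun y => kc N δ (x - y))
          (kc_contDiff.continuous.comp (continuous_const.sub continuous_id))
          (hcs_reflect (kc_hcs hδ) x) hloc
        have h2 := this.comp_sub_left x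
        simpa using h2
      simp_rw [mul_sub]
      rw [integral_sub i1 ((kc_integrable hδ).mul_const _), integral_mul_const, kc_int hδ,
        moll_eq_conv', one_mul]
    have h1 : ‖moll δ f x - f x‖ₑ ≤ eLpNorm (fun t => f (x - t) - f x) 1 ν := by
      rw [e]
      refine (enorm_integral_le_lintegral_enorm _).trans (le_of_eq ?_)
      rw [eLpNorm_one_eq_lintegral_enorm, hν, lintegral_withDensity_eq_lintegral_mul _ hk
        (hsub x).enorm]
      refine lintegral_congr fun t => ?_
      simp only [Pi.mul_apply, enorm_mul, kc]
      congr 1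
      rw [← ofReal_norm_eq_enorm, Complex.norm_real, Real.norm_of_nonneg (kern_nonneg t)]
    have h2 := eLpNorm_le_eLpNorm_of_exponent_le (μ := ν) (p := 1) (q := 2) (by norm_num)
      (hsub x).aestronglyMeasurable
    calc ‖moll δ f x - f x‖ₑ ^ 2 ≤ (eLpNorm (fun t => f (x - t) - f x) 2 ν)^2 := by
          gcongr; exact h1.trans h2
      _ = _ := eLpNorm_two_sq _
  have hsq : eLpNorm (fun x => moll δ f x - f x) 2 (vol N) ^ 2 ≤ C ^ 2 := by
    rw [eLpNorm_two_sq]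
    calc ∫⁻ x, ‖moll δ f x - f x‖ₑ ^ 2 ∂(vol N)
        ≤ ∫⁻ x, ∫⁻ t, ‖f (x - t) - f x‖ₑ ^ 2 ∂ν ∂(vol N) := lintegral_mono hjen
      _ = ∫⁻ t, ∫⁻ x, ‖f (x - t) - f x‖ₑ ^ 2 ∂(vol N) ∂ν := by
          refine lintegral_lintegral_swap ?_
          have : Measurable (Function.uncurry fun (x t : EN N) => ‖f (x - t) - f x‖ₑ ^ 2) := by
            refine Measurable.pow_const ?_ 2
            refine Measurable.enorm ?_
            exact (hm.measurable.comp (measurable_fst.sub measurable_snd)).sub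
              (hm.measurable.comp measurable_fst)
          exact this.aemeasurable
      _ ≤ ∫⁻ t, C ^ 2 ∂ν := by
          refine lintegral_mono_ae ?_
          rw [hν, ae_withDensity_iff hk]
          refine Eventually.of_forall fun t ht => ?_
          rw [← eLpNorm_two_sq]
          gcongr
          apply hC
          by_contra hcon
          exact ht (by simp [kern_zero hδ (not_lt.mp hcon)])
      _ = C ^ 2 := by simp
  exact (ENNReal.pow_le_pow_left_iff (by norm_num)).mp hsq

/-- `L²` convergence of a sequence -/
structure L2lim {N : ℕ} (F : ℕ → EN N → ℂ) (G : EN N → ℂ) : Prop where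
  memF : ∀ n, MemLp (F n) 2 (vol N)
  memG : MemLp G 2 (vol N)
  lim : Tendsto (fun n => eLpNorm (fun x => F n x - G x) 2 (vol N)) atTop (𝓝 0)

/-- mollification scale -/
def sc (n : ℕ) : ℝ := 1 / ((n : ℝ) + 1)
lemma sc_pos (n : ℕ) : 0 < sc n := by unfold sc; positivity
lemma sc_tendsto : Tendsto sc atTop (𝓝 0) := tendsto_one_div_add_atTop_nhds_zero_nat

lemma L2lim_moll {f : EN N → ℂ} (hf : MemLp f 2 (vol N)) : L2lim (fun n => moll (sc n) f) f := by
  have hdiff : ∀ n, eLpNorm (fun x => moll (sc n) f x - f x) 2 (vol N) ≤ 2 * eLpNorm f 2 (vol N) := by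
    intro n
    refine moll_sub_bound (sc_pos n) hf _ fun t _ => ?_
    have h2 : eLpNorm (fun x => f (x - t)) 2 (vol N) = eLpNorm f 2 (vol N) :=
      eLpNorm_comp_measurePreserving (g := f) hf.1 (measurePreserving_sub_right (vol N) t)
    have hm : MemLp (fun x => f (x - t)) 2 (vol N) :=
      hf.comp_measurePreserving (measurePreserving_sub_right (vol N) t)
    refine (eLpNorm_sub_le hm.1 hf.1 (by norm_num)).trans ?_
    rw [h2, two_mul]
  have hcont : ∀ n, AEStronglyMeasurable (moll (sc n) f) (vol N) := fun n =>
    (moll_contDiff (sc_pos n) (memLp_locInt hf)).continuous.aestronglyMeasurable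
  refine ⟨fun n => ?_, hf, ?_⟩
  · have h1 : MemLp (fun x => moll (sc n) f x - f x) 2 (vol N) :=
      ⟨(hcont n).sub hf.1, (hdiff n).trans_lt (ENNReal.mul_lt_top (by norm_num) hf.2)⟩
    have := h1.add hf
    refine (memLp_congr_ae (Eventually.of_forall fun x => ?_)).mp this
    simp
  · rw [ENNReal.tendsto_nhds_zero]
    intro ε hε
    have ht := (ENNReal.tendsto_nhds_zero.mp (translation_tendsto hf)) ε hε
    obtain ⟨r, hr, hb⟩ := Metric.eventually_nhds_iff.mp ht
    filter_upwards [sc_tendsto.eventually (gt_mem_nhds hr)] with n hn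
    exact moll_sub_bound (sc_pos n) hf _ fun t h => hb (by simpa using h.trans hn)

lemma L2lim.add {F F' : ℕ → EN N → ℂ} {G G' : EN N → ℂ} (h : L2lim F G) (h' : L2lim F' G') :
    L2lim (fun n x => F n x + F' n x) (fun x => G x + G' x) := by
  refine ⟨fun n => (h.memF n).add (h'.memF n), h.memG.add h'.memG, ?_⟩
  have := h.lim.add h'.lim
  rw [add_zero] at this
  refine tendsto_of_tendsto_of_tendsto_of_le_of_le tendsto_const_nhds this (fun _ => zero_le)
    fun n => ?_
  refine le_trans (le_of_eq ?_) (eLpNorm_add_le ((h.memF n).sub h.memG).1 ((h'.memF n).sub h'.memG).1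
    (by norm_num))
  refine eLpNorm_congr_ae (Eventually.of_forall fun x => ?_)
  simp; ring

lemma L2lim.mul {F : ℕ → EN N → ℂ} {G : EN N → ℂ} (h : L2lim F G) {m : EN N → ℂ} {M : ℝ}
    (hm : AEStronglyMeasurable m (vol N)) (hM : ∀ x, ‖m x‖ ≤ M) :
    L2lim (fun n x => m x * F n x) (fun x => m x * G x) := by
  have key : ∀ H : EN N → ℂ, eLpNorm (fun x => m x * H x) 2 (vol N)
      ≤ ENNReal.ofReal M * eLpNorm H 2 (vol N) := by
    intro H
    refine eLpNorm_le_mul_eLpNorm_of_ae_le_mul (Eventually.of_forall fun x => ?_) 2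
    rw [norm_mul]; gcongr; exact hM x
  have mem : ∀ H : EN N → ℂ, MemLp H 2 (vol N) → MemLp (fun x => m x * H x) 2 (vol N) := fun H hH =>
    ⟨hm.mul hH.1, (key H).trans_lt (ENNReal.mul_lt_top (by simp) hH.2)⟩
  refine ⟨fun n => mem _ (h.memF n), mem _ h.memG, ?_⟩
  have := ENNReal.Tendsto.const_mul (a := ENNReal.ofReal M) h.lim (Or.inr (by simp))
  rw [mul_zero] at this
  refine tendsto_of_tendsto_of_tendsto_of_le_of_le tendsto_const_nhds this (fun _ => zero_le)
    fun n => ?_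
  refine le_trans (le_of_eq ?_) (key _)
  refine eLpNorm_congr_ae (Eventually.of_forall fun x => ?_)
  simp; ring

lemma L2lim.zero : L2lim (N := N) (fun _ _ => 0) (fun _ => 0) :=
  ⟨fun _ => MemLp.zero, MemLp.zero, by simp⟩

lemma L2lim.sum {ι : Type*} (s : Finset ι) {F : ι → ℕ → EN N → ℂ} {G : ι → EN N → ℂ}
    (h : ∀ i, L2lim (F i) (G i)) : L2lim (fun n x => ∑ i ∈ s, F i n x) (fun x => ∑ i ∈ s, G i x) := by
  classical
  induction s using Finset.induction_on with
  | empty => simpa using L2lim.zero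
  | insert i s hi ih => simp only [Finset.sum_insert hi]; exact (h i).add ih

lemma L2lim.integral_sq {F : ℕ → EN N → ℂ} {G : EN N → ℂ} (h : L2lim F G) :
    Tendsto (fun n => ∫ x, ‖F n x‖^2 ∂(vol N)) atTop (𝓝 (∫ x, ‖G x‖^2 ∂(vol N))) := by
  have e : ∀ H : EN N → ℂ, ∀ hH : MemLp H 2 (vol N), ∫ x, ‖H x‖^2 ∂(vol N) = ‖hH.toLp H‖^2 := by
    intro H hH
    rw [Lp.norm_toLp, ← ENNReal.toReal_pow, eLpNorm_two_sq,
      integral_eq_lintegral_of_nonneg_ae (f := fun x => ‖H x‖^2) (Eventually.of_forall fun x => by positivity)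
        (hH.1.norm.pow 2)]
    congr 1
    refine lintegral_congr fun x => ?_
    rw [ENNReal.ofReal_pow (norm_nonneg _), ofReal_norm_eq_enorm]
  have h1 : Tendsto (fun n => (h.memF n).toLp (F n)) atTop (𝓝 (h.memG.toLp G)) := by
    rw [tendsto_iff_edist_tendsto_0]
    refine h.lim.congr fun n => ?_
    rw [Lp.edist_toLp_toLp]; rfl
  simp_rw [e G h.memG, fun n => e (F n) (h.memF n)]
  exact h1.norm.pow 2

lemma L2lim.integral_wt {F : ℕ → EN N → ℂ} {G : EN N → ℂ} (h : L2lim F G) {m : EN N → ℝ} {M : ℝ}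
    (hm : Measurable m) (h0 : ∀ x, 0 ≤ m x) (hM : ∀ x, m x ≤ M) :
    Tendsto (fun n => ∫ x, m x * ‖F n x‖^2 ∂(vol N)) atTop (𝓝 (∫ x, m x * ‖G x‖^2 ∂(vol N))) := by
  have hs : Measurable (fun x => ((Real.sqrt (m x) : ℝ) : ℂ)) :=
    Complex.measurable_ofReal.comp hm.sqrt
  have := (h.mul hs.aestronglyMeasurable (M := Real.sqrt M) (fun x => by
    rw [Complex.norm_real, Real.norm_of_nonneg (Real.sqrt_nonneg _)]
    exact Real.sqrt_le_sqrt (hM x))).integral_sq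
  have e : ∀ x (z : ℂ), ‖((Real.sqrt (m x) : ℝ) : ℂ) * z‖^2 = m x * ‖z‖^2 := by
    intro x z
    rw [norm_mul, Complex.norm_real, Real.norm_of_nonneg (Real.sqrt_nonneg _), mul_pow,
      Real.sq_sqrt (h0 x)]
  simpa only [e] using this

lemma memLp_wt_integrable {G : EN N → ℂ} (hG : MemLp G 2 (vol N)) {m : EN N → ℝ} {M : ℝ}
    (hm : Measurable m) (hM : ∀ x, |m x| ≤ M) :
    Integrable (fun x => m x * ‖G x‖^2) (vol N) := by
  have h : Integrable (fun x => ‖G x‖^2) (vol N) := hG.integrable_norm_pow (by norm_num)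
  exact h.bdd_mul (c := M) hm.aestronglyMeasurable (Eventually.of_forall hM)
end l2
end

open Set Filter Topology Metric MeasureTheory
open scoped ENNReal NNReal InnerProductSpace ComplexConjugate ContDiff Manifold

noncomputable section
section cut
variable {N : ℕ}

lemma two_le_infty : (2 : WithTop ℕ∞) ≤ ((⊤:ℕ∞) : WithTop ℕ∞) := by
  exact WithTop.coe_le_coe.mpr (le_top : (2:ℕ∞) ≤ ⊤)

lemma exists_cutoff {S D : Set (EN N)} (hS : IsCompact S) (hD : IsOpen D) (h : S ⊆ D) :
    ∃ χ : EN N → ℝ, ContDiff ℝ ∞ χ ∧ (∀ x, 0 ≤ χ x ∧ χ x ≤ 1) ∧ HasCompactSupport χ ∧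
      tsupport χ ⊆ D ∧ ∀ᶠ x in 𝓝ˢ S, χ x = 1 := by
  obtain ⟨L, hL, hSL, hLD⟩ := exists_compact_between hS hD h
  obtain ⟨f, hf1, hf0, hf⟩ := exists_contMDiffMap_one_nhds_of_subset_interior (n := ⊤)
    𝓘(ℝ, EN N) (s := S) (t := L) hS.isClosed hSL
  have hsub : Function.support f ⊆ L := by
    intro x hx; by_contra hxL; exact hx (hf0 x hxL)
  have hts : tsupport f ⊆ L := closure_minimal hsub hL.isClosed
  refine ⟨f, f.contMDiff.contDiff, fun x => ⟨(hf x).1, (hf x).2⟩,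
    HasCompactSupport.of_support_subset_isCompact hL hsub, hts.trans hLD, hf1⟩

/-- Extension by zero of a `C^n` function times a cutoff -/
lemma cutoff_mul_contDiff {D : Set (EN N)} (hD : IsOpen D) {F : Type*} [NormedAddCommGroup F]
    [NormedSpace ℝ F] {n : ℕ∞} {χ : EN N → ℝ}
    (hχ : ContDiff ℝ n χ) (hs : tsupport χ ⊆ D) {ψ : EN N → F} (hψ : ContDiffOn ℝ n ψ D) :
    ContDiff ℝ n (fun x => χ x • ψ x) := by
  rw [contDiff_iff_contDiffAt]
  intro x
  by_cases hx : x ∈ D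
  · exact hχ.contDiffAt.smul (hψ.contDiffAt (hD.mem_nhds hx))
  · have : (fun x => χ x • ψ x) =ᶠ[𝓝 x] fun _ => 0 := by
      have hx' : x ∉ tsupport χ := fun h => hx (hs h)
      filter_upwards [(isClosed_tsupport χ).isOpen_compl.mem_nhds hx'] with y hy
      rw [image_eq_zero_of_notMem_tsupport hy, zero_smul]
    exact contDiffAt_const.congr_of_eventuallyEq this

lemma levi_congr {ψ ψ' : EN N → ℝ} {x : EN N} (h : ψ =ᶠ[𝓝 x] ψ') (w : EN N) :
    LeviForm ψ x w = LeviForm ψ' x w := by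
  have : fderiv ℝ ψ =ᶠ[𝓝 x] fderiv ℝ ψ' := h.fderiv
  simp only [LeviForm, Hess, this.fderiv_eq]

lemma dz_congr {f g : EN N → ℂ} {x : EN N} (h : f =ᶠ[𝓝 x] g) (v : EN N) : dz v f x = dz v g x := by
  simp only [dz, h.fderiv_eq]

lemma dzb_congr {f g : EN N → ℂ} {x : EN N} (h : f =ᶠ[𝓝 x] g) (v : EN N) :
    dzb v f x = dzb v g x := by
  simp only [dzb, h.fderiv_eq]

lemma bdd_of_hcs {F : Type*} [NormedAddCommGroup F] {f : EN N → F} (hf : Continuous f)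
    (hs : HasCompactSupport f) : ∃ M, ∀ x, ‖f x‖ ≤ M := hs.exists_bound_of_continuous hf

lemma indicator_meas {F : Type*} [TopologicalSpace F] [MeasurableSpace F] [BorelSpace F] [Zero F]
    {c : EN N → F} {S : Set (EN N)} (hc : ContinuousOn c S) (hS : MeasurableSet S) :
    Measurable (S.indicator c) := by
  classical
  rw [← piecewise_eq_indicator]
  exact hc.measurable_piecewise continuousOn_const hS

/-- Test functions on `D` -/
structure IsTest {N : ℕ} (D : Set (EN N)) (η : EN N → ℂ) : Prop where
  cd : ContDiff ℝ 2 η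
  cs : HasCompactSupport η
  sub : tsupport η ⊆ D

lemma kc_isTest {δ : ℝ} (hδ : 0 < δ) (x : EN N) : IsTest univ (fun y => kc N δ (x - y)) :=
  ⟨(kc_contDiff.comp (contDiff_const.sub contDiff_id)).of_le (two_le_infty),
    hcs_reflect (kc_hcs hδ) x, subset_univ _⟩

lemma moll_hcs {δ : ℝ} (hδ : 0 < δ) {f : EN N → ℂ} {S : Set (EN N)} (hS : IsCompact S)
    (hf : ∀ y ∉ S, f y = 0) : HasCompactSupport (moll δ f) := by
  refine HasCompactSupport.intro (hS.cthickening (r := δ)) fun x hx => ?_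
  refine moll_support hδ hf fun y hy => ?_
  by_contra hcon
  exact hx (mem_cthickening_of_dist_le x y δ S hy (not_le.mp hcon).le)

theorem p1_L2 {D : Set (EN N)} (hD : IsOpen D) {ψ : EN N → ℝ} (hψ : ContDiffOn ℝ 2 ψ D)
    {c : EN N → ℝ} (hcc : ContinuousOn c D) (hc0 : ∀ x ∈ D, 0 ≤ c x)
    (hc : ∀ x ∈ D, ∀ w, c x * ‖w‖^2 ≤ LeviForm ψ x w)
    {S : Set (EN N)} (hS : IsCompact S) (hSD : S ⊆ D)
    {β : Fin N → EN N → ℂ} (hβ : ∀ j, MemLp (β j) 2 (vol N)) (sβ : ∀ j, ∀ x ∉ S, β j x = 0)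
    {s : EN N → ℂ} (hs : MemLp s 2 (vol N)) (ss : ∀ x ∉ S, s x = 0)
    (ws : ∀ η, IsTest univ η → ∑ j, ∫ x, dz (bas j) η x * β j x ∂(vol N) = - ∫ x, η x * s x ∂(vol N))
    {γ : Fin N → Fin N → EN N → ℂ} (hγ : ∀ j k, MemLp (γ j k) 2 (vol N))
    (sγ : ∀ j k, ∀ x ∉ S, γ j k x = 0)
    (wγ : ∀ j k, ∀ η, IsTest univ η → ∫ x, dzb (bas k) η x * β j x ∂(vol N)
      - ∫ x, dzb (bas j) η x * β k x ∂(vol N) = - ∫ x, η x * γ j k x ∂(vol N)) :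
    ∫ x, c x * (∑ j, ‖β j x‖^2) * Real.exp (-ψ x) ∂(vol N) ≤
    ∫ x, (‖s x - ∑ j, dz (bas j) (fun y => (ψ y : ℂ)) x * β j x‖^2
      + (1/2) * ∑ j, ∑ k, ‖γ j k x‖^2) * Real.exp (-ψ x) ∂(vol N) := by
  obtain ⟨S', hS', hSS', hS'D⟩ := exists_compact_between hS hD hSD
  obtain ⟨χ, hχ, hχ01, hχs, hχD, hχ1⟩ := exists_cutoff hS' hD hS'D
  set ψ' : EN N → ℝ := fun x => χ x • ψ x with hψ'
  have cψ' : ContDiff ℝ 2 ψ' := cutoff_mul_contDiff (n := 2) hD (hχ.of_le (mod_cast le_top)) hχD hψ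
  have sψ' : HasCompactSupport ψ' := hχs.smul_right
  have eqψ : ∀ x ∈ S', ψ' =ᶠ[𝓝 x] ψ := by
    intro x hx
    have := (eventually_nhdsSet_iff_forall.mp hχ1) x hx
    filter_upwards [this] with y hy
    simp [hψ', hy]
  have cψC : ContDiff ℝ 2 (fun y => (ψ' y : ℂ)) := contDiff_ofReal_comp (n := 2) cψ'
  set c' : EN N → ℝ := S'.indicator c with hc'
  obtain ⟨Mψ, hMψ⟩ := bdd_of_hcs cψ'.continuous sψ'
  have hw : ∀ x, Real.exp (-ψ' x) ≤ Real.exp Mψ := fun x => by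
    have := hMψ x; rw [Real.norm_eq_abs] at this
    exact Real.exp_le_exp.mpr (by linarith [neg_abs_le (ψ' x)])
  have mw : Measurable (fun x => Real.exp (-ψ' x)) :=
    (Real.continuous_exp.comp cψ'.continuous.neg).measurable
  obtain ⟨Mc, hMc⟩ : ∃ M, ∀ x ∈ S', c x ≤ M := by
    obtain ⟨M, hM⟩ := hS'.exists_bound_of_continuousOn (hcc.mono hS'D)
    exact ⟨M, fun x hx => (le_abs_self _).trans (hM x hx)⟩
  have mc : Measurable c' := by
    have : ContinuousOn c S' := hcc.mono hS'D
    rw [hc']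
    exact indicator_meas this hS'.isClosed.measurableSet
  have c'0 : ∀ x, 0 ≤ c' x := fun x => indicator_nonneg (fun y hy => hc0 y (hS'D hy)) x
  have c'M : ∀ x, c' x ≤ max Mc 0 := fun x => by
    by_cases hx : x ∈ S'
    · rw [hc', indicator_of_mem hx]; exact (hMc x hx).trans (le_max_left _ _)
    · rw [hc', indicator_of_notMem hx]; exact le_max_right _ _
  have mcw : Measurable (fun x => c' x * Real.exp (-ψ' x)) := mc.mul mw
  have cw0 : ∀ x, 0 ≤ c' x * Real.exp (-ψ' x) := fun x => mul_nonneg (c'0 x) (Real.exp_pos _).le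
  have cwM : ∀ x, c' x * Real.exp (-ψ' x) ≤ max Mc 0 * Real.exp Mψ := fun x =>
    mul_le_mul (c'M x) (hw x) (Real.exp_pos _).le (le_max_right _ _)
  -- mollified forms
  set α : ℕ → Fin N → EN N → ℂ := fun n j => moll (sc n) (β j) with hα
  have lβ : ∀ j, L2lim (fun n => α n j) (β j) := fun j => L2lim_moll (hβ j)
  have cα : ∀ n j, ContDiff ℝ 2 (α n j) := fun n j =>
    (moll_contDiff (sc_pos n) (memLp_locInt (hβ j))).of_le (two_le_infty)
  have sα : ∀ n j, HasCompactSupport (α n j) := fun n j => moll_hcs (sc_pos n) hS (sβ j)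
  have edz : ∀ n x, ∑ j, dz (bas j) (α n j) x = moll (sc n) s x := by
    intro n x
    have h := ws _ (kc_isTest (sc_pos n) x)
    simp only [hα]
    simp_rw [fun j => moll_dz (sc_pos n) (memLp_locInt (hβ j)) x (bas j)]
    rw [Finset.sum_neg_distrib, h, neg_neg]; rfl
  have edzb : ∀ n j k x, dzb (bas k) (α n j) x - dzb (bas j) (α n k) x
      = moll (sc n) (γ j k) x := by
    intro n j k x
    have h := wγ j k _ (kc_isTest (sc_pos n) x)
    simp only [hα]
    rw [moll_dzb (sc_pos n) (memLp_locInt (hβ j)) x (bas k),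
      moll_dzb (sc_pos n) (memLp_locInt (hβ k)) x (bas j)]
    have h2 : moll (sc n) (γ j k) x = ∫ y, kc N (sc n) (x - y) * γ j k y ∂(vol N) := rfl
    rw [h2]
    linear_combination -h
  -- bounds of derivative of weight
  have bdz : ∀ j : Fin N, ∃ M, ∀ x, ‖dz (bas j) (fun y => (ψ' y : ℂ)) x‖ ≤ M := fun j =>
    bdd_of_hcs (contDiff_dz (n := 1) cψC _).continuous
      (hcs_dz (sψ'.comp_left (g := fun z : ℝ => (z : ℂ)) (by simp)) _)
  choose Md hMd using bdz
  have ldel : L2lim (fun n x => ∑ j, dlt ψ' (bas j) (α n j) x)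
      (fun x => s x - ∑ j, dz (bas j) (fun y => (ψ' y : ℂ)) x * β j x) := by
    have h1 := L2lim.sum Finset.univ (fun j => (lβ j).mul
      (contDiff_dz (n := 1) cψC (bas j)).continuous.aestronglyMeasurable (hMd j))
    have h2 := (L2lim_moll hs).add (h1.mul (m := fun _ => -1) (M := 1)
      aestronglyMeasurable_const (by simp))
    convert h2 using 1
    · ext n x
      simp only [dlt, Finset.sum_sub_distrib, edz]
      ring
    · ext x; ring
  have lγ : ∀ j k, L2lim (fun n x => dzb (bas k) (α n j) x - dzb (bas j) (α n k) x) (γ j k) := by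
    intro j k
    have := L2lim_moll (hγ j k)
    convert this using 1
    ext n x; exact edzb n j k x
  -- limits
  have habs : ∀ x, |c' x * Real.exp (-ψ' x)| ≤ max Mc 0 * Real.exp Mψ := fun x => by
    rw [abs_of_nonneg (cw0 x)]; exact cwM x
  have hwabs : ∀ x, |Real.exp (-ψ' x)| ≤ Real.exp Mψ := fun x => by
    rw [abs_of_nonneg (Real.exp_pos _).le]; exact hw x
  have eL : ∀ a : Fin N → EN N → ℂ, (∀ j, MemLp (a j) 2 (vol N)) →
      Integrable (fun x => c' x * (∑ j, ‖a j x‖^2) * Real.exp (-ψ' x)) (vol N) ∧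
      ∫ x, c' x * (∑ j, ‖a j x‖^2) * Real.exp (-ψ' x) ∂(vol N)
      = ∑ j, ∫ x, (c' x * Real.exp (-ψ' x)) * ‖a j x‖^2 ∂(vol N) := by
    intro a ha
    have e : (fun x => c' x * (∑ j, ‖a j x‖^2) * Real.exp (-ψ' x))
      = fun x => ∑ j, (c' x * Real.exp (-ψ' x)) * ‖a j x‖^2 := by
      ext x; rw [mul_right_comm, Finset.mul_sum]
    have i := fun j => memLp_wt_integrable (ha j) mcw habs
    rw [e]
    exact ⟨integrable_finset_sum _ fun j _ => i j, integral_finset_sum _ fun j _ => i j⟩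
  have eR : ∀ (t : EN N → ℂ) (g : Fin N → Fin N → EN N → ℂ), MemLp t 2 (vol N) →
      (∀ j k, MemLp (g j k) 2 (vol N)) →
      ∫ x, (‖t x‖^2 + (1/2) * ∑ j, ∑ k, ‖g j k x‖^2) * Real.exp (-ψ' x) ∂(vol N)
      = ∫ x, Real.exp (-ψ' x) * ‖t x‖^2 ∂(vol N)
        + (1/2) * ∑ j, ∑ k, ∫ x, Real.exp (-ψ' x) * ‖g j k x‖^2 ∂(vol N) := by
    intro t g ht hg
    have e : (fun x => (‖t x‖^2 + (1/2) * ∑ j, ∑ k, ‖g j k x‖^2) * Real.exp (-ψ' x))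
        = fun x => Real.exp (-ψ' x) * ‖t x‖^2
          + (1/2) * ∑ j, ∑ k, Real.exp (-ψ' x) * ‖g j k x‖^2 := by
      ext x
      simp_rw [← Finset.mul_sum]; ring
    have i1 := memLp_wt_integrable ht mw hwabs
    have i2 := fun j k => memLp_wt_integrable (hg j k) mw hwabs
    rw [e, integral_add i1 ((integrable_finset_sum _ fun j _ =>
      integrable_finset_sum _ fun k _ => i2 j k).const_mul _), integral_const_mul,
      integral_finset_sum _ (fun j _ => integrable_finset_sum _ fun k _ => i2 j k)]
    congr 2
    refine Finset.sum_congr rfl fun j _ => ?_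
    exact integral_finset_sum _ fun k _ => i2 j k
  -- inequality for large n
  obtain ⟨r, hr, hrS⟩ : ∃ r, 0 < r ∧ cthickening r S ⊆ S' := by
    obtain ⟨r, hr, h⟩ := hS.exists_cthickening_subset_open isOpen_interior hSS'
    exact ⟨r, hr, h.trans interior_subset⟩
  have hineq : ∀ᶠ n in atTop, ∑ j, ∫ x, (c' x * Real.exp (-ψ' x)) * ‖α n j x‖^2 ∂(vol N)
      ≤ ∫ x, Real.exp (-ψ' x) * ‖∑ j, dlt ψ' (bas j) (α n j) x‖^2 ∂(vol N)
        + (1/2) * ∑ j, ∑ k, ∫ x, Real.exp (-ψ' x) *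
          ‖dzb (bas k) (α n j) x - dzb (bas j) (α n k) x‖^2 ∂(vol N) := by
    filter_upwards [sc_tendsto.eventually (gt_mem_nhds hr)] with n hn
    have hmem := fun j => (lβ j).memF n
    rw [← (eL (α n) hmem).2, ← eR _ (fun j k x => dzb (bas k) (α n j) x - dzb (bas j) (α n k) x)
      (ldel.memF n) (fun j k => (lγ j k).memF n)]
    refine p1_ineq cψ' (α n) (cα n) (sα n) c' ?_ (eL (α n) hmem).1
    rintro x w ⟨j, hj⟩
    have hx : x ∈ S' := by
      by_contra hx
      refine hj (moll_support (sc_pos n) (sβ j) fun y hy => ?_)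
      by_contra hcon
      exact hx (hrS (mem_cthickening_of_dist_le x y r S hy ((not_le.mp hcon).le.trans hn.le)))
    rw [levi_congr (eqψ x hx), hc', indicator_of_mem hx]
    exact hc x (hS'D hx) w
  have lim1 : Tendsto (fun n => ∑ j, ∫ x, (c' x * Real.exp (-ψ' x)) * ‖α n j x‖^2 ∂(vol N)) atTop
      (𝓝 (∑ j, ∫ x, (c' x * Real.exp (-ψ' x)) * ‖β j x‖^2 ∂(vol N))) :=
    tendsto_finset_sum _ fun j _ => (lβ j).integral_wt mcw cw0 cwM
  have lim2 := (ldel.integral_wt mw (fun x => (Real.exp_pos _).le) hw).add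
    ((tendsto_finset_sum Finset.univ fun j _ => tendsto_finset_sum Finset.univ fun k _ =>
      (lγ j k).integral_wt mw (fun x => (Real.exp_pos _).le) hw).const_mul (1/2 : ℝ))
  have fin := le_of_tendsto_of_tendsto lim1 lim2 hineq
  rw [← (eL β hβ).2, ← eR _ γ ldel.memG hγ] at fin
  have hSS : S ⊆ S' := hSS'.trans interior_subset
  have eA : ∫ x, c x * (∑ j, ‖β j x‖^2) * Real.exp (-ψ x) ∂(vol N)
      = ∫ x, c' x * (∑ j, ‖β j x‖^2) * Real.exp (-ψ' x) ∂(vol N) := by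
    refine integral_congr_ae (Eventually.of_forall fun x => ?_)
    by_cases hx : x ∈ S
    · have e := (eqψ x (hSS hx)).self_of_nhds
      simp only [hc', indicator_of_mem (hSS hx), e]
    · simp [sβ _ x hx]
  have eB : ∫ x, (‖s x - ∑ j, dz (bas j) (fun y => (ψ y : ℂ)) x * β j x‖^2
      + (1/2) * ∑ j, ∑ k, ‖γ j k x‖^2) * Real.exp (-ψ x) ∂(vol N) =
      ∫ x, (‖s x - ∑ j, dz (bas j) (fun y => (ψ' y : ℂ)) x * β j x‖^2
      + (1/2) * ∑ j, ∑ k, ‖γ j k x‖^2) * Real.exp (-ψ' x) ∂(vol N) := by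
    refine integral_congr_ae (Eventually.of_forall fun x => ?_)
    by_cases hx : x ∈ S
    · have e := (eqψ x (hSS hx)).self_of_nhds
      have e2 : ∀ j : Fin N, dz (bas j) (fun y => (ψ y : ℂ)) x = dz (bas j) (fun y => (ψ' y : ℂ)) x := by
        intro j
        refine dz_congr ?_ _
        filter_upwards [eqψ x (hSS hx)] with y hy
        rw [hy]
      simp only [e, e2]
    · simp [sβ _ x hx, ss x hx, sγ _ _ x hx]
  rw [eA, eB]; exact fin
end cut
end

open Set Filter Topology Metric MeasureTheory
open scoped ENNReal NNReal InnerProductSpace ComplexConjugate ContDiff Manifold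

noncomputable section
section p2
variable {N : ℕ} {D : Set (EN N)}

/-- continuous functions with compact support in `D` -/
structure IsCS {N : ℕ} {F : Type*} [TopologicalSpace F] [Zero F] (D : Set (EN N)) (η : EN N → F) :
    Prop where
  ct : Continuous η
  cs : HasCompactSupport η
  sub : tsupport η ⊆ D

lemma IsTest.isCS {η : EN N → ℂ} (h : IsTest D η) : IsCS D η := ⟨h.cd.continuous, h.cs, h.sub⟩

lemma tsupport_dz {η : EN N → ℂ} (v : EN N) : tsupport (dz v η) ⊆ tsupport η := by
  refine closure_minimal (fun x hx => ?_) (isClosed_tsupport η)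
  by_contra h
  apply hx
  have : fderiv ℝ η x = 0 := by
    by_contra h2
    exact h (support_fderiv_subset ℝ h2)
  simp [dz, this]

lemma tsupport_dzb {η : EN N → ℂ} (v : EN N) : tsupport (dzb v η) ⊆ tsupport η := by
  refine closure_minimal (fun x hx => ?_) (isClosed_tsupport η)
  by_contra h
  apply hx
  have : fderiv ℝ η x = 0 := by
    by_contra h2
    exact h (support_fderiv_subset ℝ h2)
  simp [dzb, this]

lemma IsTest.dz_isCS {η : EN N → ℂ} (h : IsTest D η) (v : EN N) : IsCS D (dz v η) :=
  ⟨(contDiff_dz (n := 1) h.cd v).continuous, hcs_dz h.cs v, (tsupport_dz v).trans h.sub⟩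

lemma IsTest.dzb_isCS {η : EN N → ℂ} (h : IsTest D η) (v : EN N) : IsCS D (dzb v η) :=
  ⟨(contDiff_dzb (n := 1) h.cd v).continuous, hcs_dzb h.cs v, (tsupport_dzb v).trans h.sub⟩

lemma IsCS.mul_on {R : Type*} [NormedRing R] (hD : IsOpen D) {η F : EN N → R} (hη : IsCS D η)
    (hF : ContinuousOn F D) : IsCS D (fun x => η x * F x) := by
  refine ⟨?_, hη.cs.mul_right, (closure_mono (fun x hx => ?_)).trans hη.sub⟩
  · rw [continuous_iff_continuousAt]
    intro x
    by_cases hx : x ∈ D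
    · exact hη.ct.continuousAt.mul (hF.continuousAt (hD.mem_nhds hx))
    · have : (fun x => η x * F x) =ᶠ[𝓝 x] fun _ => 0 := by
        have hx' : x ∉ tsupport η := fun h => hx (hη.sub h)
        filter_upwards [(isClosed_tsupport η).isOpen_compl.mem_nhds hx'] with y hy
        rw [image_eq_zero_of_notMem_tsupport hy, zero_mul]
      exact continuousAt_const.congr this.symm
  · rw [Function.mem_support] at hx ⊢
    intro h0; apply hx; simp [h0]

lemma IsTest.mul_on (hD : IsOpen D) {η F : EN N → ℂ} (hη : IsTest D η)
    (hF : ContDiffOn ℝ 2 F D) : IsTest D (fun x => η x * F x) := by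
  have h := hη.isCS.mul_on hD hF.continuousOn
  refine ⟨?_, h.cs, h.sub⟩
  rw [contDiff_iff_contDiffAt]
  intro x
  by_cases hx : x ∈ D
  · exact hη.cd.contDiffAt.mul (hF.contDiffAt (hD.mem_nhds hx))
  · have : (fun x => η x * F x) =ᶠ[𝓝 x] fun _ => 0 := by
      have hx' : x ∉ tsupport η := fun h => hx (hη.sub h)
      filter_upwards [(isClosed_tsupport η).isOpen_compl.mem_nhds hx'] with y hy
      rw [image_eq_zero_of_notMem_tsupport hy, zero_mul]
    exact contDiffAt_const.congr_of_eventuallyEq this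

lemma IsTest.mul_left {η κ : EN N → ℂ} (hη : ContDiff ℝ 2 η) (hκ : IsTest D κ) :
    IsTest D (fun x => η x * κ x) := by
  refine ⟨hη.mul hκ.cd, hκ.cs.mul_left, (closure_mono (fun x hx => ?_)).trans hκ.sub⟩
  rw [Function.mem_support] at hx ⊢
  intro h0; apply hx; simp [h0]

lemma IsCS.bdd {F : Type*} [NormedAddCommGroup F] {η : EN N → F} (h : IsCS D η) :
    ∃ M, ∀ x, ‖η x‖ ≤ M := bdd_of_hcs h.ct h.cs

lemma memLp_bdd_mul {m A : EN N → ℂ} {M : ℝ} (hA : MemLp A 2 (vol N))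
    (hm : AEStronglyMeasurable m (vol N)) (hM : ∀ x, ‖m x‖ ≤ M) :
    MemLp (fun x => m x * A x) 2 (vol N) := by
  refine ⟨hm.mul hA.1, lt_of_le_of_lt (b := ENNReal.ofReal M * eLpNorm A 2 (vol N)) ?_
    (ENNReal.mul_lt_top (by simp) hA.2)⟩
  refine eLpNorm_le_mul_eLpNorm_of_ae_le_mul (Eventually.of_forall fun x => ?_) 2
  rw [norm_mul]; gcongr; exact hM x

lemma IsCS.memLp {m A : EN N → ℂ} (h : IsCS D m) (hA : MemLp A 2 (vol N)) :
    MemLp (fun x => m x * A x) 2 (vol N) := by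
  obtain ⟨M, hM⟩ := h.bdd
  exact memLp_bdd_mul hA h.ct.aestronglyMeasurable hM

lemma IsCS.integrable_mul {m A : EN N → ℂ} (h : IsCS D m) (hA : MemLp A 2 (vol N)) :
    Integrable (fun x => m x * A x) (vol N) := cs_mul_integrable h.ct h.cs (memLp_locInt hA)

lemma notMem_sub {F : Type*} [Zero F] {η : EN N → F} (h : tsupport η ⊆ D) {x : EN N} (hx : x ∉ D) : η x = 0 :=
  image_eq_zero_of_notMem_tsupport fun h' => hx (h h')

lemma ofReal_contDiffOn {n : ℕ∞} {f : EN N → ℝ} (hf : ContDiffOn ℝ n f D) :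
    ContDiffOn ℝ n (fun y => (f y : ℂ)) D := Complex.ofRealCLM.contDiff.comp_contDiffOn hf

lemma norm3_sq (a b c : ℂ) : ‖a - b - c‖^2 ≤ 3 * (‖a‖^2 + ‖b‖^2 + ‖c‖^2) := by
  have h : ‖a - b - c‖ ≤ ‖a‖ + ‖b‖ + ‖c‖ :=
    (norm_sub_le _ _).trans (add_le_add (norm_sub_le _ _) le_rfl)
  have h0 := norm_nonneg (a - b - c)
  nlinarith [sq_nonneg (‖a‖ - ‖b‖), sq_nonneg (‖a‖ - ‖c‖), sq_nonneg (‖b‖ - ‖c‖),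
    norm_nonneg a, norm_nonneg b, norm_nonneg c]

lemma norm2_sq (a b : ℂ) : ‖a - b‖^2 ≤ 2 * (‖a‖^2 + ‖b‖^2) := by
  have h : ‖a - b‖ ≤ ‖a‖ + ‖b‖ := norm_sub_le _ _
  have h0 := norm_nonneg (a - b)
  nlinarith [sq_nonneg (‖a‖ - ‖b‖), norm_nonneg a, norm_nonneg b]

lemma cs_sum (a b : Fin N → ℂ) : ‖∑ j, a j * b j‖^2 ≤ (∑ j, ‖a j‖^2) * ∑ j, ‖b j‖^2 := by
  have h1 : ‖∑ j, a j * b j‖ ≤ ∑ j, ‖a j‖ * ‖b j‖ := by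
    refine (norm_sum_le _ _).trans (le_of_eq ?_)
    simp only [norm_mul]
  calc ‖∑ j, a j * b j‖^2 ≤ (∑ j, ‖a j‖ * ‖b j‖)^2 := by gcongr
    _ ≤ _ := Finset.sum_mul_sq_le_sq_mul_sq _ _ _

lemma curl_sum (a b : Fin N → ℂ) :
    (1/2) * ∑ j, ∑ k, ‖a k * b j - a j * b k‖^2 ≤ 2 * ((∑ j, ‖a j‖^2) * ∑ j, ‖b j‖^2) := by
  have : ∑ j, ∑ k, ‖a k * b j - a j * b k‖^2
      ≤ ∑ j, ∑ k, 2 * (‖a k‖^2 * ‖b j‖^2 + ‖a j‖^2 * ‖b k‖^2) := by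
    refine Finset.sum_le_sum fun j _ => Finset.sum_le_sum fun k _ => ?_
    refine (norm2_sq _ _).trans (le_of_eq ?_)
    rw [norm_mul, norm_mul, mul_pow, mul_pow]
  have e : ∑ j, ∑ k, 2 * (‖a k‖^2 * ‖b j‖^2 + ‖a j‖^2 * ‖b k‖^2)
      = 4 * ((∑ j, ‖a j‖^2) * ∑ j, ‖b j‖^2) := by
    simp_rw [← Finset.mul_sum, Finset.sum_add_distrib, ← Finset.mul_sum, ← Finset.sum_mul,
      ← Finset.mul_sum]
    ring
  linarith

lemma dz_ofReal_sub {f g : EN N → ℝ} {x v : EN N} (hf : DifferentiableAt ℝ f x)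
    (hg : DifferentiableAt ℝ g x) :
    dz v (fun y => ((f y - g y : ℝ) : ℂ)) x
      = dz v (fun y => (f y : ℂ)) x - dz v (fun y => (g y : ℂ)) x := by
  rw [← dz_sub (f := fun y => (f y : ℂ)) (g := fun y => (g y : ℂ))
    (Complex.ofRealCLM.differentiableAt.comp x hf)
    (Complex.ofRealCLM.differentiableAt.comp x hg)]
  simp

lemma dz_exp_real {f : EN N → ℝ} {x v : EN N} (hf : DifferentiableAt ℝ f x) :
    dz v (fun y => ((Real.exp (f y) : ℝ) : ℂ)) x
      = dz v (fun y => (f y : ℂ)) x * (Real.exp (f x) : ℂ) := by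
  have h1 : fderiv ℝ (fun y => Real.exp (f y)) x = Real.exp (f x) • fderiv ℝ f x :=
    hf.hasFDerivAt.exp.fderiv
  simp only [dz]
  rw [fderiv_ofReal_comp hf, fderiv_ofReal_comp (ψ := fun y => Real.exp (f y)) hf.exp, h1]
  simp
  ring

lemma continuousOn_dz (hD : IsOpen D) {f : EN N → ℂ} (hf : ContDiffOn ℝ 1 f D) (v : EN N) :
    ContinuousOn (dz v f) D := by
  have h := hf.continuousOn_fderiv_of_isOpen hD le_rfl
  have h1 : ContinuousOn (fun x => fderiv ℝ f x v) D := h.clm_apply continuousOn_const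
  have h2 : ContinuousOn (fun x => fderiv ℝ f x (Complex.I • v)) D := h.clm_apply continuousOn_const
  exact (h1.sub (continuousOn_const.mul h2)).div_const 2

end p2
end

open Set Filter Topology Metric MeasureTheory
open scoped ENNReal NNReal InnerProductSpace ComplexConjugate ContDiff Manifold

noncomputable section
section p2
variable {N : ℕ} {D : Set (EN N)}

/-- `|∂θ|²` -/
def gsq {N : ℕ} (θ : EN N → ℝ) (x : EN N) : ℝ := ∑ j : Fin N, ‖dz (bas j) (fun y => (θ y : ℂ)) x‖^2

lemma gsq_nonneg (θ : EN N → ℝ) (x : EN N) : 0 ≤ gsq θ x := Finset.sum_nonneg fun _ _ => by positivity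

lemma gsq_contOn (hD : IsOpen D) {θ : EN N → ℝ} (hθ : ContDiffOn ℝ 1 θ D) : ContinuousOn (gsq θ) D := by
  unfold gsq
  refine continuousOn_finset_sum _ fun j _ => ?_
  exact ((continuousOn_dz hD (ofReal_contDiffOn (n := 1) hθ) _).norm).pow 2

lemma weak_mul {B : Fin N → EN N → ℂ} {Q : EN N → ℂ}
    (hB : ∀ m, IsCS D m → ∀ j, Integrable (fun x => m x * B j x) (vol N))
    (hw : ∀ η, IsTest D η → ∑ j, ∫ x, dz (bas j) η x * B j x ∂(vol N) = ∫ x, η x * Q x ∂(vol N))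
    {κ : EN N → ℂ} (hκ : IsTest D κ) {η : EN N → ℂ} (hη : ContDiff ℝ 2 η)
    (hQ : Integrable (fun x => η x * κ x * Q x) (vol N)) :
    ∑ j, ∫ x, dz (bas j) η x * (κ x * B j x) ∂(vol N)
      = - ∫ x, η x * (∑ j, dz (bas j) κ x * B j x - κ x * Q x) ∂(vol N) := by
  have h := hw _ (hκ.mul_left hη)
  have i1 : ∀ j, Integrable (fun x => dz (bas j) η x * (κ x * B j x)) (vol N) := fun j => by
    have : IsCS D (fun x => κ x * dz (bas j) η x) := ⟨hκ.isCS.ct.mul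
      (contDiff_dz (n := 1) hη _).continuous, hκ.cs.mul_right, (closure_mono (fun x hx => by
        rw [Function.mem_support] at hx ⊢; intro h0; apply hx; simp [h0])).trans hκ.sub⟩
    refine (hB _ this j).congr (Eventually.of_forall fun x => ?_)
    ring
  have i2 : ∀ j, Integrable (fun x => η x * (dz (bas j) κ x * B j x)) (vol N) := fun j => by
    have : IsCS D (fun x => dz (bas j) κ x * η x) := ⟨(hκ.dz_isCS _).ct.mul
      hη.continuous, (hκ.dz_isCS _).cs.mul_right, (closure_mono (fun x hx => by
        rw [Function.mem_support] at hx ⊢; intro h0; apply hx; simp [h0])).trans (hκ.dz_isCS (bas j)).sub⟩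
    refine (hB _ this j).congr (Eventually.of_forall fun x => ?_)
    ring
  have e : ∀ j, ∫ x, dz (bas j) (fun x => η x * κ x) x * B j x ∂(vol N)
      = ∫ x, dz (bas j) η x * (κ x * B j x) ∂(vol N)
        + ∫ x, η x * (dz (bas j) κ x * B j x) ∂(vol N) := by
    intro j
    rw [← integral_add (i1 j) (i2 j)]
    refine integral_congr_ae (Eventually.of_forall fun x => ?_)
    simp only
    rw [dz_mul (hη.differentiable (by norm_num) x) (hκ.cd.differentiable (by norm_num) x)]
    ring
  simp_rw [e, Finset.sum_add_distrib] at h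
  have e2 : ∫ x, η x * (∑ j, dz (bas j) κ x * B j x - κ x * Q x) ∂(vol N)
      = ∑ j, ∫ x, η x * (dz (bas j) κ x * B j x) ∂(vol N) - ∫ x, η x * κ x * Q x ∂(vol N) := by
    rw [← integral_finset_sum _ (fun j _ => i2 j), ← integral_sub
      (integrable_finset_sum _ fun j _ => i2 j) hQ]
    refine integral_congr_ae (Eventually.of_forall fun x => ?_)
    simp only [mul_sub, Finset.mul_sum]
    ring
  rw [e2]
  linear_combination h

lemma weak_mul_b {B : Fin N → EN N → ℂ}
    (hB : ∀ m, IsCS D m → ∀ j, Integrable (fun x => m x * B j x) (vol N))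
    {j k : Fin N}
    (hw : ∀ η, IsTest D η → ∫ x, dzb (bas k) η x * B j x ∂(vol N)
      - ∫ x, dzb (bas j) η x * B k x ∂(vol N) = 0)
    {κ : EN N → ℂ} (hκ : IsTest D κ) {η : EN N → ℂ} (hη : ContDiff ℝ 2 η) :
    ∫ x, dzb (bas k) η x * (κ x * B j x) ∂(vol N) - ∫ x, dzb (bas j) η x * (κ x * B k x) ∂(vol N)
      = - ∫ x, η x * (dzb (bas k) κ x * B j x - dzb (bas j) κ x * B k x) ∂(vol N) := by
  have h := hw _ (hκ.mul_left hη)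
  have i1 : ∀ j k, Integrable (fun x => dzb (bas k) η x * (κ x * B j x)) (vol N) := fun j k => by
    have : IsCS D (fun x => κ x * dzb (bas k) η x) := ⟨hκ.isCS.ct.mul
      (contDiff_dzb (n := 1) hη _).continuous, hκ.cs.mul_right, (closure_mono (fun x hx => by
        rw [Function.mem_support] at hx ⊢; intro h0; apply hx; simp [h0])).trans hκ.sub⟩
    refine (hB _ this j).congr (Eventually.of_forall fun x => ?_)
    ring
  have i2 : ∀ j k, Integrable (fun x => η x * (dzb (bas k) κ x * B j x)) (vol N) := fun j k => by
    have : IsCS D (fun x => dzb (bas k) κ x * η x) := ⟨(hκ.dzb_isCS _).ct.mul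
      hη.continuous, (hκ.dzb_isCS _).cs.mul_right, (closure_mono (fun x hx => by
        rw [Function.mem_support] at hx ⊢; intro h0; apply hx; simp [h0])).trans (hκ.dzb_isCS (bas k)).sub⟩
    refine (hB _ this j).congr (Eventually.of_forall fun x => ?_)
    ring
  have e : ∀ j k, ∫ x, dzb (bas k) (fun x => η x * κ x) x * B j x ∂(vol N)
      = ∫ x, dzb (bas k) η x * (κ x * B j x) ∂(vol N)
        + ∫ x, η x * (dzb (bas k) κ x * B j x) ∂(vol N) := by
    intro j k
    rw [← integral_add (i1 j k) (i2 j k)]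
    refine integral_congr_ae (Eventually.of_forall fun x => ?_)
    simp only
    rw [dzb_mul (hη.differentiable (by norm_num) x) (hκ.cd.differentiable (by norm_num) x)]
    ring
  simp_rw [e] at h
  have e2 : ∫ x, η x * (dzb (bas k) κ x * B j x - dzb (bas j) κ x * B k x) ∂(vol N)
      = ∫ x, η x * (dzb (bas k) κ x * B j x) ∂(vol N)
        - ∫ x, η x * (dzb (bas j) κ x * B k x) ∂(vol N) := by
    rw [← integral_sub (i2 _ _) (i2 _ _)]
    refine integral_congr_ae (Eventually.of_forall fun x => ?_)
    simp only [mul_sub]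
  rw [e2]
  linear_combination h
end p2
end

open Set Filter Topology Metric MeasureTheory
open scoped ENNReal NNReal InnerProductSpace ComplexConjugate ContDiff Manifold

noncomputable section
section p2
variable {N : ℕ} {D : Set (EN N)}

/-- `e^{g}` as complex function -/
def cexpR {N : ℕ} (g : EN N → ℝ) (x : EN N) : ℂ := ((Real.exp (g x) : ℝ) : ℂ)

lemma cexpR_contDiffOn {n : ℕ∞} {g : EN N → ℝ} (h : ContDiffOn ℝ n g D) :
    ContDiffOn ℝ n (cexpR g) D := ofReal_contDiffOn (n := n) h.exp

lemma norm_cexpR (g : EN N → ℝ) (x : EN N) : ‖cexpR g x‖ = Real.exp (g x) := by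
  rw [cexpR, Complex.norm_real, Real.norm_eq_abs, abs_of_pos (Real.exp_pos _)]

theorem p2_step (hD : IsOpen D) {ψ θ : EN N → ℝ} (hψ : ContDiffOn ℝ 2 ψ D) (hθ : ContDiffOn ℝ 2 θ D)
    (hL : ∀ x ∈ D, ∀ w, (3 * gsq θ x + 3 * Real.exp (θ x)) * ‖w‖^2 ≤ LeviForm ψ x w)
    {A : Fin N → EN N → ℂ} (hA : ∀ j, MemLp (A j) 2 (vol N)) {T : EN N → ℂ} (hT : MemLp T 2 (vol N))
    (hZ : ∀ j k η, IsTest D η → ∫ x, dzb (bas k) η x * (cexpR (fun y => (ψ y - θ y) / 2) x * A j x) ∂(vol N)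
      - ∫ x, dzb (bas j) η x * (cexpR (fun y => (ψ y - θ y) / 2) x * A k x) ∂(vol N) = 0)
    (hW : ∀ η, IsTest D η →
      ∑ j, ∫ x, dz (bas j) η x * (cexpR (fun y => -(ψ y - θ y) / 2) x * A j x) ∂(vol N)
        = ∫ x, η x * (cexpR (fun y => -(ψ y - 2 * θ y) / 2) x * T x) ∂(vol N))
    {χ : EN N → ℝ} (hχ : IsTest D (fun x => (χ x : ℂ))) (hχr : ContDiff ℝ 2 χ) :
    3 * ∫ x, χ x ^ 2 * ∑ j, ‖A j x‖^2 ∂(vol N) ≤ 3 * ∫ x, χ x ^ 2 * ‖T x‖^2 ∂(vol N)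
      + 5 * ∫ x, gsq χ x * Real.exp (-θ x) * ∑ j, ‖A j x‖^2 ∂(vol N) := by
  set ep := cexpR (fun y => (ψ y - θ y) / 2) with hep
  set em := cexpR (fun y => -(ψ y - θ y) / 2) with hem
  set eq := cexpR (fun y => -(ψ y - 2 * θ y) / 2) with heq
  have dep : ContDiffOn ℝ 2 ep D := cexpR_contDiffOn (n := 2) ((hψ.sub hθ).div_const 2)
  have dem : ContDiffOn ℝ 2 em D := cexpR_contDiffOn (n := 2) ((hψ.sub hθ).neg.div_const 2)
  have deq : ContDiffOn ℝ 2 eq D :=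
    cexpR_contDiffOn (n := 2) ((hψ.sub (contDiffOn_const.mul hθ)).neg.div_const 2)
  set κ : EN N → ℂ := fun x => (χ x : ℂ) * cexpR (fun y => ψ y - θ y) x with hκd
  have hκ : IsTest D κ := hχ.mul_on hD (cexpR_contDiffOn (n := 2) (hψ.sub hθ))
  have hcs : IsCompact (tsupport fun x => (χ x : ℂ)) := hχ.cs
  set S := tsupport fun x => (χ x : ℂ) with hS
  have emp : ∀ x, cexpR (fun y => ψ y - θ y) x * em x = ep x := fun x => by
    simp only [hep, hem, cexpR]
    rw [← Complex.ofReal_mul, ← Real.exp_add]; congr 2; ring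
  have eqp : ∀ x, cexpR (fun y => ψ y - θ y) x * eq x = cexpR (fun y => ψ y / 2) x := fun x => by
    simp only [heq, cexpR]
    rw [← Complex.ofReal_mul, ← Real.exp_add]; congr 2; ring
  -- the weighted functions
  have hBe : ∀ F, ContinuousOn F D → ∀ m, IsCS D m → ∀ G, MemLp G 2 (vol N) →
      MemLp (fun x => m x * (F x * G x)) 2 (vol N) := fun F hF m hm G hG => by
    have := (hm.mul_on hD hF).memLp hG
    refine this.ae_eq (Eventually.of_forall fun x => ?_)
    exact mul_assoc _ _ _
  have hBi : ∀ F, ContinuousOn F D → ∀ m, IsCS D m → ∀ G, MemLp G 2 (vol N) →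
      Integrable (fun x => m x * (F x * G x)) (vol N) := fun F hF m hm G hG => by
    have := (hm.mul_on hD hF).integrable_mul hG
    refine this.congr (Eventually.of_forall fun x => ?_)
    exact mul_assoc _ _ _
  have offS : ∀ x ∉ S, χ x = 0 := fun x hx => by
    have := image_eq_zero_of_notMem_tsupport hx
    exact_mod_cast this
  have offdz : ∀ j : Fin N, ∀ x ∉ S, dz (bas j) (fun x => (χ x : ℂ)) x = 0 := fun j x hx =>
    image_eq_zero_of_notMem_tsupport fun h => hx (tsupport_dz _ h)
  have offdzb : ∀ j : Fin N, ∀ x ∉ S, dzb (bas j) (fun x => (χ x : ℂ)) x = 0 := fun j x hx =>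
    image_eq_zero_of_notMem_tsupport fun h => hx (tsupport_dzb _ h)
  have κsub : tsupport κ ⊆ S := closure_mono fun x hx => by
    rw [Function.mem_support] at hx ⊢; intro h0; apply hx
    simp only [hκd, h0, zero_mul]
  have κ0 : ∀ x ∉ S, κ x = 0 := fun x hx => by simp [hκd, offS x hx]
  have offκ : ∀ j : Fin N, ∀ x ∉ S, dz (bas j) κ x = 0 := fun j x hx =>
    image_eq_zero_of_notMem_tsupport fun h => hx (κsub (tsupport_dz _ h))
  have key := p1_L2 hD hψ (c := fun x => 3 * gsq θ x + 3 * Real.exp (θ x))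
    ((continuousOn_const.mul (gsq_contOn hD (hθ.of_le (by norm_num)))).add
      (continuousOn_const.mul hθ.continuousOn.rexp))
    (fun x hx => by have := gsq_nonneg θ x; positivity) hL hcs hχ.sub
    (β := fun j x => (χ x : ℂ) * (ep x * A j x))
    (fun j => hBe ep dep.continuousOn _ hχ.isCS _ (hA j))
    (fun j x hx => by simp [offS x hx])
    (s := fun x => ∑ j, dz (bas j) κ x * (em x * A j x) - κ x * (eq x * T x))
    ((memLp_finset_sum _ fun j _ => hBe em dem.continuousOn _ (hκ.dz_isCS _) _ (hA j)).sub
      (hBe eq deq.continuousOn _ hκ.isCS _ hT))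
    (fun x hx => by simp [κ0 x hx, offκ _ x hx])
    (by
      intro η hη
      rw [← weak_mul (B := fun j x => em x * A j x) (Q := fun x => eq x * T x)
        (fun m hm j => hBi em dem.continuousOn m hm _ (hA j)) hW hκ hη.cd]
      · refine Finset.sum_congr rfl fun j _ => ?_
        congr 1; ext x
        simp only [hκd]
        rw [← emp]; ring
      · exact hBi eq deq.continuousOn _ (hκ.mul_left hη.cd).isCS _ hT)
    (γ := fun j k x => dzb (bas k) (fun x => (χ x : ℂ)) x * (ep x * A j x)
      - dzb (bas j) (fun x => (χ x : ℂ)) x * (ep x * A k x))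
    (fun j k => (hBe ep dep.continuousOn _ (hχ.dzb_isCS _) _ (hA j)).sub
      (hBe ep dep.continuousOn _ (hχ.dzb_isCS _) _ (hA k)))
    (fun j k x hx => by simp [offdzb _ x hx])
    (fun j k η hη => weak_mul_b (B := fun j x => ep x * A j x)
        (fun m hm j => hBi ep dep.continuousOn m hm _ (hA j)) (hZ j k) hχ hη.cd)
  -- now the bookkeeping
  have hSd : ∀ x ∈ S, x ∈ D := fun x hx => hχ.sub hx
  set P : EN N → ℝ := fun x => ∑ j, ‖A j x‖^2 with hP
  have P0 : ∀ x, 0 ≤ P x := fun x => Finset.sum_nonneg fun _ _ => by positivity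
  have wint : ∀ m : EN N → ℝ, IsCS D m → Integrable (fun x => m x * P x) (vol N) := fun m hm => by
    obtain ⟨M, hM⟩ := hm.bdd
    have : (fun x => m x * P x) = fun x => ∑ j, m x * ‖A j x‖^2 := by
      ext x; rw [hP, Finset.mul_sum]
    rw [this]
    exact integrable_finset_sum _ fun j _ => memLp_wt_integrable (hA j) hm.ct.measurable hM
  have rχ : IsCS D χ := by
    refine ⟨hχr.continuous, ?_, ?_⟩
    · exact HasCompactSupport.intro hcs offS
    · refine (closure_minimal (fun x hx => ?_) (isClosed_tsupport _)).trans hχ.sub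
      by_contra h; exact hx (offS x h)
  have rχ2 : IsCS D (fun x => χ x ^ 2) := by
    simp_rw [pow_two]; exact rχ.mul_on hD rχ.ct.continuousOn
  have gχ : IsCS D (gsq χ) := by
    have hz : ∀ x ∉ S, gsq χ x = 0 := fun x hx => by simp [gsq, offdz _ x hx]
    refine ⟨?_, HasCompactSupport.intro hcs hz, ?_⟩
    · rw [← continuousOn_univ]
      exact gsq_contOn isOpen_univ (hχr.contDiffOn.of_le (by norm_num))
    · refine (closure_minimal (fun x hx => ?_) (isClosed_tsupport _)).trans hχ.sub
      by_contra h; exact hx (hz x h)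
  have cθ : ContinuousOn (fun x => Real.exp (-θ x)) D := hθ.continuousOn.neg.rexp
  have i1 := wint _ rχ2
  have i2 := wint _ (gχ.mul_on hD cθ)
  have i3 : Integrable (fun x => χ x ^ 2 * (gsq θ x * Real.exp (-θ x)) * P x) (vol N) :=
    wint _ (rχ2.mul_on hD ((gsq_contOn hD (hθ.of_le (by norm_num))).mul cθ))
  have i4 : Integrable (fun x => χ x ^ 2 * ‖T x‖^2) (vol N) := by
    obtain ⟨M, hM⟩ := rχ2.bdd
    exact memLp_wt_integrable hT rχ2.ct.measurable hM
  have lhs : ∫ x, (3 * gsq θ x + 3 * Real.exp (θ x)) * (∑ j, ‖(χ x : ℂ) * (ep x * A j x)‖^2)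
      * Real.exp (-ψ x) ∂(vol N) = 3 * ∫ x, χ x ^ 2 * P x ∂(vol N)
      + 3 * ∫ x, χ x ^ 2 * (gsq θ x * Real.exp (-θ x)) * P x ∂(vol N) := by
    rw [← integral_const_mul, ← integral_const_mul, ← integral_add (i1.const_mul 3) (i3.const_mul 3)]
    refine integral_congr_ae (Eventually.of_forall fun x => ?_)
    have e1 : ∑ j, ‖(χ x : ℂ) * (ep x * A j x)‖^2 = χ x ^ 2 * Real.exp (ψ x - θ x) * P x := by
      rw [hP, Finset.mul_sum]
      refine Finset.sum_congr rfl fun j _ => ?_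
      rw [norm_mul, norm_mul, hep, norm_cexpR, mul_pow, mul_pow, Complex.norm_real,
        Real.norm_eq_abs, sq_abs, ← Real.exp_nat_mul]
      push_cast
      rw [show (2:ℝ) * ((ψ x - θ x)/2) = ψ x - θ x by ring]; ring
    simp only
    rw [e1]
    have e2 : Real.exp (ψ x - θ x) * Real.exp (-ψ x) = Real.exp (-θ x) := by
      rw [← Real.exp_add]; congr 1; ring
    have e3 : Real.exp (θ x) * Real.exp (-θ x) = 1 := by rw [← Real.exp_add]; simp
    calc _ = (3 * gsq θ x + 3 * Real.exp (θ x)) * (χ x ^ 2 * P x) *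
          (Real.exp (ψ x - θ x) * Real.exp (-ψ x)) := by ring
      _ = 3 * gsq θ x * Real.exp (-θ x) * (χ x ^ 2 * P x)
          + 3 * (Real.exp (θ x) * Real.exp (-θ x)) * (χ x ^ 2 * P x) := by rw [e2]; ring
      _ = _ := by rw [e3]; ring
  rw [lhs] at key
  have rhs : ∀ x, (‖∑ j, dz (bas j) κ x * (em x * A j x) - κ x * (eq x * T x)
      - ∑ j, dz (bas j) (fun y => (ψ y : ℂ)) x * ((χ x : ℂ) * (ep x * A j x))‖^2
      + (1/2) * ∑ j, ∑ k, ‖dzb (bas k) (fun x => (χ x : ℂ)) x * (ep x * A j x)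
      - dzb (bas j) (fun x => (χ x : ℂ)) x * (ep x * A k x)‖^2) * Real.exp (-ψ x)
      ≤ 3 * (χ x ^ 2 * ‖T x‖^2) + 3 * (χ x ^ 2 * (gsq θ x * Real.exp (-θ x)) * P x)
        + 5 * (gsq χ x * Real.exp (-θ x) * P x) := by
    intro x
    by_cases hx : x ∈ S
    swap
    · have hz : gsq χ x = 0 := by simp [gsq, offdz _ x hx]
      simp [offS x hx, offκ _ x hx, offdzb _ x hx, κ0 x hx, hz]
    have hxD := hSd x hx
    have dψ : DifferentiableAt ℝ ψ x := (hψ.differentiableOn (by norm_num)).differentiableAt (hD.mem_nhds hxD)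
    have dθ : DifferentiableAt ℝ θ x := (hθ.differentiableOn (by norm_num)).differentiableAt (hD.mem_nhds hxD)
    have dκ : ∀ j : Fin N, dz (bas j) κ x * em x = (dz (bas j) (fun x => (χ x : ℂ)) x
        + χ x * (dz (bas j) (fun y => (ψ y : ℂ)) x - dz (bas j) (fun y => (θ y : ℂ)) x)) * ep x := by
      intro j
      have h1 := dz_mul (v := bas j) (hχ.cd.differentiable (by norm_num) x)
        (((cexpR_contDiffOn (n := 2) (hψ.sub hθ)).differentiableOn (by norm_num)).differentiableAt
          (hD.mem_nhds hxD))
      have h2 : dz (bas j) (cexpR (fun y => ψ y - θ y)) x = (dz (bas j) (fun y => (ψ y : ℂ)) x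
          - dz (bas j) (fun y => (θ y : ℂ)) x) * cexpR (fun y => ψ y - θ y) x := by
        have := dz_exp_real (v := bas j) (dψ.sub dθ)
        have h3 := dz_ofReal_sub (v := bas j) dψ dθ
        rw [← h3]; exact this
      have h4 : dz (bas j) κ x = _ := h1
      rw [h4, h2, ← emp]; ring
    have e1 : ∑ j, dz (bas j) κ x * (em x * A j x) - κ x * (eq x * T x)
      - ∑ j, dz (bas j) (fun y => (ψ y : ℂ)) x * ((χ x : ℂ) * (ep x * A j x))
      = ∑ j, dz (bas j) (fun x => (χ x : ℂ)) x * (ep x * A j x)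
        - χ x * (∑ j, dz (bas j) (fun y => (θ y : ℂ)) x * (ep x * A j x))
        - χ x * (cexpR (fun y => ψ y / 2) x * T x) := by
      have : ∑ j, dz (bas j) κ x * (em x * A j x) = ∑ j, dz (bas j) (fun x => (χ x : ℂ)) x * (ep x * A j x)
        + ∑ j, dz (bas j) (fun y => (ψ y : ℂ)) x * ((χ x : ℂ) * (ep x * A j x))
        - χ x * (∑ j, dz (bas j) (fun y => (θ y : ℂ)) x * (ep x * A j x)) := by
        rw [Finset.mul_sum, ← Finset.sum_add_distrib, ← Finset.sum_sub_distrib]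
        refine Finset.sum_congr rfl fun j _ => ?_
        rw [← mul_assoc, dκ]; ring
      rw [this, ← eqp]; simp only [hκd]; ring
    have nep : ∑ j, ‖ep x * A j x‖^2 = Real.exp (ψ x - θ x) * P x := by
      rw [hP, Finset.mul_sum]
      refine Finset.sum_congr rfl fun j _ => ?_
      rw [norm_mul, hep, norm_cexpR, mul_pow, ← Real.exp_nat_mul]
      push_cast
      rw [show (2:ℝ) * ((ψ x - θ x)/2) = ψ x - θ x by ring]
    rw [e1]
    have b1 := cs_sum (fun j => dz (bas j) (fun x => (χ x : ℂ)) x) (fun j => ep x * A j x)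
    have b2 := cs_sum (fun j => dz (bas j) (fun x => (θ x : ℂ)) x) (fun j => ep x * A j x)
    have b3 := curl_sum (fun j => dzb (bas j) (fun x => (χ x : ℂ)) x) (fun j => ep x * A j x)
    have egb : ∑ j, ‖dzb (bas j) (fun x => (χ x : ℂ)) x‖^2 = gsq χ x := by
      refine Finset.sum_congr rfl fun j _ => ?_
      rw [← conj_dz_real hχr, RCLike.norm_conj]
    rw [nep] at b1 b2 b3
    rw [egb] at b3
    change _ ≤ gsq χ x * _ at b1
    change _ ≤ gsq θ x * _ at b2
    have b4 := norm3_sq (∑ j, dz (bas j) (fun x => (χ x : ℂ)) x * (ep x * A j x))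
      (χ x * (∑ j, dz (bas j) (fun y => (θ y : ℂ)) x * (ep x * A j x)))
      (χ x * (cexpR (fun y => ψ y / 2) x * T x))
    have n2 : ‖(χ x : ℂ) * (∑ j, dz (bas j) (fun y => (θ y : ℂ)) x * (ep x * A j x))‖^2
        = χ x ^ 2 * ‖∑ j, dz (bas j) (fun y => (θ y : ℂ)) x * (ep x * A j x)‖^2 := by
      rw [norm_mul, mul_pow, Complex.norm_real, Real.norm_eq_abs, sq_abs]
    have n3 : ‖(χ x : ℂ) * (cexpR (fun y => ψ y / 2) x * T x)‖^2
        = χ x ^ 2 * (Real.exp (ψ x) * ‖T x‖^2) := by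
      rw [norm_mul, norm_mul, mul_pow, mul_pow, Complex.norm_real, Real.norm_eq_abs, sq_abs,
        norm_cexpR, ← Real.exp_nat_mul]
      push_cast
      rw [show (2:ℝ) * (ψ x/2) = ψ x by ring]
    rw [n2, n3] at b4
    have e2 : Real.exp (ψ x - θ x) * Real.exp (-ψ x) = Real.exp (-θ x) := by
      rw [← Real.exp_add]; congr 1; ring
    have e3 : Real.exp (ψ x) * Real.exp (-ψ x) = 1 := by rw [← Real.exp_add]; simp
    have b5 := mul_le_mul_of_nonneg_left b2 (sq_nonneg (χ x))
    have tot : ‖∑ j, dz (bas j) (fun x => (χ x : ℂ)) x * (ep x * A j x)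
        - χ x * (∑ j, dz (bas j) (fun y => (θ y : ℂ)) x * (ep x * A j x))
        - χ x * (cexpR (fun y => ψ y / 2) x * T x)‖^2 +
        (1/2) * ∑ j, ∑ k, ‖dzb (bas k) (fun x => (χ x : ℂ)) x * (ep x * A j x)
      - dzb (bas j) (fun x => (χ x : ℂ)) x * (ep x * A k x)‖^2
      ≤ 3 * (χ x ^ 2 * (Real.exp (ψ x) * ‖T x‖^2)) + 3 * (χ x ^ 2 * (gsq θ x * (Real.exp (ψ x - θ x) * P x)))
        + 5 * (gsq χ x * (Real.exp (ψ x - θ x) * P x)) := by linarith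
    refine (mul_le_mul_of_nonneg_right tot (Real.exp_pos (-ψ x)).le).trans (le_of_eq ?_)
    calc _ = 3 * (χ x ^ 2 * ((Real.exp (ψ x) * Real.exp (-ψ x)) * ‖T x‖^2))
          + 3 * (χ x ^ 2 * (gsq θ x * ((Real.exp (ψ x - θ x) * Real.exp (-ψ x)) * P x)))
          + 5 * (gsq χ x * ((Real.exp (ψ x - θ x) * Real.exp (-ψ x)) * P x)) := by ring
      _ = _ := by rw [e2, e3]; ring
  have i5 : Integrable (fun x => 3 * (χ x ^ 2 * ‖T x‖^2)
      + 3 * (χ x ^ 2 * (gsq θ x * Real.exp (-θ x)) * P x)) (vol N) :=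
    (i4.const_mul 3).add (i3.const_mul 3)
  have fin := key.trans (integral_mono_of_nonneg (Eventually.of_forall fun x => by
      have : 0 ≤ Real.exp (-ψ x) := (Real.exp_pos _).le
      simp only [Pi.zero_apply]; positivity)
    (i5.add (i2.const_mul 5)) (Eventually.of_forall rhs))
  simp only [Pi.add_apply] at fin
  rw [integral_add i5 (i2.const_mul 5),
    integral_add (i4.const_mul 3) (i3.const_mul 3), integral_const_mul, integral_const_mul,
    integral_const_mul] at fin
  linarith
end p2
end

open Set Filter Topology Metric MeasureTheory
open scoped ENNReal NNReal InnerProductSpace ComplexConjugate ContDiff Manifold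

noncomputable section
section p2
variable {N : ℕ} {D : Set (EN N)}

/-- data for Hörmander's theorem -/
structure Horm {N : ℕ} (D : Set (EN N)) (ψ θ : EN N → ℝ) : Prop where
  op : IsOpen D
  hψ : ContDiffOn ℝ 2 ψ D
  hθ : ContDiffOn ℝ 2 θ D
  levi : ∀ x ∈ D, ∀ w, (3 * gsq θ x + 3 * Real.exp (θ x)) * ‖w‖^2 ≤ LeviForm ψ x w
  cut : ∃ (χ : ℕ → EN N → ℝ) (C : ℝ), (∀ n, ContDiff ℝ 2 (χ n)) ∧
    (∀ n, IsTest D (fun x => (χ n x : ℂ))) ∧ (∀ n x, |χ n x| ≤ 1) ∧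
    (∀ n, ∀ x ∈ D, gsq (χ n) x ≤ C * Real.exp (θ x)) ∧
    ∀ x ∈ D, ∀ᶠ n in atTop, χ n =ᶠ[𝓝 x] fun _ => 1

lemma gsq_congr {f g : EN N → ℝ} {x : EN N} (h : f =ᶠ[𝓝 x] g) : gsq f x = gsq g x := by
  unfold gsq
  refine Finset.sum_congr rfl fun j _ => ?_
  rw [dz_congr]
  filter_upwards [h] with y hy
  rw [hy]

lemma gsq_const (c : ℝ) (x : EN N) : gsq (fun _ => c) x = 0 := by
  simp [gsq, dz]

theorem p2_limit {ψ θ : EN N → ℝ} (H : Horm D ψ θ)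
    {A : Fin N → EN N → ℂ} (hA : ∀ j, MemLp (A j) 2 (vol N)) {T : EN N → ℂ} (hT : MemLp T 2 (vol N))
    (zA : ∀ j, ∀ x ∉ D, A j x = 0)
    (hZ : ∀ j k η, IsTest D η → ∫ x, dzb (bas k) η x * (cexpR (fun y => (ψ y - θ y) / 2) x * A j x) ∂(vol N)
      - ∫ x, dzb (bas j) η x * (cexpR (fun y => (ψ y - θ y) / 2) x * A k x) ∂(vol N) = 0)
    (hW : ∀ η, IsTest D η →
      ∑ j, ∫ x, dz (bas j) η x * (cexpR (fun y => -(ψ y - θ y) / 2) x * A j x) ∂(vol N)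
        = ∫ x, η x * (cexpR (fun y => -(ψ y - 2 * θ y) / 2) x * T x) ∂(vol N)) :
    ∫ x, ∑ j, ‖A j x‖^2 ∂(vol N) ≤ ∫ x, ‖T x‖^2 ∂(vol N) := by
  obtain ⟨χ, C, h1, h2, h3, h4, h5⟩ := H.cut
  have iA : Integrable (fun x => ∑ j, ‖A j x‖^2) (vol N) :=
    integrable_finset_sum _ fun j _ => (hA j).integrable_norm_pow (by norm_num)
  have iT : Integrable (fun x => ‖T x‖^2) (vol N) := hT.integrable_norm_pow (by norm_num)
  have P0 : ∀ x, 0 ≤ ∑ j, ‖A j x‖^2 := fun x => Finset.sum_nonneg fun _ _ => by positivity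
  have zP : ∀ x ∉ D, ∑ j, ‖A j x‖^2 = 0 := fun x hx => by simp [zA _ x hx]
  have χ2 : ∀ n x, χ n x ^ 2 ≤ 1 := fun n x => by
    have := h3 n x; rw [← sq_abs]; nlinarith [abs_nonneg (χ n x)]
  have step := fun n => p2_step H.op H.hψ H.hθ H.levi hA hT hZ hW (h2 n) (h1 n)
  have lim1 : Tendsto (fun n => ∫ x, χ n x ^ 2 * ∑ j, ‖A j x‖^2 ∂(vol N)) atTop
      (𝓝 (∫ x, ∑ j, ‖A j x‖^2 ∂(vol N))) := by
    refine tendsto_integral_of_dominated_convergence (fun x => ∑ j, ‖A j x‖^2) (fun n => ?_) iA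
      (fun n => Eventually.of_forall fun x => ?_) (Eventually.of_forall fun x => ?_)
    · exact ((h1 n).continuous.pow 2).aestronglyMeasurable.mul iA.1
    · rw [norm_mul, Real.norm_eq_abs, Real.norm_eq_abs, abs_of_nonneg (sq_nonneg _), abs_of_nonneg (P0 x)]
      exact mul_le_of_le_one_left (P0 x) (χ2 n x)
    · by_cases hx : x ∈ D
      · refine tendsto_const_nhds.congr' ?_
        filter_upwards [h5 x hx] with n hn
        rw [hn.self_of_nhds]; ring
      · simp only [zP x hx, mul_zero]; exact tendsto_const_nhds
  have mg : ∀ n, Continuous (gsq (χ n)) := fun n => by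
    rw [← continuousOn_univ]
    exact gsq_contOn isOpen_univ ((h1 n).contDiffOn.of_le (by norm_num))
  have lim2 : Tendsto (fun n => ∫ x, gsq (χ n) x * Real.exp (-θ x) * ∑ j, ‖A j x‖^2 ∂(vol N)) atTop
      (𝓝 (∫ x, (0:ℝ) ∂(vol N))) := by
    refine tendsto_integral_of_dominated_convergence (fun x => C * ∑ j, ‖A j x‖^2) (fun n => ?_)
      (iA.const_mul C) (fun n => Eventually.of_forall fun x => ?_) (Eventually.of_forall fun x => ?_)
    · have e : (fun x => gsq (χ n) x * Real.exp (-θ x) * ∑ j, ‖A j x‖^2)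
        = fun x => gsq (χ n) x * D.indicator (fun x => Real.exp (-θ x)) x * ∑ j, ‖A j x‖^2 := by
        ext x
        by_cases hx : x ∈ D
        · rw [indicator_of_mem hx]
        · rw [zP x hx]; ring
      rw [e]
      exact ((mg n).aestronglyMeasurable.mul (indicator_meas H.hθ.continuousOn.neg.rexp
        H.op.measurableSet).aestronglyMeasurable).mul iA.1
    · by_cases hx : x ∈ D
      · have g0 := gsq_nonneg (χ n) x
        rw [Real.norm_eq_abs, abs_of_nonneg (by have := P0 x; positivity)]
        refine mul_le_mul_of_nonneg_right ?_ (P0 x)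
        calc gsq (χ n) x * Real.exp (-θ x) ≤ C * Real.exp (θ x) * Real.exp (-θ x) :=
              mul_le_mul_of_nonneg_right (h4 n x hx) (Real.exp_pos _).le
          _ = C := by rw [mul_assoc, ← Real.exp_add]; simp
      · simp [zP x hx]
    · by_cases hx : x ∈ D
      · refine tendsto_const_nhds.congr' ?_
        filter_upwards [h5 x hx] with n hn
        rw [gsq_congr hn, gsq_const]; ring
      · simp only [zP x hx, mul_zero]; exact tendsto_const_nhds
  rw [integral_zero] at lim2
  have bT : ∀ n, ∫ x, χ n x ^ 2 * ‖T x‖^2 ∂(vol N) ≤ ∫ x, ‖T x‖^2 ∂(vol N) := fun n =>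
    integral_mono_of_nonneg (Eventually.of_forall fun x => by positivity) iT
      (Eventually.of_forall fun x => mul_le_of_le_one_left (by positivity) (χ2 n x))
  have fin := le_of_tendsto_of_tendsto (lim1.const_mul 3)
    ((lim2.const_mul 5).const_add (3 * ∫ x, ‖T x‖^2 ∂(vol N)))
    (Eventually.of_forall fun n => (step n).trans (by simpa using (bT n)))
  linarith

lemma riesz_lift {J H : Type*} [AddCommGroup J] [Module ℂ J] [NormedAddCommGroup H]
    [InnerProductSpace ℂ H] [CompleteSpace H] (t : J →ₗ[ℂ] H) (f : J →ₗ[ℂ] ℂ) {C : ℝ} (hC : 0 ≤ C)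
    (h : ∀ j, ‖f j‖ ≤ C * ‖t j‖) : ∃ v : H, ‖v‖ ≤ C ∧ ∀ j, ⟪v, t j⟫_ℂ = f j := by
  obtain ⟨s, hs⟩ := t.rangeRestrict.exists_rightInverse_of_surjective t.range_rangeRestrict
  have hs' : ∀ y : LinearMap.range t, t (s y) = y := fun y => by
    have := congrArg (fun g => ((g y : LinearMap.range t) : H)) hs
    simpa using this
  set l : LinearMap.range t →L[ℂ] ℂ := (f.comp s).mkContinuous C (fun y => by
    have := h (s y); rw [hs'] at this; simpa using this)
  obtain ⟨g, hg, hgn⟩ := exists_extension_norm_eq (LinearMap.range t) l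
  refine ⟨(InnerProductSpace.toDual ℂ H).symm g, ?_, fun j => ?_⟩
  · rw [LinearIsometryEquiv.norm_map, hgn]
    exact LinearMap.mkContinuous_norm_le _ hC _
  · rw [InnerProductSpace.toDual_symm_apply]
    have h1 := hg ⟨t j, LinearMap.mem_range_self t j⟩
    have h2 : l ⟨t j, LinearMap.mem_range_self t j⟩ = f (s ⟨t j, LinearMap.mem_range_self t j⟩) := rfl
    rw [h2] at h1
    have h3 := h (j - s ⟨t j, LinearMap.mem_range_self t j⟩)
    rw [map_sub, map_sub, hs'] at h3
    simp only [sub_self, norm_zero, mul_zero] at h3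
    have h4 := norm_le_zero_iff.mp h3
    rw [sub_eq_zero] at h4
    rw [h4]; exact h1

lemma abs_solve {ι H H1 : Type*} [NormedAddCommGroup H] [InnerProductSpace ℂ H] [CompleteSpace H]
    [NormedAddCommGroup H1] [InnerProductSpace ℂ H1] [CompleteSpace H1]
    (e : ι → H) (u : ι → H1) (Z : Submodule ℂ H) [Z.HasOrthogonalProjection] (hZ : ∀ i, e i ∈ Z)
    (est : ∀ A ∈ Z, ∀ T, (∀ i, ⟪e i, A⟫_ℂ = ⟪u i, T⟫_ℂ) → ‖A‖ ≤ ‖T‖) {g : H} (hg : g ∈ Z) :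
    ∃ v : H1, ‖v‖ ≤ ‖g‖ ∧ ∀ a t, (∀ i, ⟪e i, a⟫_ℂ = ⟪u i, t⟫_ℂ) → ⟪v, t⟫_ℂ = ⟪g, a⟫_ℂ := by
  let J : Submodule ℂ (H × H1) :=
    { carrier := {p | ∀ i, ⟪e i, p.1⟫_ℂ = ⟪u i, p.2⟫_ℂ}
      add_mem' := fun {p q} hp hq i => by
        simp only [Prod.fst_add, Prod.snd_add, inner_add_right, hp i, hq i]
      zero_mem' := fun i => by simp
      smul_mem' := fun c p hp i => by
        simp only [Prod.smul_fst, Prod.smul_snd, inner_smul_right, hp i] }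
  let f : J →ₗ[ℂ] ℂ := ((innerSL ℂ g : H →L[ℂ] ℂ) : H →ₗ[ℂ] ℂ) ∘ₗ (LinearMap.fst ℂ H H1) ∘ₗ J.subtype
  let t : J →ₗ[ℂ] H1 := (LinearMap.snd ℂ H H1) ∘ₗ J.subtype
  obtain ⟨v, hv, hv'⟩ := riesz_lift t f (norm_nonneg g) (by
    rintro ⟨⟨a, T⟩, hp⟩
    change ‖⟪g, a⟫_ℂ‖ ≤ ‖g‖ * ‖T‖
    have hp' : ∀ i, ⟪e i, a⟫_ℂ = ⟪u i, T⟫_ℂ := hp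
    have pr : ∀ x ∈ Z, ⟪x, ((Z.orthogonalProjection a : Z) : H)⟫_ℂ = ⟪x, a⟫_ℂ := fun x hx => by
      have := Z.sub_starProjection_mem_orthogonal a
      have h0 := (Submodule.mem_orthogonal Z _).mp this x hx
      rw [inner_sub_right, sub_eq_zero] at h0
      exact h0.symm
    rw [← pr g hg]
    refine (norm_inner_le_norm _ _).trans (mul_le_mul_of_nonneg_left ?_ (norm_nonneg _))
    exact est _ (Submodule.coe_mem _) T fun i => by rw [pr _ (hZ i), hp'])
  exact ⟨v, hv, fun a T h => hv' ⟨⟨a, T⟩, h⟩⟩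
end p2
end

open Set Filter Topology Metric MeasureTheory
open scoped ENNReal NNReal InnerProductSpace ComplexConjugate ContDiff Manifold

noncomputable section
section p3
variable {N : ℕ} {D : Set (EN N)}

lemma IsCS.memLpR {F : Type*} [NormedAddCommGroup F] {m : EN N → F} (h : IsCS D m) (p : ℝ≥0∞) (μ : Measure (EN N))
    [IsFiniteMeasureOnCompacts μ] : MemLp m p μ := h.ct.memLp_of_hasCompactSupport h.cs

lemma int_restrict (hD : IsOpen D) {F : Type*} [NormedAddCommGroup F] [NormedSpace ℝ F]
    {f : EN N → F} (h : ∀ x ∉ D, f x = 0) :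
    ∫ x, f x ∂((vol N).restrict D) = ∫ x, f x ∂(vol N) :=
  setIntegral_eq_integral_of_forall_compl_eq_zero h

lemma IsTest.conj {η : EN N → ℂ} (h : IsTest D η) : IsTest D (fun x => conj (η x)) := by
  refine ⟨conj_comp_contDiff (n := 2) h.cd, h.cs.comp_left (g := fun z : ℂ => (starRingEnd ℂ) z) (by simp), ?_⟩
  refine (closure_mono (fun x hx => ?_)).trans h.sub
  rw [Function.mem_support] at hx ⊢; intro h0; apply hx; simp [h0]

lemma IsCS.conj {η : EN N → ℂ} (h : IsCS D η) : IsCS D (fun x => conj (η x)) := by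
  refine ⟨Complex.continuous_conj.comp h.ct, h.cs.comp_left (g := fun z : ℂ => (starRingEnd ℂ) z) (by simp), ?_⟩
  refine (closure_mono (fun x hx => ?_)).trans h.sub
  rw [Function.mem_support] at hx ⊢; intro h0; apply hx; simp [h0]

/-- vector valued from components -/
lemma vec_isCS {a : Fin N → EN N → ℂ} (h : ∀ j, IsCS D (a j)) : IsCS D (vec a) := by
  have e : vec a = fun x => ∑ j, a j x • bas j := by
    ext x j
    simp [vec, Finset.sum_apply, Pi.single_apply]
  have c : Continuous (vec a) := by
    rw [e]; exact continuous_finset_sum _ fun j _ => (h j).ct.smul continuous_const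
  have hk : IsCompact (⋃ j, tsupport (a j)) := isCompact_iUnion fun j => (h j).cs
  have hz : ∀ x ∉ ⋃ j, tsupport (a j), vec a x = 0 := fun x hx => by
    rw [e]
    simp only [mem_iUnion, not_exists] at hx
    exact Finset.sum_eq_zero fun j _ => by rw [image_eq_zero_of_notMem_tsupport (hx j), zero_smul]
  refine ⟨c, HasCompactSupport.intro hk hz, ?_⟩
  refine (closure_minimal (fun x hx => ?_) hk.isClosed).trans (iUnion_subset fun j => (h j).sub)
  by_contra h'; exact hx (hz x h')

lemma inner_vec (a b : EN N) : ⟪a, b⟫_ℂ = ∑ j, conj (a j) * b j := by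
  rw [PiLp.inner_apply]
  refine Finset.sum_congr rfl fun j _ => ?_
  rw [RCLike.inner_apply, mul_comm]

lemma memLp_comp {μ : Measure (EN N)} {A : EN N → EN N} (h : MemLp A 2 μ) (j : Fin N) :
    MemLp (fun x => A x j) 2 μ :=
  (EuclideanSpace.proj (𝕜 := ℂ) j : EN N →L[ℂ] ℂ).comp_memLp' h

lemma L2_norm_sq' {F : Type*} [NormedAddCommGroup F] [InnerProductSpace ℂ F] {μ : Measure (EN N)}
    (A : Lp F 2 μ) : ‖A‖^2 = ∫ x, ‖A x‖^2 ∂μ := by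
  rw [← @inner_self_eq_norm_sq ℂ, L2.inner_def, ← integral_re (L2.integrable_inner A A)]
  simp only [inner_self_eq_norm_sq]

theorem hormander {ψ θ : EN N → ℝ} (H : Horm D ψ θ) {u₀ : EN N → ℂ} (hu₀ : IsTest D u₀) :
    ∃ V : EN N → ℂ, MemLp V 2 (vol N) ∧ (∀ x ∉ D, V x = 0) ∧
      ∫ x, ‖V x‖^2 ∂(vol N) ≤ ∫ x, (∑ j, ‖dzb (bas j) u₀ x‖^2) * Real.exp (-(ψ x - θ x)) ∂(vol N) ∧
      ∀ (j : Fin N) η, IsTest D η →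
        ∫ x, dzb (bas j) η x * (u₀ x - cexpR (fun y => (ψ y - 2 * θ y) / 2) x * V x) ∂(vol N) = 0 := by
  set μ := (vol N).restrict D with hμ
  set ep := cexpR (fun y => (ψ y - θ y) / 2) with hep
  set em := cexpR (fun y => -(ψ y - θ y) / 2) with hem
  set eq := cexpR (fun y => -(ψ y - 2 * θ y) / 2) with heq
  set er := cexpR (fun y => (ψ y - 2 * θ y) / 2) with her
  have dep : ContinuousOn ep D := (cexpR_contDiffOn (n := 2) ((H.hψ.sub H.hθ).div_const 2)).continuousOn
  have dem : ContinuousOn em D := (cexpR_contDiffOn (n := 2) ((H.hψ.sub H.hθ).neg.div_const 2)).continuousOn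
  have deq : ContinuousOn eq D := (cexpR_contDiffOn (n := 2)
    ((H.hψ.sub (contDiffOn_const.mul H.hθ)).neg.div_const 2)).continuousOn
  have der : ContinuousOn er D := (cexpR_contDiffOn (n := 2)
    ((H.hψ.sub (contDiffOn_const.mul H.hθ)).div_const 2)).continuousOn
  have epm : ∀ x, ep x * em x = 1 := fun x => by
    simp only [hep, hem, cexpR]
    rw [← Complex.ofReal_mul, ← Real.exp_add]; ring_nf; simp
  have eqr : ∀ x, eq x * er x = 1 := fun x => by
    simp only [heq, her, cexpR]
    rw [← Complex.ofReal_mul, ← Real.exp_add]; ring_nf; simp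
  have cep : ∀ x, conj (ep x) = ep x := fun x => Complex.conj_ofReal _
  have cem : ∀ x, conj (em x) = em x := fun x => Complex.conj_ofReal _
  have ceq : ∀ x, conj (eq x) = eq x := fun x => Complex.conj_ofReal _
  have cer : ∀ x, conj (er x) = er x := fun x => Complex.conj_ofReal _
  -- L2 elements
  have csE : ∀ u : {u // IsTest D u}, IsCS D (vec (fun j x => dzb (bas j) u.1 x * em x)) := fun u =>
    vec_isCS fun j => (u.2.dzb_isCS _).mul_on H.op dem
  have csU : ∀ u : {u // IsTest D u}, IsCS D (fun x => u.1 x * eq x) := fun u =>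
    u.2.isCS.mul_on H.op deq
  set e : {u // IsTest D u} → Lp (EN N) 2 μ := fun u => ((csE u).memLpR 2 μ).toLp _ with he
  set ut : {u // IsTest D u} → Lp ℂ 2 μ := fun u => ((csU u).memLpR 2 μ).toLp _ with hut
  have csZ : ∀ p : {u // IsTest D u} × Fin N × Fin N, IsCS D (vec (fun j x =>
      conj (dzb (bas p.2.2) p.1.1 x) * (if j = p.2.1 then ep x else 0)
        - conj (dzb (bas p.2.1) p.1.1 x) * (if j = p.2.2 then ep x else 0))) := by
    intro p
    refine vec_isCS fun j => ?_
    have hc : ∀ i : Fin N, ContinuousOn (fun x => if j = i then ep x else 0) D := fun i => by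
      split_ifs; exacts [dep, continuousOn_const]
    have h1 := (p.1.2.dzb_isCS (bas p.2.2)).conj.mul_on H.op (hc p.2.1)
    have h2 := (p.1.2.dzb_isCS (bas p.2.1)).conj.mul_on H.op (hc p.2.2)
    refine ⟨h1.ct.sub h2.ct, ?_, ?_⟩
    · exact h1.cs.sub h2.cs
    · exact (tsupport_sub _ _).trans (union_subset h1.sub h2.sub)
  set z : {u // IsTest D u} × Fin N × Fin N → Lp (EN N) 2 μ := fun p => ((csZ p).memLpR 2 μ).toLp _ with hz
  set Z : Submodule ℂ (Lp (EN N) 2 μ) := (Submodule.span ℂ (range z))ᗮ with hZd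
  have memZ : ∀ A, A ∈ Z ↔ ∀ p, ⟪z p, A⟫_ℂ = 0 := by
    intro A
    rw [hZd, Submodule.mem_orthogonal]
    constructor
    · intro h p; exact h _ (Submodule.subset_span (mem_range_self p))
    · intro h y hy
      induction hy using Submodule.span_induction with
      | mem x hx => obtain ⟨p, rfl⟩ := hx; exact h p
      | zero => simp
      | add x y _ _ hx hy => rw [inner_add_left, hx, hy, add_zero]
      | smul c x _ hx => rw [inner_smul_left, hx, mul_zero]
  -- inner product formulas
  have innE : ∀ u (A : Lp (EN N) 2 μ), ⟪e u, A⟫_ℂ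
      = ∫ x, ∑ j, conj (dzb (bas j) u.1 x) * (em x * A x j) ∂μ := by
    intro u A
    rw [L2.inner_def]
    refine integral_congr_ae ?_
    filter_upwards [((csE u).memLpR 2 μ).coeFn_toLp] with x hx
    simp only [he]
    rw [hx, inner_vec]
    refine Finset.sum_congr rfl fun j _ => ?_
    simp only [vec, PiLp.toLp_apply, map_mul, cem]
    ring
  have innU : ∀ u (T : Lp ℂ 2 μ), ⟪ut u, T⟫_ℂ = ∫ x, conj (u.1 x) * (eq x * T x) ∂μ := by
    intro u T
    rw [L2.inner_def]
    refine integral_congr_ae ?_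
    filter_upwards [((csU u).memLpR 2 μ).coeFn_toLp] with x hx
    simp only [hut]
    rw [hx, RCLike.inner_apply]
    simp only [map_mul, ceq]
    ring
  have innZ : ∀ p (A : Lp (EN N) 2 μ), ⟪z p, A⟫_ℂ
      = ∫ x, (dzb (bas p.2.2) p.1.1 x * (ep x * A x p.2.1)
        - dzb (bas p.2.1) p.1.1 x * (ep x * A x p.2.2)) ∂μ := by
    intro p A
    rw [L2.inner_def]
    refine integral_congr_ae ?_
    filter_upwards [((csZ p).memLpR 2 μ).coeFn_toLp] with x hx
    simp only [hz]
    rw [hx, inner_vec]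
    simp only [vec, PiLp.toLp_apply, map_mul, map_sub, sub_mul, Finset.sum_sub_distrib, apply_ite conj,
      cep, map_zero, Complex.conj_conj, mul_ite, ite_mul, mul_zero, zero_mul, Finset.sum_ite_eq',
      Finset.sum_ite_eq, Finset.mem_univ, if_true]
    ring
  have hDm := H.op.measurableSet
  have offdzb : ∀ {η : EN N → ℂ}, IsTest D η → ∀ (j : Fin N), ∀ x ∉ D, dzb (bas j) η x = 0 := fun hη j x hx =>
    notMem_sub (hη.dzb_isCS _).sub hx
  have offdz : ∀ {η : EN N → ℂ}, IsTest D η → ∀ (j : Fin N), ∀ x ∉ D, dz (bas j) η x = 0 := fun hη j x hx =>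
    notMem_sub (hη.dz_isCS _).sub hx
  have eZ : ∀ u, e u ∈ Z := by
    intro u
    rw [memZ]
    rintro ⟨η, j, k⟩
    rw [innZ]
    have h1 : ∫ x, (dzb (bas k) η.1 x * (ep x * e u x j)
        - dzb (bas j) η.1 x * (ep x * e u x k)) ∂μ
        = ∫ x, (dzb (bas k) η.1 x * dzb (bas j) u.1 x - dzb (bas j) η.1 x * dzb (bas k) u.1 x) ∂μ := by
      refine integral_congr_ae ?_
      filter_upwards [((csE u).memLpR 2 μ).coeFn_toLp] with x hx
      simp only [he]
      rw [hx]
      simp only [vec, PiLp.toLp_apply]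
      linear_combination (dzb (bas k) η.1 x * dzb (bas j) u.1 x - dzb (bas j) η.1 x * dzb (bas k) u.1 x) * epm x
    simp only
    rw [h1, hμ, int_restrict H.op (fun x hx => by simp [offdzb η.2 _ x hx])]
    have c1 : ∀ i, ContDiff ℝ 1 (fun x => η.1 x * dzb (bas i) u.1 x) := fun i =>
      (η.2.cd.of_le (by norm_num)).mul (contDiff_dzb (n := 1) u.2.cd _)
    have d1 : ∀ i l x, dzb (bas l) (fun x => η.1 x * dzb (bas i) u.1 x) x
        = dzb (bas l) η.1 x * dzb (bas i) u.1 x + η.1 x * dzb (bas l) (dzb (bas i) u.1) x := fun i l x =>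
      dzb_mul (η.2.cd.differentiable (by norm_num) x)
        ((contDiff_dzb (n := 1) u.2.cd _).differentiable (by norm_num) x)
    have I1 := integral_dzb_zero (c1 j) (η.2.cs.mul_right) (bas k)
    have I2 := integral_dzb_zero (c1 k) (η.2.cs.mul_right) (bas j)
    have ii : ∀ i l, Integrable (dzb (bas l) (fun x => η.1 x * dzb (bas i) u.1 x)) (vol N) := fun i l =>
      integrable_C1cs (contDiff_dzb (n := 0) (c1 i) _).continuous (hcs_dzb (η.2.cs.mul_right) _)
    rw [← sub_eq_zero.mpr (I1.trans I2.symm), ← integral_sub (ii _ _) (ii _ _)]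
    refine integral_congr_ae (Eventually.of_forall fun x => ?_)
    simp only [d1]
    rw [dzb_dzb_comm u.2.cd]; ring
  have est : ∀ A ∈ Z, ∀ T, (∀ i, ⟪e i, A⟫_ℂ = ⟪ut i, T⟫_ℂ) → ‖A‖ ≤ ‖T‖ := by
    intro A hA T hAT
    have mA : ∀ j : Fin N, MemLp (D.indicator fun x => A x j) 2 (vol N) := fun j =>
      (memLp_indicator_iff_restrict hDm).mpr (memLp_comp (Lp.memLp A) j)
    have mT : MemLp (D.indicator fun x => T x) 2 (vol N) :=
      (memLp_indicator_iff_restrict hDm).mpr (Lp.memLp T)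
    have conv : ∀ (m : EN N → ℂ) (F B : EN N → ℂ), (∀ x ∉ D, m x = 0) →
        ∫ x, m x * (F x * D.indicator B x) ∂(vol N) = ∫ x, m x * (F x * B x) ∂μ := by
      intro m F B hm
      rw [hμ, int_restrict H.op (fun x hx => by rw [hm x hx, zero_mul])]
      refine integral_congr_ae (Eventually.of_forall fun x => ?_)
      by_cases hx : x ∈ D
      · simp only [indicator_of_mem hx]
      · simp [hm x hx]
    have intg : ∀ (m : EN N → ℂ) (F B : EN N → ℂ), IsCS D m → ContinuousOn F D → MemLp B 2 μ →
        Integrable (fun x => m x * (F x * B x)) μ := by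
      intro m F B hm hF hB
      have h1 := (hm.mul_on H.op hF).integrable_mul ((memLp_indicator_iff_restrict hDm).mpr hB)
      refine (h1.restrict (s := D)).congr ?_
      filter_upwards [ae_restrict_mem hDm] with x hx
      rw [indicator_of_mem hx]; exact mul_assoc _ _ _
    have key := p2_limit H (A := fun j => D.indicator fun x => A x j) mA mT
      (fun j x hx => indicator_of_notMem hx _)
      (by
        intro j k η hη
        rw [conv _ _ _ (offdzb hη k), conv _ _ _ (offdzb hη j)]
        rw [← integral_sub (intg _ _ _ (hη.dzb_isCS _) dep (memLp_comp (Lp.memLp A) j))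
          (intg _ _ _ (hη.dzb_isCS _) dep (memLp_comp (Lp.memLp A) k))]
        have := (memZ A).mp hA (⟨η, hη⟩, j, k)
        rwa [innZ] at this)
      (by
        intro η hη
        rw [conv _ _ _ (fun x hx => notMem_sub hη.sub hx)]
        simp_rw [fun j => conv _ (cexpR (fun y => -(ψ y - θ y) / 2)) (fun x => A x j) (offdz hη j)]
        have := hAT ⟨_, hη.conj⟩
        rw [innE, innU] at this
        simp only [Complex.conj_conj] at this
        rw [← this, integral_finset_sum]
        · refine Finset.sum_congr rfl fun j _ => ?_
          refine integral_congr_ae (Eventually.of_forall fun x => ?_)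
          simp only
          rw [dzb_conj (hη.cd.differentiable (by norm_num) x), Complex.conj_conj]
        · intro j _
          exact intg _ _ _ (hη.conj.dzb_isCS _).conj dem (memLp_comp (Lp.memLp A) j))
    have eA : ‖A‖^2 = ∫ x, ∑ j, ‖D.indicator (fun x => A x j) x‖^2 ∂(vol N) := by
      rw [← int_restrict H.op (fun x hx => by simp [indicator_of_notMem hx])]
      rw [L2_norm_sq']
      refine integral_congr_ae ?_
      filter_upwards [ae_restrict_mem hDm] with x hx
      simp only [indicator_of_mem hx]
      rw [EuclideanSpace.norm_sq_eq]
    have eT : ‖T‖^2 = ∫ x, ‖D.indicator (fun x => T x) x‖^2 ∂(vol N) := by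
      rw [← int_restrict H.op (fun x hx => by simp [indicator_of_notMem hx])]
      rw [L2_norm_sq']
      refine integral_congr_ae ?_
      filter_upwards [ae_restrict_mem hDm] with x hx
      simp only [indicator_of_mem hx]
    rw [← eA, ← eT] at key
    exact le_of_sq_le_sq key (norm_nonneg _)
  haveI : Z.HasOrthogonalProjection := by
    haveI : CompleteSpace Z := (Submodule.isClosed_orthogonal _).completeSpace_coe
    infer_instance
  obtain ⟨v, hv, hv'⟩ := abs_solve e ut Z eZ est (eZ ⟨u₀, hu₀⟩)
  have mv : MemLp (D.indicator fun x => v x) 2 (vol N) :=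
    (memLp_indicator_iff_restrict hDm).mpr (Lp.memLp v)
  refine ⟨D.indicator (fun x => v x), mv, fun x hx => indicator_of_notMem hx _, ?_, ?_⟩
  · rw [← int_restrict H.op (fun x hx => by simp [indicator_of_notMem hx])]
    rw [← int_restrict (f := fun x => (∑ j, ‖dzb (bas j) u₀ x‖^2) * Real.exp (-(ψ x - θ x))) H.op
      (fun x hx => by simp [offdzb hu₀ _ x hx])]
    have h1 : ∫ x, ‖D.indicator (fun x => v x) x‖^2 ∂μ = ‖v‖^2 := by
      rw [L2_norm_sq']
      refine integral_congr_ae ?_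
      filter_upwards [ae_restrict_mem hDm] with x hx
      simp only [indicator_of_mem hx]
    have h2 : ∫ x, (∑ j, ‖dzb (bas j) u₀ x‖^2) * Real.exp (-(ψ x - θ x)) ∂μ = ‖e ⟨u₀, hu₀⟩‖^2 := by
      rw [L2_norm_sq']
      refine integral_congr_ae ?_
      filter_upwards [((csE ⟨u₀, hu₀⟩).memLpR 2 μ).coeFn_toLp] with x hx
      simp only [he]
      rw [hx, EuclideanSpace.norm_sq_eq]
      simp only [vec, PiLp.toLp_apply, norm_mul, mul_pow, ← Finset.sum_mul]
      congr 1
      rw [hem, norm_cexpR, ← Real.exp_nat_mul]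
      congr 1; push_cast; ring
    rw [← hμ, h1, h2]
    exact pow_le_pow_left₀ (norm_nonneg _) hv 2
  · intro j η hη
    have hη' := hη.conj
    set η' : EN N → ℂ := fun x => conj (η x) with hη'd
    have csA : IsCS D (vec (fun i x => η' x * (if i = j then ep x else 0))) :=
      vec_isCS fun i => hη'.isCS.mul_on H.op (by split_ifs; exacts [dep, continuousOn_const])
    have csT : IsCS D (fun x => - dz (bas j) η' x * er x) := by
      have : IsCS D (fun x => - dz (bas j) η' x) :=
        ⟨(hη'.dz_isCS _).ct.neg, (hη'.dz_isCS _).cs.neg, by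
          have := (hη'.dz_isCS (bas j)).sub
          rwa [show (fun x => - dz (bas j) η' x) = - (dz (bas j) η') from rfl, tsupport_neg]⟩
      exact this.mul_on H.op der
    have inA : ∀ u, ⟪e u, (csA.memLpR 2 μ).toLp _⟫_ℂ = ∫ x, conj (dzb (bas j) u.1 x) * η' x ∂(vol N) := by
      intro u
      rw [innE, ← int_restrict H.op (f := fun x => conj (dzb (bas j) u.1 x) * η' x)
        (fun x hx => by rw [offdzb u.2 _ x hx]; simp)]
      refine integral_congr_ae ?_
      filter_upwards [(csA.memLpR 2 μ).coeFn_toLp] with x hx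
      rw [hx]
      simp only [vec, PiLp.toLp_apply, mul_ite, mul_zero, Finset.sum_ite_eq', Finset.sum_ite_eq, Finset.mem_univ,
        if_true]
      linear_combination conj (dzb (bas j) u.1 x) * η' x * epm x
    have inT : ∀ u, ⟪ut u, (csT.memLpR 2 μ).toLp _⟫_ℂ = - ∫ x, conj (u.1 x) * dz (bas j) η' x ∂(vol N) := by
      intro u
      rw [innU, ← integral_neg, ← int_restrict H.op (f := fun x => - (conj (u.1 x) * dz (bas j) η' x))
        (fun x hx => by rw [offdz hη' _ x hx]; simp)]
      refine integral_congr_ae ?_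
      filter_upwards [(csT.memLpR 2 μ).coeFn_toLp] with x hx
      rw [hx]
      linear_combination - conj (u.1 x) * dz (bas j) η' x * eqr x
    have ibp : ∀ u : EN N → ℂ, IsTest D u → ∫ x, conj (dzb (bas j) u x) * η' x ∂(vol N)
        = - ∫ x, conj (u x) * dz (bas j) η' x ∂(vol N) := by
      intro u hu
      have I := integral_dz_zero (f := fun x => conj (u x) * η' x)
        ((hu.conj.cd.mul hη'.cd).of_le (by norm_num)) (hη'.cs.mul_left) (bas j)
      have d : ∀ x, dz (bas j) (fun x => conj (u x) * η' x) x
          = conj (dzb (bas j) u x) * η' x + conj (u x) * dz (bas j) η' x := fun x => by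
        rw [dz_mul (hu.conj.cd.differentiable (by norm_num) x) (hη'.cd.differentiable (by norm_num) x),
          dz_conj (hu.cd.differentiable (by norm_num) x)]
      simp only [d] at I
      rw [integral_add] at I
      · exact eq_neg_of_add_eq_zero_left I
      · exact integrable_C1cs (((hu.dzb_isCS _).conj.ct).mul hη'.isCS.ct) (hη'.cs.mul_left)
      · exact integrable_C1cs ((hu.conj.isCS.ct).mul (hη'.dz_isCS _).ct) ((hη'.dz_isCS _).cs.mul_left)
    have key := hv' ((csA.memLpR 2 μ).toLp _) ((csT.memLpR 2 μ).toLp _) (fun u => by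
      rw [inA, inT, ibp _ u.2])
    rw [inA, ibp _ hu₀, L2.inner_def] at key
    have d' : ∀ x, dz (bas j) η' x = conj (dzb (bas j) η x) := fun x =>
      dz_conj (hη.cd.differentiable (by norm_num) x)
    have k1 : ∫ x, ⟪v x, ((csT.memLpR 2 μ).toLp _ : Lp ℂ 2 μ) x⟫_ℂ ∂μ
        = - ∫ x, conj (dzb (bas j) η x * (er x * D.indicator (fun x => v x) x)) ∂(vol N) := by
      rw [← integral_neg, ← int_restrict H.op (f := fun x => - conj (dzb (bas j) η x * (er x * D.indicator (fun x => v x) x)))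
        (fun x hx => by rw [offdzb hη _ x hx]; simp)]
      refine integral_congr_ae ?_
      filter_upwards [(csT.memLpR 2 μ).coeFn_toLp, ae_restrict_mem hDm] with x hx hxD
      rw [hx, RCLike.inner_apply, d', indicator_of_mem hxD]
      simp only [map_mul, cer]; ring
    have k2 : ∫ x, conj (u₀ x) * dz (bas j) η' x ∂(vol N) = ∫ x, conj (dzb (bas j) η x * u₀ x) ∂(vol N) := by
      refine integral_congr_ae (Eventually.of_forall fun x => ?_)
      simp only [d', map_mul]; ring
    rw [k1, k2, neg_inj, integral_conj, integral_conj] at key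
    have key' := (starRingEnd ℂ).injective key
    simp only [mul_sub]
    rw [integral_sub, key', sub_self]
    · exact integrable_C1cs ((hη.dzb_isCS _).ct.mul hu₀.isCS.ct) (hu₀.cs.mul_left)
    · have := ((hη.dzb_isCS (bas j)).mul_on H.op der).integrable_mul mv
      refine this.congr (Eventually.of_forall fun x => ?_)
      exact mul_assoc _ _ _
end p3
end

open Set Filter Topology Metric MeasureTheory
open scoped ENNReal NNReal InnerProductSpace ComplexConjugate ContDiff Manifold

noncomputable section
section weyl
variable {N : ℕ} {D : Set (EN N)}

lemma dzb_zero_all {f : EN N → ℂ} {x : EN N} (h : ∀ j, dzb (bas j) f x = 0) (v : EN N) : dzb v f x = 0 := by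
  rw [sum_bas v, dzb_sum_dir]
  refine Finset.sum_eq_zero fun j _ => ?_
  rw [h j, mul_zero]

lemma diffC_of_dzb {f : EN N → ℂ} {x : EN N} (hd : DifferentiableAt ℝ f x)
    (h : ∀ j, dzb (bas j) f x = 0) : DifferentiableAt ℂ f x := by
  have hI : ∀ v, fderiv ℝ f x (Complex.I • v) = Complex.I * fderiv ℝ f x v := fun v => by
    have := dzb_zero_all h v
    rw [dzb, div_eq_zero_iff] at this
    have h2 := this.resolve_right (by norm_num)
    linear_combination (-Complex.I) * h2 + fderiv ℝ f x (Complex.I • v) * Complex.I_sq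
  let L : EN N →L[ℂ] ℂ :=
    { toFun := fderiv ℝ f x
      map_add' := map_add _
      map_smul' := fun c v => by
        have : c • v = c.re • v + c.im • (Complex.I • v) := by
          rw [← Complex.coe_smul, ← Complex.coe_smul, smul_smul, ← add_smul, Complex.re_add_im]
        rw [this, map_add, map_smul, map_smul, hI]
        simp only [Complex.real_smul, RingHom.id_apply, smul_eq_mul]
        conv_rhs => rw [← Complex.re_add_im c]
        ring
      cont := (fderiv ℝ f x).continuous }
  exact (hasFDerivAt_of_restrictScalars ℝ hd.hasFDerivAt (f' := L) (by ext v; rfl)).differentiableAt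

lemma moll_hol {δ : ℝ} (hδ : 0 < δ) {f : EN N → ℂ} (hf : LocallyIntegrable f (vol N))
    (hw : ∀ j η, IsTest D η → ∫ y, dzb (bas j) η y * f y ∂(vol N) = 0) {x : EN N}
    (hx : closedBall x δ ⊆ D) : DifferentiableAt ℂ (moll δ f) x := by
  refine diffC_of_dzb ((moll_contDiff hδ hf).differentiable (by norm_num) x) fun j => ?_
  rw [moll_dzb hδ hf, hw j, neg_zero]
  have h := kc_isTest (N := N) hδ x
  refine ⟨h.cd, h.cs, (closure_minimal (fun y hy => ?_) isClosed_closedBall).trans hx⟩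
  by_contra h'
  refine hy (kc_zero hδ ?_)
  rw [mem_closedBall', dist_eq_norm, not_le] at h'
  exact h'.le

lemma moll_local {δ : ℝ} (hδ : 0 < δ) {f g : EN N → ℂ} {x : EN N} (h : ∀ y ∈ closedBall x δ, f y = g y) :
    moll δ f x = moll δ g x := by
  refine integral_congr_ae (Eventually.of_forall fun y => ?_)
  by_cases hy : y ∈ closedBall x δ
  · simp only [h y hy]
  · rw [mem_closedBall', dist_eq_norm, not_le] at hy
    simp only [kc_zero hδ hy.le, zero_mul]

lemma rot_int {δ : ℝ} (g : EN N → ℂ) (x : EN N) (c : ℂ) (hc : ‖c‖ = 1) :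
    ∫ t, kc N δ t * g (x - c • t) ∂(vol N) = ∫ t, kc N δ t * g (x - t) ∂(vol N) := by
  have hc0 : c ≠ 0 := by intro h; rw [h, norm_zero] at hc; exact zero_ne_one hc
  let e : EN N ≃L[ℝ] EN N := (ContinuousLinearEquiv.smulLeft (Units.mk0 c hc0) : EN N ≃L[ℂ] EN N).restrictScalars ℝ
  have he : ∀ t, e t = c • t := fun t => rfl
  have hmp : MeasurePreserving e (vol N) (vol N) := by
    refine ⟨e.continuous.measurable, ?_⟩
    haveI : ((vol N).map e).IsAddHaarMeasure := e.isAddHaarMeasure_map (vol N)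
    have h1 := Measure.isAddLeftInvariant_eq_smul ((vol N).map e) (vol N)
    set k := Measure.addHaarScalarFactor ((vol N).map e) (vol N)
    have h2 : ((vol N).map e) (ball 0 1) = (vol N) (ball 0 1) := by
      rw [Measure.map_apply e.continuous.measurable measurableSet_ball]
      congr 1
      ext t
      simp only [mem_preimage, mem_ball, dist_zero_right]
      rw [he, norm_smul, hc, one_mul]
    rw [h1] at h2 ⊢
    have hb0 : (vol N) (ball 0 1) ≠ 0 := (measure_ball_pos _ _ one_pos).ne'
    have hbt : (vol N) (ball 0 1) ≠ ⊤ := measure_ball_lt_top.ne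
    rw [Measure.smul_apply, ENNReal.smul_def, smul_eq_mul] at h2
    have h3 : (k : ℝ≥0∞) = 1 := by
      rw [← ENNReal.mul_left_inj hb0 hbt, h2, one_mul]
    rw [ENNReal.coe_eq_one.mp h3, one_smul]
  rw [← hmp.integral_comp e.toHomeomorph.measurableEmbedding (fun t => kc N δ t * g (x - t))]
  refine integral_congr_ae (Eventually.of_forall fun t => ?_)
  simp only [he]
  rw [kc_norm_eq (y := c • t) (z := t) (by rw [norm_smul, hc, one_mul])]

lemma moll_mean {ε s : ℝ} (hε : 0 < ε) {g : EN N → ℂ} (hg : Continuous g) {x : EN N}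
    (hs : ε ≤ s) (hd : DifferentiableOn ℂ g (ball x s)) : moll ε g x = g x := by
  have h1 : ∀ θ : ℝ, ∫ t, kc N ε t * g (x - (Complex.exp (θ * Complex.I)) • t) ∂(vol N) = moll ε g x := fun θ => by
    rw [rot_int g x _ (Complex.norm_exp_ofReal_mul_I θ), moll_eq_conv']
  have h2 : ∀ t : EN N, kc N ε t * ∫ θ in (0:ℝ)..(2 * Real.pi), g (x - (Complex.exp (θ * Complex.I)) • t)
      = kc N ε t * ((2 * Real.pi : ℝ) * g x) := by
    intro t
    by_cases ht : ε ≤ ‖t‖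
    · rw [kc_zero hε ht]; simp
    congr 1
    have := DiffContOnCl.circleAverage (f := fun z : ℂ => g (x - z • t)) (c := 0) (R := 1) ?_
    · rw [Real.circleAverage_def] at this
      simp only [circleMap, zero_add, zero_smul, sub_zero, Complex.ofReal_one, one_mul] at this
      rw [← this, Complex.real_smul, ← mul_assoc, ← Complex.ofReal_mul, mul_inv_cancel₀ (by positivity)]
      simp
    · rw [abs_one]
      refine DifferentiableOn.diffContOnCl ?_
      intro z hz
      rw [closure_ball _ one_ne_zero, mem_closedBall, dist_zero_right] at hz
      have hx : x - z • t ∈ ball x s := by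
        rw [mem_ball, dist_eq_norm, sub_sub_cancel_left, norm_neg, norm_smul]
        push Not at ht
        calc ‖z‖ * ‖t‖ ≤ 1 * ‖t‖ := by gcongr
          _ < s := by linarith
      have h3 := (hd.differentiableAt (isOpen_ball.mem_nhds hx))
      exact (h3.comp z (by fun_prop)).differentiableWithinAt
  have sw : ∫ θ in (0:ℝ)..(2 * Real.pi), ∫ t, kc N ε t * g (x - (Complex.exp (θ * Complex.I)) • t) ∂(vol N)
      = ∫ t, kc N ε t * (∫ θ in (0:ℝ)..(2 * Real.pi), g (x - (Complex.exp (θ * Complex.I)) • t)) ∂(vol N) := by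
    rw [intervalIntegral_integral_swap]
    · simp only [intervalIntegral.integral_const_mul]
    · set ψ : ℝ × EN N → ℂ := Function.uncurry fun (θ : ℝ) t => kc N ε t * g (x - (Complex.exp (θ * Complex.I)) • t) with hψ
      have hψc : Continuous ψ := by
        have h0 : Continuous (kc N ε) := kc_contDiff.continuous
        simp only [hψ, Function.uncurry_def]
        fun_prop
      obtain ⟨C, hC⟩ := (IsCompact.prod (isCompact_uIcc (a := (0:ℝ)) (b := 2 * Real.pi)) (isCompact_closedBall (0 : EN N) ε)).exists_bound_of_continuousOn hψc.continuousOn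
      have hfin : Integrable ((univ ×ˢ closedBall (0:EN N) ε).indicator fun _ : ℝ × EN N => C)
          ((volume.restrict (uIoc 0 (2 * Real.pi))).prod (vol N)) := by
        rw [integrable_indicator_iff (MeasurableSet.univ.prod measurableSet_closedBall)]
        refine integrableOn_const ?_
        rw [Measure.prod_prod]
        refine (ENNReal.mul_lt_top ?_ measure_closedBall_lt_top).ne
        simp [uIoc]
      refine hfin.mono' hψc.aestronglyMeasurable ?_
      have : ∀ᵐ p : ℝ × EN N ∂((volume.restrict (uIoc 0 (2 * Real.pi))).prod (vol N)), p.1 ∈ uIoc 0 (2 * Real.pi) :=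
        Measure.quasiMeasurePreserving_fst.ae (ae_restrict_mem measurableSet_uIoc)
      filter_upwards [this] with p hp
      by_cases h : p.2 ∈ closedBall (0:EN N) ε
      · rw [indicator_of_mem (by exact ⟨mem_univ _, h⟩)]
        exact hC p ⟨uIoc_subset_uIcc hp, h⟩
      · rw [indicator_of_notMem (fun h' => h h'.2)]
        rw [mem_closedBall, dist_zero_right, not_le] at h
        simp only [hψ, Function.uncurry_def]
        rw [kc_zero hε h.le]; simp
  simp only [h1, h2] at sw
  rw [integral_mul_const, kc_int hε, intervalIntegral.integral_const] at sw
  have hp : ((2 * Real.pi : ℝ) : ℂ) ≠ 0 := by exact_mod_cast (by positivity)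
  rw [sub_zero, Complex.real_smul, one_mul] at sw
  exact mul_left_cancel₀ hp sw

lemma moll_comm {δ ε : ℝ} (hδ : 0 < δ) (hε : 0 < ε) {f : EN N → ℂ} (hf : LocallyIntegrable f (vol N)) :
    moll ε (moll δ f) = moll δ (moll ε f) := by
  have kcc : ∀ {δ}, Continuous (kc N δ) := kc_contDiff.continuous
  have as : ∀ {δ ε : ℝ}, 0 < δ → 0 < ε → ∀ x, moll ε (moll δ f) x
      = convolution (convolution (kc N ε) (kc N δ) (ContinuousLinearMap.mul ℝ ℂ) (vol N)) f
          (ContinuousLinearMap.mul ℝ ℂ) (vol N) x := by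
    intro δ ε hδ hε x
    have hk : LocallyIntegrable (kc N δ) (vol N) := (kc_integrable hδ).locallyIntegrable
    rw [moll_eq_conv, moll_eq_conv]
    symm
    refine convolution_assoc _ _ _ _ (fun a b c => mul_assoc a b c) kcc.aestronglyMeasurable
      kcc.aestronglyMeasurable hf.aestronglyMeasurable (Eventually.of_forall ?_) (Eventually.of_forall ?_) ?_
    · exact (kc_hcs hε).convolutionExists_left _ kcc hk
    · exact (kc_hcs hδ).norm.convolutionExists_left _ kcc.norm (fun y => (hf y).norm)
    · refine (kc_hcs hε).norm.convolutionExists_left _ kcc.norm ?_ x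
      exact ((kc_hcs hδ).norm.continuous_convolution_left _ kcc.norm (fun y => (hf y).norm)).locallyIntegrable
  ext x
  rw [as hδ hε, as hε hδ]
  congr 1
  rw [← convolution_flip]
  congr 1
  ext a
  simp

lemma moll_indep0 {R δ ε : ℝ} (hδ : 0 < δ) (hε : 0 < ε) {f : EN N → ℂ} (hf : LocallyIntegrable f (vol N))
    (hw : ∀ j η, IsTest D η → ∫ y, dzb (bas j) η y * f y ∂(vol N) = 0) {x : EN N}
    (hx : closedBall x R ⊆ D) (hR : δ + ε ≤ R) : moll δ f x = moll ε f x := by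
  have h : ∀ {δ ε : ℝ}, 0 < δ → 0 < ε → δ + ε ≤ R → moll ε (moll δ f) x = moll δ f x := by
    intro δ ε hδ hε hR
    refine moll_mean hε (moll_contDiff hδ hf).continuous le_rfl fun y hy => ?_
    refine (moll_hol hδ hf hw ?_).differentiableWithinAt
    refine (closedBall_subset_closedBall' ?_).trans hx
    rw [mem_ball] at hy; linarith
  rw [← h hδ hε hR, moll_comm hδ hε hf, h hε hδ (by linarith)]

theorem weyl (hD : IsOpen D) {f : EN N → ℂ}
    (hf : ∀ S, IsCompact S → S ⊆ D → LocallyIntegrable (S.indicator f) (vol N))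
    (hw : ∀ j η, IsTest D η → ∫ y, dzb (bas j) η y * f y ∂(vol N) = 0) :
    ∃ F : EN N → ℂ, DifferentiableOn ℂ F D ∧
      ∀ x r, 0 < r → closedBall x r ⊆ D → ∀ δ, 0 < δ → δ < r → F x = moll δ f x := by
  have hball : ∀ x R, closedBall x R ⊆ D → ∀ j η, IsTest (ball x R) η →
      ∫ y, dzb (bas j) η y * (closedBall x R).indicator f y ∂(vol N) = 0 := by
    intro x R hx j η hη
    rw [← hw j η ⟨hη.cd, hη.cs, hη.sub.trans (ball_subset_closedBall.trans hx)⟩]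
    refine integral_congr_ae (Eventually.of_forall fun y => ?_)
    by_cases hy : y ∈ closedBall x R
    · simp only [indicator_of_mem hy]
    · simp only
      rw [notMem_sub (hη.dzb_isCS (bas j)).sub (fun h' => hy (ball_subset_closedBall h'))]; simp
  have indep : ∀ x r, closedBall x r ⊆ D → ∀ δ ε, 0 < δ → δ < r → 0 < ε → ε < r → moll δ f x = moll ε f x := by
    intro x r hx
    have base : ∀ δ ε, 0 < δ → 0 < ε → δ + ε < r → moll δ f x = moll ε f x := by
      intro δ ε hδ hε hr
      have l : ∀ δ, 0 < δ → δ < r → moll δ f x = moll δ ((closedBall x r).indicator f) x := fun δ hδ hr =>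
        moll_local hδ fun y hy => (indicator_of_mem (closedBall_subset_closedBall hr.le hy) _).symm
      rw [l δ hδ (by linarith), l ε hε (by linarith)]
      exact moll_indep0 hδ hε (hf _ (isCompact_closedBall _ _) hx) (hball x r hx)
        (closedBall_subset_ball hr) le_rfl
    intro δ ε hδ hδr hε hεr
    set η := min (r - δ) (r - ε) / 2
    have h1 : 0 < min (r - δ) (r - ε) := lt_min (by linarith) (by linarith)
    have h2 := min_le_left (r - δ) (r - ε)
    have h3 := min_le_right (r - δ) (r - ε)
    have hη : 0 < η := by positivity
    have hη' : η = min (r - δ) (r - ε) / 2 := rfl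
    rw [base δ η hδ hη (by linarith), base ε η hε hη (by linarith)]
  classical
  let F : EN N → ℂ := fun x => if h : ∃ r, 0 < r ∧ closedBall x r ⊆ D then moll (h.choose / 2) f x else 0
  have hF : ∀ x r, 0 < r → closedBall x r ⊆ D → ∀ δ, 0 < δ → δ < r → F x = moll δ f x := by
    intro x r hr hx δ hδ hδr
    have h : ∃ r, 0 < r ∧ closedBall x r ⊆ D := ⟨r, hr, hx⟩
    simp only [F, dif_pos h]
    have h1 := h.choose_spec
    set r' := h.choose
    have hm : 0 < min r r' := lt_min hr h1.1
    have m1 := min_le_left r r'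
    have m2 := min_le_right r r'
    rw [indep x r' h1.2 (r' / 2) (min r r' / 2) (by linarith) (by linarith) (by linarith) (by linarith),
      indep x r hx (min r r' / 2) δ (by linarith) (by linarith) hδ hδr]
  refine ⟨F, fun a ha => ?_, hF⟩
  obtain ⟨r, hr, hra⟩ := Metric.nhds_basis_closedBall.mem_iff.mp (hD.mem_nhds ha)
  have e : F =ᶠ[𝓝 a] moll (r / 4) ((closedBall a r).indicator f) := by
    filter_upwards [ball_mem_nhds a (show 0 < r / 2 by linarith)] with x hx
    rw [mem_ball] at hx
    have hsub : closedBall x (r / 2) ⊆ closedBall a r := closedBall_subset_closedBall' (by linarith)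
    rw [hF x (r / 2) (by linarith) (hsub.trans hra) (r / 4) (by linarith) (by linarith)]
    exact moll_local (by linarith) fun y hy => (indicator_of_mem
      (hsub (closedBall_subset_closedBall (by linarith) hy)) _).symm
  have := moll_hol (show 0 < r / 4 by linarith) (hf _ (isCompact_closedBall _ _) hra) (hball a r hra)
    (closedBall_subset_ball (x := a) (show r / 4 < r by linarith))
  exact (e.differentiableAt_iff.mpr this).differentiableWithinAt

end weyl
end

open Set Filter Topology Metric MeasureTheory
open scoped ENNReal NNReal InnerProductSpace ComplexConjugate ContDiff Manifold

noncomputable section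
section levi
variable {N : ℕ} {D : Set (EN N)} {u v : EN N → ℝ} {x w a b : EN N}

/-- squared modulus of the complex differential -/
def tq {N : ℕ} (u : EN N → ℝ) (x w : EN N) : ℝ :=
  ((fderiv ℝ u x w)^2 + (fderiv ℝ u x (Complex.I • w))^2) / 4

lemma tq_nonneg : 0 ≤ tq u x w := by unfold tq; positivity

lemma c2_ev (hu : ContDiffAt ℝ 2 u x) : ∀ᶠ y in 𝓝 x, DifferentiableAt ℝ u y := by
  filter_upwards [hu.eventually (by simp)] with y hy
  exact hy.differentiableAt (by norm_num)

lemma c2_dd (hu : ContDiffAt ℝ 2 u x) : DifferentiableAt ℝ (fderiv ℝ u) x :=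
  (hu.fderiv_right (m := 1) (by norm_num)).differentiableAt (by norm_num)

lemma hess_comp {κ κ1 : ℝ → ℝ} {κ2 : ℝ} (hu : ContDiffAt ℝ 2 u x)
    (h1 : ∀ᶠ t in 𝓝 (u x), HasDerivAt κ (κ1 t) t) (h2 : HasDerivAt κ1 κ2 (u x)) :
    Hess (fun y => κ (u y)) x a b = κ2 * (fderiv ℝ u x a * fderiv ℝ u x b) + κ1 (u x) * Hess u x a b := by
  have e : fderiv ℝ (fun y => κ (u y)) =ᶠ[𝓝 x] fun y => κ1 (u y) • fderiv ℝ u y := by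
    filter_upwards [c2_ev hu, hu.continuousAt.eventually h1] with y hy hy'
    exact (hy'.comp_hasFDerivAt y hy.hasFDerivAt).fderiv
  rw [Hess, e.fderiv_eq]
  have hd : HasFDerivAt u (fderiv ℝ u x) x := (hu.differentiableAt (by norm_num)).hasFDerivAt
  have h3 := (h2.comp_hasFDerivAt x hd).smul (c2_dd hu).hasFDerivAt
  erw [h3.fderiv]
  simp [Hess]
  ring

lemma hess_add (hu : ContDiffAt ℝ 2 u x) (hv : ContDiffAt ℝ 2 v x) :
    Hess (fun y => u y + v y) x a b = Hess u x a b + Hess v x a b := by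
  have e : fderiv ℝ (fun y => u y + v y) =ᶠ[𝓝 x] fun y => fderiv ℝ u y + fderiv ℝ v y := by
    filter_upwards [c2_ev hu, c2_ev hv] with y hy hy'
    exact fderiv_fun_add hy hy'
  rw [Hess, e.fderiv_eq, fderiv_fun_add (c2_dd hu) (c2_dd hv)]
  rfl

lemma hess_const_mul (c : ℝ) (hu : ContDiffAt ℝ 2 u x) :
    Hess (fun y => c * u y) x a b = c * Hess u x a b := by
  have := hess_comp (a := a) (b := b) (κ := fun t => c * t) (κ1 := fun _ => c) (κ2 := 0) hu
    (Eventually.of_forall fun t => by simpa using (hasDerivAt_id t).const_mul c) (hasDerivAt_const _ _)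
  simpa using this

lemma levi_comp {κ κ1 : ℝ → ℝ} {κ2 : ℝ} (hu : ContDiffAt ℝ 2 u x)
    (h1 : ∀ᶠ t in 𝓝 (u x), HasDerivAt κ (κ1 t) t) (h2 : HasDerivAt κ1 κ2 (u x)) :
    LeviForm (fun y => κ (u y)) x w = κ1 (u x) * LeviForm u x w + κ2 * tq u x w := by
  rw [LeviForm, hess_comp hu h1 h2, hess_comp hu h1 h2, LeviForm, tq]; ring

lemma levi_add (hu : ContDiffAt ℝ 2 u x) (hv : ContDiffAt ℝ 2 v x) :
    LeviForm (fun y => u y + v y) x w = LeviForm u x w + LeviForm v x w := by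
  rw [LeviForm, hess_add hu hv, hess_add hu hv, LeviForm, LeviForm]; ring

lemma levi_const_mul (c : ℝ) (hu : ContDiffAt ℝ 2 u x) :
    LeviForm (fun y => c * u y) x w = c * LeviForm u x w := by
  rw [LeviForm, hess_const_mul c hu, hess_const_mul c hu, LeviForm]; ring

lemma nsq_contDiff (p : EN N) : ContDiff ℝ 2 (fun y : EN N => ‖y - p‖^2) :=
  (contDiff_norm_sq ℂ).comp (contDiff_id.sub contDiff_const)

lemma nsq_fderiv (p y v : EN N) : fderiv ℝ (fun y : EN N => ‖y - p‖^2) y v = 2 * (⟪y - p, v⟫_ℂ).re := by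
  have h0 : HasFDerivAt (fun y : EN N => y - p) (ContinuousLinearMap.id ℝ (EN N)) y :=
    (hasFDerivAt_id y).sub_const p
  have h1 := Complex.reCLM.hasFDerivAt.comp y (h0.inner ℂ h0)
  have e : (fun y : EN N => ‖y - p‖^2) = Complex.reCLM ∘ fun y => ⟪y - p, y - p⟫_ℂ := by
    ext y
    simp only [Function.comp, Complex.reCLM_apply]
    exact (@inner_self_eq_norm_sq ℂ _ _ _ _ (y - p)).symm
  rw [e, h1.fderiv]
  simp only [ContinuousLinearMap.comp_apply, ContinuousLinearMap.prod_apply, ContinuousLinearMap.id_apply,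
    fderivInnerCLM_apply, Complex.reCLM_apply, Complex.add_re]
  rw [← inner_conj_symm v (y - p), Complex.conj_re]
  ring

lemma nsq_hess (p y a b : EN N) : Hess (fun y : EN N => ‖y - p‖^2) y a b = 2 * (⟪a, b⟫_ℂ).re := by
  have hd := c2_dd (nsq_contDiff p).contDiffAt (x := y)
  have h1 : fderiv ℝ (fun y => fderiv ℝ (fun y : EN N => ‖y - p‖^2) y b) y a
      = Hess (fun y : EN N => ‖y - p‖^2) y a b := by
    rw [fderiv_clm_apply hd (differentiableAt_const b)]
    simp [Hess]
  rw [← h1]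
  simp only [nsq_fderiv]
  have h0 : HasFDerivAt (fun y : EN N => y - p) (ContinuousLinearMap.id ℝ (EN N)) y :=
    (hasFDerivAt_id y).sub_const p
  have h2 := (Complex.reCLM.hasFDerivAt.comp y (h0.inner ℂ (hasFDerivAt_const b y))).const_mul 2
  have e : (fun y : EN N => 2 * (⟪y - p, b⟫_ℂ).re) = fun y => 2 * (Complex.reCLM ∘ fun y => ⟪y - p, b⟫_ℂ) y := rfl
  rw [e, h2.fderiv]
  simp [fderivInnerCLM_apply]

lemma nsq_levi (p : EN N) : LeviForm (fun y : EN N => ‖y - p‖^2) x w = ‖w‖^2 := by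
  rw [LeviForm, nsq_hess, nsq_hess]
  have h1 : (⟪w, w⟫_ℂ).re = ‖w‖^2 := @inner_self_eq_norm_sq ℂ _ _ _ _ w
  have h2 : (⟪Complex.I • w, Complex.I • w⟫_ℂ).re = ‖Complex.I • w‖^2 := @inner_self_eq_norm_sq ℂ _ _ _ _ _
  rw [h1, h2, norm_smul]; simp; ring

lemma nsq_tq (p : EN N) : tq (fun y : EN N => ‖y - p‖^2) x w ≤ ‖x - p‖^2 * ‖w‖^2 := by
  rw [tq, nsq_fderiv, nsq_fderiv, inner_smul_right]
  have h := norm_inner_le_norm (𝕜 := ℂ) (x - p) w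
  have h2 : ‖⟪x - p, w⟫_ℂ‖^2 ≤ (‖x - p‖ * ‖w‖)^2 := by gcongr
  rw [← Complex.normSq_eq_norm_sq, Complex.normSq_apply] at h2
  simp only [Complex.mul_re, Complex.I_re, Complex.I_im, zero_mul, one_mul, zero_sub]
  nlinarith

lemma logw_contDiff (p : EN N) {e : ℝ} (he : 0 < e) :
    ContDiff ℝ 2 (fun y : EN N => Real.log (‖y - p‖^2 + e^2)) :=
  ((nsq_contDiff p).add contDiff_const).log fun y => by positivity

lemma logw_levi (p : EN N) {e : ℝ} (he : 0 < e) : 0 ≤ LeviForm (fun y : EN N => Real.log (‖y - p‖^2 + e^2)) x w := by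
  have hp : 0 < ‖x - p‖^2 + e^2 := by positivity
  have h1 : ∀ᶠ t in 𝓝 (‖x - p‖^2), HasDerivAt (fun t => Real.log (t + e^2)) ((t + e^2)⁻¹) t := by
    filter_upwards [(continuous_id.add continuous_const).continuousAt.eventually (lt_mem_nhds (b := ‖x-p‖^2 + e^2) hp)] with t ht
    have := ((hasDerivAt_id t).add_const (e^2)).log (by exact ht.ne')
    simpa using this
  have h2 : HasDerivAt (fun t : ℝ => (t + e^2)⁻¹) (-1 / (‖x - p‖^2 + e^2)^2) (‖x - p‖^2) := by
    have := ((hasDerivAt_id (‖x - p‖^2)).add_const (e^2)).fun_inv (by exact hp.ne')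
    simpa using this
  rw [levi_comp (nsq_contDiff p).contDiffAt h1 h2, nsq_levi]
  have := nsq_tq (x := x) (w := w) p
  set t := ‖x - p‖^2
  set s := t + e^2 with hs
  have e1 : s⁻¹ * ‖w‖^2 + -1 / s^2 * tq (fun y => ‖y - p‖^2) x w
     = (s * ‖w‖^2 - tq (fun y => ‖y - p‖^2) x w) / s^2 := by field_simp; ring
  rw [e1]
  apply div_nonneg _ (by positivity)
  nlinarith [mul_nonneg (sq_nonneg e) (sq_nonneg ‖w‖)]

end levi

section kern
variable {N : ℕ} {δ : ℝ}

def kI (N : ℕ) (δ : ℝ) : ℝ := ∫ y, kern0 N δ y ∂(vol N)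

lemma kI_scale (hδ : 0 < δ) : kI N δ = δ ^ (Module.finrank ℝ (EN N)) * kI N 1 := by
  have := Measure.integral_comp_inv_smul_of_nonneg (vol N) (kern0 N 1) hδ.le
  rw [smul_eq_mul] at this
  rw [kI, kI, ← this]
  refine integral_congr_ae (Eventually.of_forall fun y => ?_)
  simp only [kern0, norm_smul, norm_inv, Real.norm_eq_abs, abs_of_pos hδ]
  congr 2
  field_simp

lemma kc_bound (hδ : 0 < δ) (y : EN N) : ‖kc N δ y‖ ≤ (kI N δ)⁻¹ := by
  rw [kc, Complex.norm_real, Real.norm_of_nonneg (kern_nonneg y), kern, div_eq_mul_inv]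
  have := kern0_int_pos (N := N) hδ
  refine mul_le_of_le_one_left (inv_nonneg.mpr this.le) ?_
  exact Real.smoothTransition.le_one _

lemma moll_CS (hδ : 0 < δ) {V g : EN N → ℂ} (hV : MemLp V 2 (vol N)) {B : ℝ} {x : EN N}
    (hB : ∀ y ∈ closedBall x δ, ‖g y‖ ≤ B) :
    ‖moll δ (fun y => g y * V y) x‖ ^ 2 ≤ B^2 * (kI N δ)⁻¹ * ∫ y, ‖V y‖^2 ∂(vol N) := by
  have hB0 : 0 ≤ B := (norm_nonneg _).trans (hB x (mem_closedBall_self hδ.le))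
  have kcc : Continuous (kc N δ) := kc_contDiff.continuous
  have hkc : Continuous (fun y => kc N δ (x - y)) := kcc.comp (continuous_const.sub continuous_id)
  have hks : HasCompactSupport (fun y => kc N δ (x - y)) := hcs_reflect (kc_hcs hδ) x
  have hI := kern0_int_pos (N := N) hδ
  have hV2 : Integrable (fun y => ‖V y‖^2) (vol N) := (memLp_two_iff_integrable_sq_norm hV.1).mp hV
  have hk2 : Integrable (fun y => ‖kc N δ (x - y)‖^2) (vol N) :=
    (memLp_two_iff_integrable_sq_norm hkc.aestronglyMeasurable).mp (hkc.memLp_of_hasCompactSupport hks)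
  have step1 : ‖moll δ (fun y => g y * V y) x‖ ≤ B * ∫ y, ‖kc N δ (x - y)‖ * ‖V y‖ ∂(vol N) := by
    rw [moll, ← integral_const_mul]
    refine norm_integral_le_of_norm_le ?_ (Eventually.of_forall fun y => ?_)
    · refine Integrable.const_mul ?_ _
      have := (cs_mul_integrable hkc hks (memLp_locInt hV)).norm
      simpa only [norm_mul] using this
    · by_cases hy : y ∈ closedBall x δ
      · rw [norm_mul, norm_mul]
        have := hB y hy
        calc _ = ‖g y‖ * (‖kc N δ (x - y)‖ * ‖V y‖) := by ring
          _ ≤ _ := by gcongr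
      · rw [mem_closedBall', dist_eq_norm, not_le] at hy
        rw [kc_zero hδ hy.le]; simp
  have step2 : (∫ y, ‖kc N δ (x - y)‖ * ‖V y‖ ∂(vol N))^2 ≤ (∫ y, ‖kc N δ (x - y)‖^2 ∂(vol N)) * ∫ y, ‖V y‖^2 ∂(vol N) := by
    have := integral_mul_le_Lp_mul_Lq_of_nonneg (μ := vol N) (p := 2) (q := 2) Real.HolderConjugate.two_two
      (f := fun y => ‖kc N δ (x - y)‖) (g := fun y => ‖V y‖) (Eventually.of_forall fun y => norm_nonneg _)
      (Eventually.of_forall fun y => norm_nonneg _)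
      (by simpa using (hkc.memLp_of_hasCompactSupport hks (p := 2)).norm) (by simpa using hV.norm)
    simp only [← Real.sqrt_eq_rpow, Real.rpow_two] at this
    have h0 : 0 ≤ ∫ y, ‖kc N δ (x - y)‖ * ‖V y‖ ∂(vol N) := integral_nonneg fun y => by positivity
    calc _ ≤ _ := pow_le_pow_left₀ h0 this 2
      _ = _ := by
        rw [mul_pow, Real.sq_sqrt (integral_nonneg fun y => by positivity),
          Real.sq_sqrt (integral_nonneg fun y => by positivity)]
  have step3 : ∫ y, ‖kc N δ (x - y)‖^2 ∂(vol N) ≤ (kI N δ)⁻¹ := by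
    have h1 : ∫ y, ‖kc N δ (x - y)‖^2 ∂(vol N) = ∫ y, ‖kc N δ y‖^2 ∂(vol N) :=
      integral_sub_left_eq_self (fun y => ‖kc N δ y‖^2) (vol N) x
    rw [h1]
    have h2 : ∫ y, (kI N δ)⁻¹ * kern N δ y ∂(vol N) = (kI N δ)⁻¹ := by
      rw [integral_const_mul, kern_int hδ, mul_one]
    rw [← h2]
    refine integral_mono_of_nonneg (Eventually.of_forall fun y => by positivity)
      ((kern_integrable hδ).const_mul _) (Eventually.of_forall fun y => ?_)
    simp only
    have h3 : ‖kc N δ y‖ = kern N δ y := by rw [kc, Complex.norm_real, Real.norm_of_nonneg (kern_nonneg y)]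
    have := kc_bound hδ y
    rw [sq]
    nth_rw 2 [h3]
    exact mul_le_mul_of_nonneg_right this (kern_nonneg y)
  have hVn : 0 ≤ ∫ y, ‖V y‖^2 ∂(vol N) := integral_nonneg fun y => by positivity
  calc _ ≤ (B * ∫ y, ‖kc N δ (x - y)‖ * ‖V y‖ ∂(vol N))^2 := pow_le_pow_left₀ (norm_nonneg _) step1 2
    _ = B^2 * (∫ y, ‖kc N δ (x - y)‖ * ‖V y‖ ∂(vol N))^2 := by ring
    _ ≤ B^2 * ((kI N δ)⁻¹ * ∫ y, ‖V y‖^2 ∂(vol N)) := by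
      gcongr
      exact step2.trans (mul_le_mul_of_nonneg_right step3 hVn)
    _ = _ := by ring
end kern
end

open Set Filter Topology Metric MeasureTheory
open scoped ENNReal NNReal InnerProductSpace ComplexConjugate ContDiff Manifold

noncomputable section
section bpp
variable {N : ℕ} {D : Set (EN N)}

/-- one application of Hörmander + Weyl -/
lemma hw {ψ θ : EN N → ℝ} (H : Horm D ψ θ) {u₀ : EN N → ℂ} (hu₀ : IsTest D u₀) :
    ∃ (F V : EN N → ℂ), DifferentiableOn ℂ F D ∧ MemLp V 2 (vol N) ∧
      ∫ x, ‖V x‖^2 ∂(vol N) ≤ ∫ x, (∑ j, ‖dzb (bas j) u₀ x‖^2) * Real.exp (-(ψ x - θ x)) ∂(vol N) ∧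
      ∀ x r, 0 < r → closedBall x r ⊆ D → ∀ δ, 0 < δ → δ < r → ∀ c : ℂ, (∀ y ∈ closedBall x δ, u₀ y = c) →
        ∀ B, (∀ y ∈ closedBall x δ, Real.exp (ψ y - 2 * θ y) ≤ B) →
        ‖c - F x‖^2 ≤ B * (kI N δ)⁻¹ * ∫ y, ‖V y‖^2 ∂(vol N) := by
  obtain ⟨V, hV, hV0, hVn, hVw⟩ := hormander H hu₀
  set er := cexpR (fun y => (ψ y - 2 * θ y) / 2) with her
  have der : ContinuousOn er D := (cexpR_contDiffOn (n := 2)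
    ((H.hψ.sub (contDiffOn_const.mul H.hθ)).div_const 2)).continuousOn
  have hi : ∀ S, IsCompact S → S ⊆ D → MemLp (S.indicator fun y => er y * V y) 2 (vol N) := by
    intro S hS hSD
    obtain ⟨M, hM⟩ := hS.exists_bound_of_continuousOn (der.mono hSD)
    have h1 : MemLp (fun y => S.indicator er y * V y) 2 (vol N) := by
      refine memLp_bdd_mul (M := max M 0) hV
        (indicator_meas (der.mono hSD) hS.isClosed.measurableSet).aestronglyMeasurable fun x => ?_
      by_cases hx : x ∈ S
      · rw [indicator_of_mem hx]; exact (hM x hx).trans (le_max_left _ _)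
      · rw [indicator_of_notMem hx]; simp
    convert h1 using 1
    ext y
    by_cases hy : y ∈ S
    · simp [indicator_of_mem hy]
    · simp [indicator_of_notMem hy]
  have hl : ∀ S, IsCompact S → S ⊆ D →
      LocallyIntegrable (S.indicator fun y => u₀ y - er y * V y) (vol N) := by
    intro S hS hSD
    have h2 : MemLp (S.indicator u₀) 2 (vol N) := (hu₀.isCS.memLpR 2 _).indicator hS.isClosed.measurableSet
    have h3 := memLp_locInt (h2.sub (hi S hS hSD))
    rwa [← indicator_sub'] at h3
  obtain ⟨F, hF, hFm⟩ := weyl H.op hl hVw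
  refine ⟨F, V, hF, hV, hVn, ?_⟩
  intro x r hr hx δ hδ hδr c hc B hB
  rw [hFm x r hr hx δ hδ hδr]
  have hsub : closedBall x δ ⊆ D := (closedBall_subset_closedBall hδr.le).trans hx
  have e1 : moll δ (fun y => u₀ y - er y * V y) x = c - moll δ (fun y => er y * V y) x := by
    rw [moll_local (g := fun y => c - (closedBall x δ).indicator (fun y => er y * V y) y) hδ
      (fun y hy => by simp only [hc y hy, indicator_of_mem hy])]
    rw [moll_local (f := fun y => er y * V y) (g := (closedBall x δ).indicator (fun y => er y * V y)) hδ
      (fun y hy => by simp only [indicator_of_mem hy])]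
    simp only [moll, mul_sub]
    have hkc : Continuous (fun y => kc N δ (x - y)) := kc_contDiff.continuous.comp (continuous_const.sub continuous_id)
    have hks : HasCompactSupport (fun y => kc N δ (x - y)) := hcs_reflect (kc_hcs hδ) x
    rw [integral_sub]
    · congr 1
      rw [integral_mul_const, integral_sub_left_eq_self (fun y => kc N δ y) (vol N) x, kc_int hδ, one_mul]
    · exact (integrable_C1cs hkc hks).mul_const _
    · exact cs_mul_integrable hkc hks (memLp_locInt (hi _ (isCompact_closedBall _ _) hsub))
  rw [e1, sub_sub_cancel]
  have hB0 : 0 ≤ B := (Real.exp_pos _).le.trans (hB x (mem_closedBall_self hδ.le))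
  have := moll_CS (B := Real.sqrt B) (g := er) hδ hV (x := x) (fun y hy => by
    rw [her, norm_cexpR]
    apply Real.le_sqrt_of_sq_le
    refine le_trans (le_of_eq ?_) (hB y hy)
    rw [← Real.exp_nat_mul]; congr 1; push_cast; ring)
  rwa [Real.sq_sqrt hB0] at this

end bpp
end

open Set Filter Topology Metric MeasureTheory
open scoped ENNReal NNReal InnerProductSpace ComplexConjugate ContDiff Manifold

noncomputable section
section bpp2
variable {N : ℕ} {D : Set (EN N)}

lemma horm_weight {G θ ψ0 : EN N → ℝ} (H : Horm D G θ) (h0 : ContDiffOn ℝ 2 ψ0 D)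
    (hl : ∀ x ∈ D, ∀ w, 0 ≤ LeviForm ψ0 x w) {M a e : ℝ} (hM : 0 ≤ M) (ha : 0 ≤ a) (he : 0 < e)
    (p : EN N) :
    Horm D (fun y => (M * ψ0 y + a * Real.log (‖y - p‖^2 + e^2)) + G y) θ where
  op := H.op
  hψ := ((contDiffOn_const.mul h0).add
    (contDiffOn_const.mul (logw_contDiff p he).contDiffOn)).add H.hψ
  hθ := H.hθ
  levi x hx w := by
    have h1 : ContDiffAt ℝ 2 ψ0 x := h0.contDiffAt (H.op.mem_nhds hx)
    have h2 : ContDiffAt ℝ 2 G x := H.hψ.contDiffAt (H.op.mem_nhds hx)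
    have h3 : ContDiffAt ℝ 2 (fun y : EN N => Real.log (‖y - p‖^2 + e^2)) x := (logw_contDiff p he).contDiffAt
    rw [levi_add ((contDiffAt_const.mul h1).add (contDiffAt_const.mul h3)) h2,
      levi_add (contDiffAt_const.mul h1) (contDiffAt_const.mul h3), levi_const_mul _ h1,
      levi_const_mul _ h3]
    have := H.levi x hx w
    have := mul_nonneg hM (hl x hx w)
    have := mul_nonneg ha (logw_levi (x := x) (w := w) p he)
    linarith
  cut := H.cut

theorem Bpp {G θ ψ0 : EN N → ℝ} (H : Horm D G θ) (h0 : ContDiffOn ℝ 2 ψ0 D)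
    (hl : ∀ x ∈ D, ∀ w, 0 ≤ LeviForm ψ0 x w) {p : EN N} (hp : p ∈ D) {X : Set (EN N)}
    (hX : IsCompact X) (hXD : X ⊆ D) (hXp : ∀ x ∈ X, ψ0 x < ψ0 p) :
    ∃ F : EN N → ℂ, DifferentiableOn ℂ F D ∧ F p = 1 ∧ ∀ x ∈ X, ‖F x‖ ≤ 1/2 := by
  obtain ⟨l1, hl1p, hl1⟩ : ∃ l1 < ψ0 p, ∀ x ∈ X, ψ0 x < l1 := by
    rcases X.eq_empty_or_nonempty with rfl | hne
    · exact ⟨ψ0 p - 1, by linarith, by simp⟩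
    · obtain ⟨x0, hx0, hm⟩ := hX.exists_isMaxOn hne (h0.continuousOn.mono hXD)
      refine ⟨(ψ0 x0 + ψ0 p)/2, by linarith [hXp x0 hx0], fun x hx => ?_⟩
      have : ψ0 x ≤ ψ0 x0 := hm hx
      linarith [hXp x0 hx0]
  set l2 := (l1 + ψ0 p) / 2 with hl2
  have hcont := h0.continuousOn
  have op1 : IsOpen (D ∩ ψ0 ⁻¹' Iio l1) := hcont.isOpen_inter_preimage H.op isOpen_Iio
  have op2 : IsOpen (D ∩ ψ0 ⁻¹' Ioi l2) := hcont.isOpen_inter_preimage H.op isOpen_Ioi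
  obtain ⟨r2, hr2, hr2s⟩ := hX.exists_cthickening_subset_open op1 (fun x hx => ⟨hXD hx, hl1 x hx⟩)
  have hX2c : IsCompact (cthickening r2 X) := hX.cthickening
  obtain ⟨r1, hr1, hr1s⟩ := nhds_basis_closedBall.mem_iff.1
    (op2.mem_nhds (show p ∈ D ∩ ψ0 ⁻¹' Ioi l2 from ⟨hp, by simp only [mem_preimage, mem_Ioi]; linarith⟩))
  obtain ⟨χ, hχ, -, hχc, hχs, hχ1⟩ := exists_cutoff (isCompact_singleton (x := p)) (isOpen_ball (x := p) (ε := r1))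
    (singleton_subset_iff.2 (mem_ball_self hr1))
  rw [nhdsSet_singleton] at hχ1
  obtain ⟨r0, hr0, hr0s⟩ := nhds_basis_closedBall.mem_iff.1 hχ1
  set u₀ : EN N → ℂ := fun x => (χ x : ℂ) with hu₀d
  have hcb : ball p r1 ⊆ closedBall p r1 := ball_subset_closedBall
  have hts : tsupport u₀ ⊆ tsupport χ := by
    refine closure_mono fun x hx => ?_
    simp only [Function.mem_support, hu₀d] at hx ⊢
    exact_mod_cast hx
  have hu₀ : IsTest D u₀ := by
    refine ⟨?_, ?_, ?_⟩
    · exact contDiff_ofReal_comp (n := 2) (hχ.of_le two_le_infty)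
    · exact hχc.of_isClosed_subset (isClosed_tsupport _) hts
    · exact fun x hx => (hr1s (hcb (hχs (hts hx)))).1
  set S : EN N → ℝ := fun x => ∑ j, ‖dzb (bas j) u₀ x‖^2 with hS
  have hSct : Continuous S := continuous_finsetSum _ fun j _ => ((hu₀.dzb_isCS (bas j)).ct.norm.pow 2)
  have hS0 : ∀ x, 0 ≤ S x := fun x => Finset.sum_nonneg fun j _ => by positivity
  have hSout : ∀ x, x ∉ tsupport u₀ → S x = 0 := by
    intro x hx
    refine Finset.sum_eq_zero fun j _ => ?_
    have : dzb (bas j) u₀ x = 0 := image_eq_zero_of_notMem_tsupport fun h => hx (tsupport_dzb _ h)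
    simp [this]
  have hSin : ∀ x ∈ ball p r0, S x = 0 := by
    intro x hx
    refine Finset.sum_eq_zero fun j _ => ?_
    have e1 : u₀ =ᶠ[𝓝 x] fun _ => 1 := by
      filter_upwards [isOpen_ball.mem_nhds hx] with y hy
      have : χ y = 1 := hr0s (ball_subset_closedBall hy)
      simp [hu₀d, this]
    rw [dzb_congr e1]
    simp [dzb]
  have hSts : tsupport S ⊆ tsupport u₀ := by
    refine closure_minimal (fun x hx => ?_) (isClosed_tsupport _)
    by_contra h
    exact hx (hSout x h)
  have hScs : IsCS D S := ⟨hSct, hu₀.cs.of_isClosed_subset (isClosed_tsupport _) hSts, hSts.trans hu₀.sub⟩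
  set n := Module.finrank ℝ (EN N) with hn
  set a : ℝ := (n:ℝ) + 1 with ha
  have ha0 : 0 ≤ a := by positivity
  have hθc := H.hθ.continuousOn
  have hGc := H.hψ.continuousOn
  have hI : Integrable (fun x => S x * (Real.exp (-(a * Real.log (r0^2))) * Real.exp (θ x - G x))) (vol N) := by
    have := hScs.mul_on H.op (F := fun x => Real.exp (-(a * Real.log (r0^2))) * Real.exp (θ x - G x))
      (continuousOn_const.mul (hθc.sub hGc).rexp)
    exact this.ct.integrable_of_hasCompactSupport this.cs
  set C1 := ∫ x, S x * (Real.exp (-(a * Real.log (r0^2))) * Real.exp (θ x - G x)) ∂(vol N) with hC1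
  have hC10 : 0 ≤ C1 := integral_nonneg fun x => mul_nonneg (hS0 x) (by positivity)
  have key : ∀ M e, 0 ≤ M → 0 < e → ∫ x, (∑ j, ‖dzb (bas j) u₀ x‖^2) * Real.exp (-(((M * ψ0 x + a * Real.log (‖x - p‖^2 + e^2)) + G x) - θ x)) ∂(vol N) ≤ Real.exp (-(M * l2)) * C1 := by
    intro M e hM he
    rw [hC1, ← integral_const_mul]
    refine integral_mono_of_nonneg (Eventually.of_forall fun x => mul_nonneg (hS0 x) (by positivity)) (hI.const_mul _)
      (Eventually.of_forall fun x => ?_)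
    simp only
    rw [mul_left_comm]
    by_cases hx : x ∈ tsupport u₀
    swap
    · have := hSout x hx
      rw [this]; simp only [hS] at this
      simp [this]
    by_cases hx2 : x ∈ ball p r0
    · have := hSin x hx2
      rw [this]; simp only [hS] at this
      simp [this]
    refine mul_le_mul_of_nonneg_left ?_ (hS0 x)
    rw [← Real.exp_add, ← Real.exp_add, Real.exp_le_exp]
    have h1 : l2 < ψ0 x := (hr1s (hcb (hχs (hts hx)))).2
    have h2 : Real.log (r0^2) ≤ Real.log (‖x - p‖^2 + e^2) := by
      apply Real.log_le_log (by positivity)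
      have : r0 ≤ ‖x - p‖ := by rw [← dist_eq_norm]; simpa using hx2
      nlinarith
    have := mul_le_mul_of_nonneg_left h1.le hM
    have := mul_le_mul_of_nonneg_left h2 ha0
    linarith
  -- bound near X
  obtain ⟨Q2, hQ2⟩ := hX2c.exists_bound_of_continuousOn (f := fun y => a * Real.log (‖y - p‖^2 + 1^2) + G y - 2 * θ y)
    (((continuousOn_const.mul (logw_contDiff p one_pos).continuous.continuousOn).add
      (hGc.mono fun y hy => (hr2s hy).1)).sub (continuousOn_const.mul (hθc.mono fun y hy => (hr2s hy).1)))
  set A3 := Real.exp Q2 * (kI N (r2/2))⁻¹ * C1 with hA3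
  have hkp : ∀ d, 0 < d → 0 < kI N d := fun d hd => kern0_int_pos hd
  obtain ⟨M, hM0, hM⟩ : ∃ M : ℝ, 0 ≤ M ∧ A3 * Real.exp (-(M * (l2 - l1))) ≤ 1/16 := by
    have hd : 0 < l2 - l1 := by rw [hl2]; linarith
    have : Tendsto (fun M : ℝ => A3 * Real.exp (-(M * (l2 - l1)))) atTop (𝓝 (A3 * 0)) :=
      (Real.tendsto_exp_neg_atTop_nhds_zero.comp (tendsto_id.atTop_mul_const hd)).const_mul A3
    rw [mul_zero] at this
    obtain ⟨M, h1, h2⟩ := ((this.eventually (gt_mem_nhds (show (0:ℝ) < 1/16 by norm_num))).and (eventually_ge_atTop 0)).exists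
    exact ⟨M, h2, h1.le⟩
  obtain ⟨Q3, hQ3⟩ := (isCompact_closedBall p r1).exists_bound_of_continuousOn (f := fun y => M * ψ0 y + G y - 2 * θ y)
    (((continuousOn_const.mul (hcont.mono fun y hy => (hr1s hy).1)).add
      (hGc.mono fun y hy => (hr1s hy).1)).sub (continuousOn_const.mul (hθc.mono fun y hy => (hr1s hy).1)))
  set A4 := 2^(n+1) * Real.exp Q3 * (kI N 1)⁻¹ * (Real.exp (-(M * l2)) * C1) with hA4
  have hA40 : 0 ≤ A4 := by have := hkp 1 one_pos; positivity
  set e := min (min 1 (1 / (4 * (A4 + 1)))) (min r0 r1 / 2) with hedef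
  have he : 0 < e := by positivity
  have he1 : e ≤ 1 := (min_le_left _ _).trans (min_le_left _ _)
  have heA : e ≤ 1 / (4 * (A4 + 1)) := (min_le_left _ _).trans (min_le_right _ _)
  have her : e ≤ min r0 r1 / 2 := min_le_right _ _
  have her0 : e < r0 := by linarith [min_le_left r0 r1]
  have her1 : e < r1 := by linarith [min_le_right r0 r1]
  obtain ⟨F, V, hF, hV, hVn, hFb⟩ := hw (horm_weight H h0 hl hM0 ha0 he p) hu₀
  have hVn2 := hVn.trans (key M e hM0 he)
  have fX : ∀ x ∈ X, ‖F x‖ ≤ 1/4 := by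
    intro x hx
    have hcbx : closedBall x (r2/2) ⊆ cthickening r2 X :=
      (closedBall_subset_closedBall (by linarith)).trans (closedBall_subset_cthickening hx r2)
    have := hFb x r2 hr2 (fun y hy => (hr2s (closedBall_subset_cthickening hx r2 hy)).1) (r2/2) (by positivity)
      (by linarith) 0 (fun y hy => ?_) (Real.exp (M * l1 + Q2)) (fun y hy => ?_)
    · rw [zero_sub, norm_neg] at this
      have h2 : ‖F x‖^2 ≤ (1/4)^2 := by
        refine this.trans ((mul_le_mul_of_nonneg_left hVn2 ?_).trans (le_trans (le_of_eq ?_) (hM.trans (by norm_num))))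
        · have := hkp (r2/2) (by positivity)
          positivity
        · rw [hA3, show -(M * (l2 - l1)) = M * l1 + -(M * l2) by ring, Real.exp_add, Real.exp_add]; ring
      exact le_of_sq_le_sq h2 (by norm_num) 
    · have h1 := (hr2s (hcbx hy)).2
      have : y ∉ tsupport u₀ := fun h => by
        have := (hr1s (hcb (hχs (hts h)))).2
        simp only [mem_preimage, mem_Iio, mem_Ioi] at h1 this
        linarith
      exact image_eq_zero_of_notMem_tsupport this
    · rw [Real.exp_le_exp]
      have h1 : ψ0 y < l1 := (hr2s (hcbx hy)).2
      have h2 := (le_abs_self _).trans (hQ2 y (hcbx hy))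
      have h3 : Real.log (‖y - p‖^2 + e^2) ≤ Real.log (‖y - p‖^2 + 1^2) := by
        apply Real.log_le_log (by positivity)
        nlinarith
      have := mul_le_mul_of_nonneg_left h1.le hM0
      have := mul_le_mul_of_nonneg_left h3 ha0
      linarith
  have fp : ‖1 - F p‖ ≤ 1/2 := by
    have := hFb p r1 hr1 (fun y hy => (hr1s hy).1) e he her1 1 (fun y hy => ?_) ((2 * e^2)^(n+1) * Real.exp Q3) (fun y hy => ?_)
    · have h2 : ‖1 - F p‖^2 ≤ (1/2)^2 := by
        refine this.trans ((mul_le_mul_of_nonneg_left hVn2 ?_).trans ?_)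
        · have := hkp e he
          positivity
        · rw [kI_scale he, ← hn]
          have e1 : (2 * e^2)^(n+1) * Real.exp Q3 * (e^n * kI N 1)⁻¹ * (Real.exp (-(M * l2)) * C1) = e^(n+2) * A4 := by
            rw [hA4]; field_simp; ring
          rw [e1]
          have h3 : e^(n+2) ≤ e := pow_le_of_le_one he.le he1 (by omega)
          calc e^(n+2) * A4 ≤ e * A4 := mul_le_mul_of_nonneg_right h3 hA40
            _ ≤ 1 / (4 * (A4 + 1)) * A4 := mul_le_mul_of_nonneg_right heA hA40
            _ ≤ _ := by rw [div_mul_eq_mul_div, div_le_iff₀ (by positivity)]; nlinarith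
      exact le_of_sq_le_sq h2 (by norm_num)
    · have : χ y = 1 := hr0s (closedBall_subset_closedBall her0.le hy)
      simp [hu₀d, this]
    · have h2 := (le_abs_self _).trans (hQ3 y (closedBall_subset_closedBall her1.le hy))
      have h4 : ‖y - p‖ ≤ e := by rw [← dist_eq_norm]; exact hy
      have h5 : ‖y - p‖^2 + e^2 ≤ 2 * e^2 := by nlinarith [norm_nonneg (y - p)]
      have h3 : Real.log (‖y - p‖^2 + e^2) ≤ Real.log (2 * e^2) := Real.log_le_log (by positivity) h5
      have h6 : (2 * e^2)^(n+1) = Real.exp (a * Real.log (2 * e^2)) := by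
        rw [ha, mul_comm ((n:ℝ)+1), Real.exp_mul, Real.exp_log (by positivity)]
        exact_mod_cast (Real.rpow_natCast _ (n+1)).symm
      rw [h6, ← Real.exp_add, Real.exp_le_exp]
      have := mul_le_mul_of_nonneg_left h3 ha0
      linarith
  have hFp : 1/2 ≤ ‖F p‖ := by
    have h1 : ‖(1:ℂ)‖ ≤ ‖1 - F p‖ + ‖F p‖ := by simpa using norm_add_le (1 - F p) (F p)
    rw [norm_one] at h1
    linarith
  have hFp0 : F p ≠ 0 := fun h => by rw [h] at hFp; norm_num at hFp
  refine ⟨fun x => F x * (F p)⁻¹, hF.mul_const _, mul_inv_cancel₀ hFp0, fun x hx => ?_⟩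
  rw [norm_mul, norm_inv, ← div_eq_mul_inv, div_le_iff₀ (by positivity)]
  linarith [fX x hx]
end bpp2
end

open Set Filter Topology Metric MeasureTheory
open scoped ENNReal NNReal InnerProductSpace ComplexConjugate ContDiff Manifold

noncomputable section
section geo
variable {N : ℕ} {D V : Set (EN N)} {ρ : EN N → ℝ}

/-- basic geometric data of a strictly pseudoconvex domain -/
structure Geo {N : ℕ} (D V : Set (EN N)) (ρ : EN N → ℝ) : Prop where
  opD : IsOpen D
  opV : IsOpen V
  cpt : IsCompact (closure D)
  sub : closure D ⊆ V
  cd : ContDiffOn ℝ 2 ρ V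
  eqD : D = {z ∈ V | ρ z < 0}
  dne : ∀ p ∈ frontier D, fderiv ℝ ρ p ≠ 0
  lev : ∀ p ∈ frontier D, ∀ w, w ≠ 0 → ComplexTangent ρ p w → 0 < LeviForm ρ p w

lemma StrictPSCWith.geo (h : StrictPSCWith D ρ) : ∃ V, Geo D V ρ := by
  obtain ⟨⟨h1, -⟩, h2, ⟨V, h3, h4, h5, h6, h7⟩, h8⟩ := h
  exact ⟨V, h1, h3, h2.isCompact_closure, h4, h5, h6, h7, h8⟩

namespace Geo
lemma neg (h : Geo D V ρ) {z} (hz : z ∈ D) : ρ z < 0 := by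
  have := h.eqD ▸ hz
  exact this.2

lemma DV (h : Geo D V ρ) : D ⊆ V := subset_closure.trans h.sub

lemma mem_fr (h : Geo D V ρ) {z} (hz : z ∈ closure D) (h0 : 0 ≤ ρ z) : z ∈ frontier D := by
  rw [h.opD.frontier_eq]
  exact ⟨hz, fun hD => absurd (h.neg hD) (not_lt.2 h0)⟩

lemma cat (h : Geo D V ρ) {z} (hz : z ∈ V) : ContDiffAt ℝ 2 ρ z := h.cd.contDiffAt (h.opV.mem_nhds hz)

lemma c1 (h : Geo D V ρ) : ContinuousOn (fderiv ℝ ρ) V :=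
  h.cd.continuousOn_fderiv_of_isOpen h.opV (by norm_num)

lemma c2 (h : Geo D V ρ) : ContinuousOn (fderiv ℝ (fderiv ℝ ρ)) V :=
  (h.cd.fderiv_of_isOpen h.opV (m := 1) (by norm_num)).continuousOn_fderiv_of_isOpen h.opV (by norm_num)

lemma levi_cont (h : Geo D V ρ) : ContinuousOn (fun q : EN N × EN N => LeviForm ρ q.1 q.2) (V ×ˢ univ) := by
  unfold LeviForm Hess
  have h2 : ContinuousOn (fun q : EN N × EN N => fderiv ℝ (fderiv ℝ ρ) q.1) (V ×ˢ univ) :=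
    h.c2.comp continuousOn_fst (fun q hq => hq.1)
  have h3 : ContinuousOn (fun q : EN N × EN N => Complex.I • q.2) (V ×ˢ univ) := by fun_prop
  exact (((h2.clm_apply continuousOn_snd).clm_apply continuousOn_snd).add
    ((h2.clm_apply h3).clm_apply h3)).div_const _

lemma tq_cont (h : Geo D V ρ) : ContinuousOn (fun q : EN N × EN N => tq ρ q.1 q.2) (V ×ˢ univ) := by
  unfold tq
  have h2 : ContinuousOn (fun q : EN N × EN N => fderiv ℝ ρ q.1) (V ×ˢ univ) :=
    h.c1.comp continuousOn_fst (fun q hq => hq.1)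
  have h3 : ContinuousOn (fun q : EN N × EN N => Complex.I • q.2) (V ×ˢ univ) := by fun_prop
  exact (((h2.clm_apply continuousOn_snd).pow 2).add ((h2.clm_apply h3).pow 2)).div_const _

lemma levi_lim (h : Geo D V ρ) {z w : ℕ → EN N} {z0 w0 : EN N} (hz0 : z0 ∈ V) (hz : Tendsto z atTop (𝓝 z0))
    (hw : Tendsto w atTop (𝓝 w0)) :
    Tendsto (fun n => LeviForm ρ (z n) (w n)) atTop (𝓝 (LeviForm ρ z0 w0)) := by
  have h1 := h.levi_cont.continuousAt ((h.opV.prod isOpen_univ).mem_nhds (show (z0, w0) ∈ V ×ˢ univ from ⟨hz0, mem_univ w0⟩))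
  have h2 : Tendsto (fun n => (z n, w n)) atTop (𝓝 (z0, w0)) := hz.prodMk_nhds hw
  have h3 := Tendsto.comp (show Tendsto _ (𝓝 (z0, w0)) _ from h1) h2
  exact h3

lemma tq_lim (h : Geo D V ρ) {z w : ℕ → EN N} {z0 w0 : EN N} (hz0 : z0 ∈ V) (hz : Tendsto z atTop (𝓝 z0))
    (hw : Tendsto w atTop (𝓝 w0)) :
    Tendsto (fun n => tq ρ (z n) (w n)) atTop (𝓝 (tq ρ z0 w0)) := by
  have h1 := h.tq_cont.continuousAt ((h.opV.prod isOpen_univ).mem_nhds (show (z0, w0) ∈ V ×ˢ univ from ⟨hz0, mem_univ w0⟩))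
  have h2 : Tendsto (fun n => (z n, w n)) atTop (𝓝 (z0, w0)) := hz.prodMk_nhds hw
  have h3 := Tendsto.comp (show Tendsto _ (𝓝 (z0, w0)) _ from h1) h2
  exact h3

end Geo

lemma levi_smul (t : ℝ) (x w : EN N) : LeviForm ρ x (t • w) = t^2 * LeviForm ρ x w := by
  simp only [LeviForm, Hess, smul_comm Complex.I t w, map_smul, smul_apply, smul_eq_mul]; ring

lemma tq_smul (t : ℝ) (x w : EN N) : tq ρ x (t • w) = t^2 * tq ρ x w := by
  simp only [tq, smul_comm Complex.I t w, map_smul, smul_eq_mul]; ring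

lemma norm_I_smul (w : EN N) : ‖Complex.I • w‖ = ‖w‖ := by rw [norm_smul]; simp

lemma levi_bound (x w : EN N) : |LeviForm ρ x w| ≤ ‖fderiv ℝ (fderiv ℝ ρ) x‖ * ‖w‖^2 := by
  have h1 := (fderiv ℝ (fderiv ℝ ρ) x).le_opNorm₂ w w
  have h2 := (fderiv ℝ (fderiv ℝ ρ) x).le_opNorm₂ (Complex.I • w) (Complex.I • w)
  rw [norm_I_smul] at h2
  rw [Real.norm_eq_abs] at h1 h2
  simp only [LeviForm, Hess]
  rw [abs_div, abs_of_pos (show (0:ℝ) < 4 by norm_num)]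
  have h3 := abs_add_le (fderiv ℝ (fderiv ℝ ρ) x w w) (fderiv ℝ (fderiv ℝ ρ) x (Complex.I • w) (Complex.I • w))
  have h4 : 0 ≤ ‖fderiv ℝ (fderiv ℝ ρ) x‖ * ‖w‖ * ‖w‖ := by positivity
  rw [sq, ← mul_assoc]
  linarith

set_option maxHeartbeats 1000000 in
lemma Geo.collar (h : Geo D V ρ) : ∃ c > 0, ∃ A ≥ 0, ∀ z ∈ closure D, -c ≤ ρ z →
    c ≤ ‖fderiv ℝ ρ z‖ ∧ ∀ w, c * ‖w‖^2 ≤ LeviForm ρ z w + A * tq ρ z w := by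
  by_contra hcon
  push Not at hcon
  have key : ∀ n : ℕ, ∃ z ∈ closure D, -(1/((n:ℝ)+1)) ≤ ρ z ∧ ∃ w : EN N,
      (‖fderiv ℝ ρ z‖ < 1/((n:ℝ)+1) ∧ w = 0 ∨ ‖w‖ = 1 ∧ LeviForm ρ z w + n * tq ρ z w < 1/((n:ℝ)+1)) := by
    intro n
    obtain ⟨z, hz, h1, h2⟩ := hcon (1/((n:ℝ)+1)) (by positivity) n (by positivity)
    refine ⟨z, hz, h1, ?_⟩
    by_cases h3 : 1/((n:ℝ)+1) ≤ ‖fderiv ℝ ρ z‖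
    · obtain ⟨w, hw⟩ := h2 h3
      have hw0 : w ≠ 0 := by
        rintro rfl
        simp [LeviForm, tq, Hess] at hw
      have hwp : 0 < ‖w‖ := norm_pos_iff.2 hw0
      refine ⟨(‖w‖⁻¹ : ℝ) • w, Or.inr ⟨?_, ?_⟩⟩
      · rw [norm_smul]; simp [hwp.ne']
      · rw [levi_smul, tq_smul]
        have : (‖w‖⁻¹)^2 * (LeviForm ρ z w + n * tq ρ z w) < (‖w‖⁻¹)^2 * (1/((n:ℝ)+1) * ‖w‖^2) :=
          mul_lt_mul_of_pos_left hw (by positivity)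
        rw [show (‖w‖⁻¹)^2 * (1/((n:ℝ)+1) * ‖w‖^2) = 1/((n:ℝ)+1) by field_simp] at this
        linarith
    · exact ⟨0, Or.inl ⟨not_le.1 h3, rfl⟩⟩
  choose z hz h1 w hw using key
  have hwb : ∀ n, (z n, w n) ∈ closure D ×ˢ closedBall (0 : EN N) 1 := fun n => ⟨hz n, by
    rcases hw n with h | h
    · simp [h.2]
    · simp [h.1]⟩
  obtain ⟨⟨z0, w0⟩, ⟨hz0, -⟩, φ, hφ, hlim⟩ := (h.cpt.prod (isCompact_closedBall (0 : EN N) 1)).tendsto_subseq hwb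
  have hinv : Tendsto (fun n => 1/(((φ n : ℕ):ℝ)+1)) atTop (𝓝 0) :=
    (tendsto_one_div_add_atTop_nhds_zero_nat (𝕜 := ℝ)).comp hφ.tendsto_atTop
  have hzl : Tendsto (fun n => z (φ n)) atTop (𝓝 z0) := (continuous_fst.tendsto _).comp hlim
  have hwl : Tendsto (fun n => w (φ n)) atTop (𝓝 w0) := (continuous_snd.tendsto _).comp hlim
  have hzV := h.sub hz0
  have hρ0 : 0 ≤ ρ z0 := by
    have h3 : Tendsto (fun n => ρ (z (φ n))) atTop (𝓝 (ρ z0)) := (h.cat hzV).continuousAt.tendsto.comp hzl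
    have h4 : Tendsto (fun n => -(1/(((φ n : ℕ):ℝ)+1))) atTop (𝓝 0) := by simpa using hinv.neg
    exact le_of_tendsto_of_tendsto' h4 h3 fun n => h1 (φ n)
  have hfr := h.mem_fr hz0 hρ0
  have hd : Tendsto (fun n => ‖fderiv ℝ ρ (z (φ n))‖) atTop (𝓝 ‖fderiv ℝ ρ z0‖) :=
    ((h.c1.continuousAt (h.opV.mem_nhds hzV)).norm.tendsto).comp hzl
  have hL : Tendsto (fun n => LeviForm ρ (z (φ n)) (w (φ n))) atTop (𝓝 (LeviForm ρ z0 w0)) :=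
    h.levi_lim hzV hzl hwl
  have hT : Tendsto (fun n => tq ρ (z (φ n)) (w (φ n))) atTop (𝓝 (tq ρ z0 w0)) :=
    h.tq_lim hzV hzl hwl
  have hdp : 0 < ‖fderiv ℝ ρ z0‖ := norm_pos_iff.2 (h.dne z0 hfr)
  have hev : ∀ᶠ n in atTop, ‖w (φ n)‖ = 1 ∧ LeviForm ρ (z (φ n)) (w (φ n)) + (φ n : ℕ) * tq ρ (z (φ n)) (w (φ n)) < 1/(((φ n : ℕ):ℝ)+1) := by
    have := (hd.sub hinv).eventually (lt_mem_nhds (show 0 < ‖fderiv ℝ ρ z0‖ - 0 by simpa using hdp))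
    filter_upwards [this] with n hn
    rcases hw (φ n) with h5 | h5
    · linarith [h5.1]
    · exact h5
  have hw1 : ‖w0‖ = 1 :=
    tendsto_nhds_unique hwl.norm (tendsto_const_nhds.congr' (hev.mono fun n hn => hn.1.symm))
  have ht0 : tq ρ z0 w0 ≤ 0 := by
    have h6 : Tendsto (fun n => (1/(((φ n : ℕ):ℝ)+1)) * (1/(((φ n : ℕ):ℝ)+1) - LeviForm ρ (z (φ n)) (w (φ n)) + tq ρ (z (φ n)) (w (φ n)))) atTop (𝓝 (0 * (0 - LeviForm ρ z0 w0 + tq ρ z0 w0))) :=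
      hinv.mul ((hinv.sub hL).add hT)
    rw [zero_mul] at h6
    refine le_of_tendsto_of_tendsto hT h6 (hev.mono fun n hn => ?_)
    have h7 : (0:ℝ) < (φ n : ℕ) + 1 := by positivity
    simp only
    rw [div_mul_eq_mul_div, one_mul, le_div_iff₀ h7]
    linarith [hn.2]
  have hct : ComplexTangent ρ z0 w0 := by
    unfold tq at ht0
    have q1 := sq_nonneg (fderiv ℝ ρ z0 w0)
    have q2 := sq_nonneg (fderiv ℝ ρ z0 (Complex.I • w0))
    exact ⟨pow_eq_zero_iff two_ne_zero |>.1 (by linarith), pow_eq_zero_iff two_ne_zero |>.1 (by linarith)⟩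
  have := h.lev z0 hfr w0 (by rintro rfl; simp at hw1) hct
  have h8 : LeviForm ρ z0 w0 ≤ 0 := by
    refine le_of_tendsto_of_tendsto hL hinv (hev.mono fun n hn => ?_)
    have h9 : 0 ≤ ((φ n : ℕ):ℝ) * tq ρ (z (φ n)) (w (φ n)) := mul_nonneg (Nat.cast_nonneg _) tq_nonneg
    simp only
    linarith [hn.2]
  linarith
end geo
end

open Set Filter Topology Metric MeasureTheory
open scoped ENNReal NNReal InnerProductSpace ComplexConjugate ContDiff Manifold

noncomputable section
section geo2
variable {N : ℕ} {D V : Set (EN N)} {ρ : EN N → ℝ}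

lemma gsq_comp {u : EN N → ℝ} {x : EN N} {κ : ℝ → ℝ} {k : ℝ} (hu : DifferentiableAt ℝ u x)
    (hk : HasDerivAt κ k (u x)) : gsq (fun y => κ (u y)) x = k^2 * gsq u x := by
  have h1 : HasFDerivAt (fun y => κ (u y)) (k • fderiv ℝ u x) x := hk.comp_hasFDerivAt x hu.hasFDerivAt
  unfold gsq
  rw [Finset.mul_sum]
  refine Finset.sum_congr rfl fun j _ => ?_
  have h2 : dz (bas j) (fun y => ((κ (u y) : ℝ) : ℂ)) x = (k : ℂ) * dz (bas j) (fun y => (u y : ℂ)) x := by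
    simp only [dz]
    rw [fderiv_ofReal_comp hu, fderiv_ofReal_comp (ψ := fun y => κ (u y)) h1.differentiableAt, h1.fderiv]
    simp
    ring
  rw [h2, norm_mul, mul_pow, Complex.norm_real, Real.norm_eq_abs, sq_abs]

/-- a smooth step -/
lemma exists_step : ∃ X : ℝ → ℝ, ContDiff ℝ ((⊤:ℕ∞) : WithTop ℕ∞) X ∧ (∀ t, 0 ≤ X t ∧ X t ≤ 1) ∧ (∀ t ≤ -2, X t = 1) ∧
    (∀ t ≥ -1, X t = 0) := by
  refine ⟨fun t => Real.smoothTransition (-1 - t), ?_, fun t => ⟨Real.smoothTransition.nonneg _, Real.smoothTransition.le_one _⟩,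
    fun t ht => Real.smoothTransition.one_of_one_le (by linarith),
    fun t ht => Real.smoothTransition.zero_of_nonpos (by linarith)⟩
  exact Real.smoothTransition.contDiff.comp (contDiff_const.sub contDiff_id)

lemma Geo.cut (h : Geo D V ρ) : ∃ (χ : ℕ → EN N → ℝ) (C : ℝ), (∀ n, ContDiff ℝ 2 (χ n)) ∧
    (∀ n, IsTest D (fun x => (χ n x : ℂ))) ∧ (∀ n x, |χ n x| ≤ 1) ∧
    (∀ n, ∀ x ∈ D, gsq (χ n) x ≤ C * Real.exp (-2 * Real.log (-ρ x))) ∧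
    ∀ x ∈ D, ∀ᶠ n in atTop, χ n =ᶠ[𝓝 x] fun _ => 1 := by
  classical
  obtain ⟨X, hX, hX01, hX1, hX0⟩ := exists_step
  have hXd : Continuous (deriv X) := hX.continuous_deriv (by simp)
  obtain ⟨M, hM⟩ := (isCompact_Icc (a := (-2:ℝ)) (b := 0)).exists_bound_of_continuousOn hXd.continuousOn
  have hM' : ∀ t ≤ 0, (deriv X t)^2 ≤ M^2 ∧ (t < -2 → deriv X t = 0) := by
    intro t ht
    have h3 : t < -2 → deriv X t = 0 := fun ht2 => by
      have : X =ᶠ[𝓝 t] fun _ => 1 := by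
        filter_upwards [Iio_mem_nhds ht2] with s hs using hX1 s (le_of_lt hs)
      rw [this.deriv_eq]; simp
    refine ⟨?_, h3⟩
    by_cases h2 : t < -2
    · rw [h3 h2]; simp; positivity
    · have := hM t ⟨not_lt.1 h2, ht⟩
      rw [← sq_abs]
      exact pow_le_pow_left₀ (abs_nonneg _) this 2
  have hgc : ContinuousOn (gsq ρ) V := gsq_contOn h.opV (h.cd.of_le (by norm_num))
  obtain ⟨Gm, hGm⟩ := h.cpt.exists_bound_of_continuousOn (hgc.mono h.sub)
  set χ : ℕ → EN N → ℝ := fun n z => if z ∈ D then X (((n:ℝ)+1) * ρ z) else 0 with hχ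
  have hin : ∀ n, ∀ x ∈ D, χ n =ᶠ[𝓝 x] fun y => X (((n:ℝ)+1) * ρ y) := by
    intro n x hx
    filter_upwards [h.opD.mem_nhds hx] with y hy
    simp [hχ, hy]
  set T : ℕ → Set (EN N) := fun n => {z ∈ closure D | ((n:ℝ)+1) * ρ z ≤ -1} with hT
  have hTc : ∀ n, IsCompact (T n) := fun n =>
    h.cpt.of_isClosed_subset ((continuousOn_const.mul (h.cd.continuousOn.mono h.sub)).preimage_isClosed_of_isClosed
      isClosed_closure isClosed_Iic) (fun z hz => hz.1)
  have hTD : ∀ n, T n ⊆ D := by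
    intro n z hz
    rw [h.eqD]
    refine ⟨h.sub hz.1, ?_⟩
    by_contra h0
    have : 0 ≤ ((n:ℝ)+1) * ρ z := mul_nonneg (by positivity) (not_lt.1 h0)
    linarith [hz.2]
  have hsup : ∀ n, ∀ x, x ∉ T n → χ n x = 0 := by
    intro n x hx
    simp only [hχ]
    split_ifs with hxD
    · apply hX0
      by_contra h0
      exact hx ⟨subset_closure hxD, by linarith⟩
    · rfl
  have hcd : ∀ n, ContDiff ℝ 2 (χ n) := by
    intro n
    rw [contDiff_iff_contDiffAt]
    intro x
    by_cases hx : x ∈ T n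
    · have hxD := hTD n hx
      refine ContDiffAt.congr_of_eventuallyEq ?_ (hin n x hxD)
      exact ((hX.of_le two_le_infty).contDiffAt).comp x (contDiffAt_const.mul (h.cat (h.DV hxD)))
    · refine contDiffAt_const (c := (0:ℝ)) |>.congr_of_eventuallyEq ?_
      filter_upwards [(hTc n).isClosed.isOpen_compl.mem_nhds hx] with y hy using hsup n y hy
  have hts : ∀ n, tsupport (fun x => (χ n x : ℂ)) ⊆ T n := by
    intro n
    refine closure_minimal (fun x hx => ?_) (hTc n).isClosed
    by_contra h0
    exact hx (by simp [hsup n x h0])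
  refine ⟨χ, 4 * M^2 * Gm, hcd, fun n => ⟨contDiff_ofReal_comp (n := 2) (hcd n),
    (hTc n).of_isClosed_subset (isClosed_tsupport _) (hts n), (hts n).trans (hTD n)⟩, ?_, ?_, ?_⟩
  · intro n x
    simp only [hχ]
    split_ifs
    · rw [abs_of_nonneg (hX01 _).1]; exact (hX01 _).2
    · simp
  · intro n x hx
    have hρ := h.neg hx
    rw [gsq_congr (hin n x hx)]
    have hd : HasDerivAt (fun t => X (((n:ℝ)+1) * t)) (deriv X (((n:ℝ)+1) * ρ x) * (((n:ℝ)+1) * 1)) (ρ x) :=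
      HasDerivAt.comp (ρ x) ((hX.differentiable (by simp)) _).hasDerivAt ((hasDerivAt_id _).const_mul _)
    rw [gsq_comp ((h.cat (h.DV hx)).differentiableAt (by norm_num)) hd]
    have e1 : Real.exp (-2 * Real.log (-ρ x)) = 1/(ρ x)^2 := by
      rw [mul_comm, Real.exp_mul, Real.exp_log (by linarith), Real.rpow_neg (by linarith)]
      norm_cast
      simp
    rw [e1]
    have hg := (le_abs_self _).trans (hGm x (subset_closure hx))
    have hg0 := gsq_nonneg ρ x
    have hn : (0:ℝ) < (n:ℝ) + 1 := by positivity
    obtain ⟨h4, h5⟩ := hM' (((n:ℝ)+1) * ρ x) (by nlinarith)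
    have h6 : (deriv X (((n:ℝ)+1) * ρ x) * (((n:ℝ)+1) * 1))^2 ≤ 4 * M^2 * (1/(ρ x)^2) := by
      by_cases h7 : ((n:ℝ)+1) * ρ x < -2
      · rw [h5 h7]; simp; positivity
      · have h8 : (((n:ℝ)+1) * 1)^2 ≤ 4 * (1/(ρ x)^2) := by
          rw [mul_one_div, le_div_iff₀ (by nlinarith), mul_one, ← mul_pow]
          have q1 : ((n:ℝ)+1) * ρ x ≤ 0 := by nlinarith
          nlinarith
        rw [mul_pow]
        calc _ ≤ M^2 * (4 * (1/(ρ x)^2)) := by gcongr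
          _ = _ := by ring
    calc _ ≤ 4 * M^2 * (1/(ρ x)^2) * Gm := by gcongr
      _ = _ := by ring
  · intro x hx
    have hρ := h.neg hx
    have h1 : ∀ᶠ y in 𝓝 x, ρ y < ρ x / 2 :=
      (h.cat (h.DV hx)).continuousAt.eventually (gt_mem_nhds (by linarith))
    have h2 : Tendsto (fun n : ℕ => ((n:ℝ)+1) * (-(ρ x / 2))) atTop atTop :=
      (tendsto_atTop_add_const_right _ 1 tendsto_natCast_atTop_atTop).atTop_mul_const (by linarith)
    filter_upwards [h2.eventually_ge_atTop 2] with n hn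
    filter_upwards [h1, h.opD.mem_nhds hx] with y hy hyD
    simp only [hχ, hyD, if_true]
    apply hX1
    have : ((n:ℝ)+1) * ρ y ≤ ((n:ℝ)+1) * (ρ x/2) := mul_le_mul_of_nonneg_left hy.le (by positivity)
    linarith

theorem Geo.base (h : Geo D V ρ) : ∃ G θ : EN N → ℝ, Horm D G θ := by
  obtain ⟨c, hc, A, hA, hcol⟩ := h.collar
  have hgc : ContinuousOn (gsq ρ) V := gsq_contOn h.opV (h.cd.of_le (by norm_num))
  obtain ⟨Gm', hGm'⟩ := h.cpt.exists_bound_of_continuousOn (hgc.mono h.sub)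
  have hc2n : ContinuousOn (fun z => ‖fderiv ℝ (fderiv ℝ ρ) z‖) V := ContinuousOn.norm (E := EN N →L[ℝ] EN N →L[ℝ] ℝ) h.c2
  obtain ⟨L', hL'⟩ := h.cpt.exists_bound_of_continuousOn (hc2n.mono h.sub)
  set Gm := max Gm' 0
  set L := max L' 0
  have hGm0 : 0 ≤ Gm := le_max_right _ _
  have hL0 : 0 ≤ L := le_max_right _ _
  set c1 := min c (2/(A+1)) with hc1
  have hc1p : 0 < c1 := by positivity
  set b := (12 * Gm + 3)/c with hb
  have hb0 : 0 < b := by positivity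
  set B := (12 * Gm + 3 + b * L)/c1^2 with hB
  have hB0 : 0 ≤ B := by positivity
  refine ⟨fun y => -b / ρ y + B * ‖y - 0‖^2, fun y => -2 * Real.log (-ρ y), ?_⟩
  have hcdD : ContDiffOn ℝ 2 ρ D := h.cd.mono h.DV
  refine ⟨h.opD, ?_, ?_, ?_, h.cut⟩
  · exact (contDiffOn_const.div hcdD fun x hx => (h.neg hx).ne).add (contDiffOn_const.mul (nsq_contDiff 0).contDiffOn)
  · exact contDiffOn_const.mul (hcdD.neg.log fun x hx => by linarith [h.neg hx] |> fun (h : 0 < -ρ x) => h.ne')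
  · intro x hx w
    have hρ := h.neg hx
    have hat := h.cat (h.DV hx)
    have hxc := subset_closure hx
    have e1 : Real.exp (-2 * Real.log (-ρ x)) = 1/(ρ x)^2 := by
      rw [mul_comm, Real.exp_mul, Real.exp_log (by linarith), Real.rpow_neg (by linarith)]
      norm_cast
      simp
    have e2 : gsq (fun y => -2 * Real.log (-ρ y)) x = (-2 * ((ρ x)⁻¹))^2 * gsq ρ x := by
      refine gsq_comp (κ := fun t => -2 * Real.log (-t)) (hat.differentiableAt (by norm_num)) ?_
      have := ((hasDerivAt_id (ρ x)).neg.log (by simpa using hρ.ne)).const_mul (-2)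
      refine HasDerivAt.congr_deriv this ?_
      simp [div_eq_mul_inv, inv_neg]
    have e3 : LeviForm (fun y => -b / ρ y) x w = b / (ρ x)^2 * LeviForm ρ x w + (-2 * b / (ρ x)^3) * tq ρ x w := by
      refine levi_comp (κ := fun t => -b / t) (κ1 := fun t => b / t^2) hat ?_ ?_
      · filter_upwards [isOpen_ne.mem_nhds hρ.ne] with t ht
        have ht : t ≠ 0 := ht
        refine HasDerivAt.congr_deriv ((hasDerivAt_const t (-b)).div (hasDerivAt_id t) ht) ?_
        simp
      · refine HasDerivAt.congr_deriv ((hasDerivAt_const (ρ x) b).div (hasDerivAt_pow 2 (ρ x)) (pow_ne_zero 2 hρ.ne)) ?_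
        have := hρ.ne
        field_simp
        ring
    rw [e1, e2, levi_add (u := fun y => -b / ρ y) (contDiffAt_const.div hat hρ.ne) (contDiffAt_const.mul (nsq_contDiff 0).contDiffAt),
      levi_const_mul _ (nsq_contDiff 0).contDiffAt, nsq_levi, e3]
    have hg : gsq ρ x ≤ Gm := ((le_abs_self _).trans (hGm' x hxc)).trans (le_max_left _ _)
    have hLb : |LeviForm ρ x w| ≤ L * ‖w‖^2 := (levi_bound x w).trans
      (mul_le_mul_of_nonneg_right (((le_abs_self _).trans (hL' x hxc)).trans (le_max_left _ _)) (by positivity))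
    have hlhs : (3 * ((-2 * (ρ x)⁻¹)^2 * gsq ρ x) + 3 * (1/(ρ x)^2)) * ‖w‖^2 ≤ 1/(ρ x)^2 * ((12 * Gm + 3) * ‖w‖^2) := by
      have : (3 * ((-2 * (ρ x)⁻¹)^2 * gsq ρ x) + 3 * (1/(ρ x)^2)) * ‖w‖^2 = 1/(ρ x)^2 * ((12 * gsq ρ x + 3) * ‖w‖^2) := by
        field_simp; ring
      rw [this]; gcongr
    refine hlhs.trans ?_
    have ht := tq_nonneg (u := ρ) (x := x) (w := w)
    have e4 : b / (ρ x)^2 * LeviForm ρ x w + (-2 * b / (ρ x)^3) * tq ρ x w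
        = 1/(ρ x)^2 * (b * (LeviForm ρ x w + (2/(-ρ x)) * tq ρ x w)) := by
      have := hρ.ne
      field_simp
    rw [e4]
    have hBw : 0 ≤ B * ‖w‖^2 := by positivity
    by_cases hd : -c1 ≤ ρ x
    · obtain ⟨-, h2⟩ := hcol x hxc (by linarith [min_le_left c (2/(A+1))])
      have h3 : A ≤ 2/(-ρ x) := by
        rw [le_div_iff₀ (by linarith)]
        have : -ρ x ≤ 2/(A+1) := by linarith [min_le_right c (2/(A+1))]
        rw [le_div_iff₀ (by linarith)] at this
        nlinarith
      have h4 : c * ‖w‖^2 ≤ LeviForm ρ x w + (2/(-ρ x)) * tq ρ x w :=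
        (h2 w).trans (by linarith [mul_le_mul_of_nonneg_right h3 ht])
      have h5 : (12 * Gm + 3) * ‖w‖^2 ≤ b * (LeviForm ρ x w + (2/(-ρ x)) * tq ρ x w) := by
        calc _ = b * (c * ‖w‖^2) := by rw [hb]; field_simp
          _ ≤ _ := by gcongr
      have h6 : 1/(ρ x)^2 * ((12 * Gm + 3) * ‖w‖^2) ≤ 1/(ρ x)^2 * (b * (LeviForm ρ x w + (2/(-ρ x)) * tq ρ x w)) := by
        gcongr
      linarith
    · have h3 : 1/(ρ x)^2 ≤ 1/c1^2 := by
        apply one_div_le_one_div_of_le (by positivity)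
        nlinarith
      have h4 : 0 ≤ 2/(-ρ x) * tq ρ x w := mul_nonneg (div_nonneg (by norm_num) (by linarith)) ht
      have h5 : -(b * (L * ‖w‖^2)) ≤ b * (LeviForm ρ x w + (2/(-ρ x)) * tq ρ x w) := by
        rw [← mul_neg]
        apply mul_le_mul_of_nonneg_left _ hb0.le
        linarith [neg_abs_le (LeviForm ρ x w)]
      have h6 : 1/(ρ x)^2 * (-(b * (L * ‖w‖^2))) ≤ 1/(ρ x)^2 * (b * (LeviForm ρ x w + (2/(-ρ x)) * tq ρ x w)) := by
        gcongr
      have h7 : 1/(ρ x)^2 * ((12 * Gm + 3 + b * L) * ‖w‖^2) ≤ 1/c1^2 * ((12 * Gm + 3 + b * L) * ‖w‖^2) := by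
        gcongr
      have h8 : B * ‖w‖^2 = 1/c1^2 * ((12 * Gm + 3 + b * L) * ‖w‖^2) := by rw [hB]; ring
      rw [h8]
      linarith
end geo2
end

open Set Filter Topology Metric MeasureTheory
open scoped ENNReal NNReal InnerProductSpace ComplexConjugate ContDiff Manifold

noncomputable section
section smo
variable {N : ℕ}

lemma second_diff {σ : EN N → ℝ} {O : Set (EN N)} (hO : Convex ℝ O) {ε : ℝ} 
    (h1 : ∀ z ∈ O, DifferentiableAt ℝ σ z) (h2 : ∀ z ∈ O, DifferentiableAt ℝ (fderiv ℝ σ) z)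
    (h3 : ∀ z ∈ O, ‖fderiv ℝ (fderiv ℝ σ) z‖ ≤ ε) {a u : EN N} (hp : a + u ∈ O) (hm : a - u ∈ O) :
    0 ≤ σ (a + u) + σ (a - u) - 2 * σ a + ε * ‖u‖^2 := by
  have ha : a ∈ O := by
    have := hO hp hm (show (0:ℝ) ≤ 1/2 by norm_num) (show (0:ℝ) ≤ 1/2 by norm_num) (by norm_num)
    convert this using 1
    module
  have hpt : ∀ t ∈ Icc (0:ℝ) 1, a + t • u ∈ O := fun t ht => by
    have := hO ha hp (show (0:ℝ) ≤ 1 - t by linarith [ht.2]) ht.1 (by ring)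
    convert this using 1
    module
  have hmt : ∀ t ∈ Icc (0:ℝ) 1, a - t • u ∈ O := fun t ht => by
    have := hO ha hm (show (0:ℝ) ≤ 1 - t by linarith [ht.2]) ht.1 (by ring)
    convert this using 1
    module
  set g : ℝ → ℝ := fun t => σ (a + t • u) + σ (a - t • u) + ε * ‖u‖^2 * t^2 with hg
  have hd : ∀ t ∈ Icc (0:ℝ) 1, HasDerivAt g (fderiv ℝ σ (a + t • u) u + fderiv ℝ σ (a - t • u) (-u) + ε * ‖u‖^2 * (2 * t)) t := by
    intro t ht
    have l1 : HasDerivAt (fun t : ℝ => a + t • u) u t := by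
      simpa using ((hasDerivAt_id t).smul_const u).const_add a
    have l2 : HasDerivAt (fun t : ℝ => a - t • u) (-u) t := by
      simpa using ((hasDerivAt_id t).smul_const u).const_sub a
    have d1 := (h1 _ (hpt t ht)).hasFDerivAt.comp_hasDerivAt t l1
    have d2 := (h1 _ (hmt t ht)).hasFDerivAt.comp_hasDerivAt t l2
    have d3 : HasDerivAt (fun t : ℝ => ε * ‖u‖^2 * t^2) (ε * ‖u‖^2 * (2 * t)) t := by
      simpa using (hasDerivAt_pow 2 t).const_mul (ε * ‖u‖^2)
    exact (d1.add d2).add d3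
  have hmono : MonotoneOn g (Icc 0 1) := by
    refine monotoneOn_of_deriv_nonneg (convex_Icc 0 1) (fun t ht => (hd t ht).continuousAt.continuousWithinAt)
      (fun t ht => (hd t (interior_subset ht)).differentiableAt.differentiableWithinAt) fun t ht => ?_
    have ht' := interior_subset ht
    rw [(hd t ht').deriv]
    have e1 := hO.norm_image_sub_le_of_norm_fderiv_le (𝕜 := ℝ) (f := fderiv ℝ σ) h2 h3 (hmt t ht') (hpt t ht')
    have e2 : ‖a + t • u - (a - t • u)‖ = 2 * t * ‖u‖ := by
      rw [show a + t • u - (a - t • u) = (2 * t) • u by module, norm_smul, Real.norm_eq_abs, abs_of_nonneg (by linarith [ht'.1])]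
    rw [e2] at e1
    have e3 := (fderiv ℝ σ (a + t • u) - fderiv ℝ σ (a - t • u)).le_opNorm u
    have e4 : ‖fderiv ℝ σ (a + t • u) - fderiv ℝ σ (a - t • u)‖ * ‖u‖ ≤ ε * (2 * t * ‖u‖) * ‖u‖ := by gcongr
    rw [sub_apply, Real.norm_eq_abs] at e3
    have e5 := neg_abs_le (fderiv ℝ σ (a + t • u) u - fderiv ℝ σ (a - t • u) u)
    rw [map_neg]
    nlinarith
  have := hmono (left_mem_Icc.2 zero_le_one) (right_mem_Icc.2 zero_le_one) zero_le_one
  simp [hg] at this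
  linarith

lemma hasDerivAt_fderiv_line {S : EN N → ℝ} {L : ℝ → EN N} {l v : EN N} {t : ℝ} (hL : HasDerivAt L l t)
    (h : DifferentiableAt ℝ (fderiv ℝ S) (L t)) :
    HasDerivAt (fun t => fderiv ℝ S (L t) v) (Hess S (L t) l v) t := by
  have h1 : HasDerivAt (fun t => fderiv ℝ S (L t)) (fderiv ℝ (fderiv ℝ S) (L t) l) t :=
    h.hasFDerivAt.comp_hasDerivAt t hL
  exact ((ContinuousLinearMap.apply ℝ ℝ v).hasFDerivAt (x := fderiv ℝ S (L t))).comp_hasDerivAt t h1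

lemma hess_lower {S : EN N → ℝ} (hS : ContDiff ℝ 2 S) {x v : EN N} {ε : ℝ}
    (h : ∀ᶠ t : ℝ in 𝓝 0, 0 ≤ S (x + t • v) + S (x - t • v) - 2 * S x + ε * ‖t • v‖^2) :
    - (ε * ‖v‖^2) ≤ Hess S x v v := by
  by_contra hlt
  push Not at hlt
  set q : ℝ → ℝ := fun t => S (x + t • v) + S (x - t • v) + ε * ‖v‖^2 * t^2 with hq
  set q1 : ℝ → ℝ := fun t => fderiv ℝ S (x + t • v) v + fderiv ℝ S (x - t • v) (-v) + ε * ‖v‖^2 * (2 * t) with hq1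
  have l1 : ∀ t : ℝ, HasDerivAt (fun t : ℝ => x + t • v) v t := fun t => by
    simpa using ((hasDerivAt_id t).smul_const v).const_add x
  have l2 : ∀ t : ℝ, HasDerivAt (fun t : ℝ => x - t • v) (-v) t := fun t => by
    simpa using ((hasDerivAt_id t).smul_const v).const_sub x
  have hSd := hS.differentiable (by norm_num)
  have hS2 := (hS.fderiv_right (m := 1) (by norm_num)).differentiable (by norm_num)
  have hd : ∀ t, HasDerivAt q (q1 t) t := by
    intro t
    have d1 := (hSd (x + t • v)).hasFDerivAt.comp_hasDerivAt t (l1 t)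
    have d2 := (hSd (x - t • v)).hasFDerivAt.comp_hasDerivAt t (l2 t)
    have d3 : HasDerivAt (fun t : ℝ => ε * ‖v‖^2 * t^2) (ε * ‖v‖^2 * (2 * t)) t := by
      simpa using (hasDerivAt_pow 2 t).const_mul (ε * ‖v‖^2)
    exact (d1.add d2).add d3
  have hd2 : HasDerivAt q1 (2 * Hess S x v v + 2 * (ε * ‖v‖^2)) 0 := by
    have d1 := hasDerivAt_fderiv_line (v := v) (l1 0) (hS2 _)
    have d2 := hasDerivAt_fderiv_line (v := -v) (l2 0) (hS2 _)
    have d3 : HasDerivAt (fun t : ℝ => ε * ‖v‖^2 * (2 * t)) (ε * ‖v‖^2 * (2 * 1)) 0 :=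
      ((hasDerivAt_id (0:ℝ)).const_mul 2).const_mul _
    refine HasDerivAt.congr_deriv ((d1.add d2).add d3) ?_
    simp [Hess]
    ring
  have hdq : deriv q = q1 := funext fun t => (hd t).deriv
  have hmax : IsLocalMax q 0 := by
    refine isLocalMax_of_deriv_deriv_neg ?_ ?_ (hd 0).continuousAt
    · rw [hdq, hd2.deriv]; linarith
    · rw [hdq]; simp [hq1]
  have hev : q =ᶠ[𝓝 0] fun _ => q 0 := by
    filter_upwards [hmax, h] with t h1 h2
    refine le_antisymm h1 ?_
    rw [norm_smul, mul_pow, Real.norm_eq_abs, sq_abs] at h2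
    simp only [hq, zero_smul, add_zero, sub_zero]
    nlinarith
  have hev2 : q1 =ᶠ[𝓝 0] fun _ => 0 := by
    rw [← hdq]
    have := hev.deriv
    simpa using this
  have := hd2.deriv
  rw [hev2.deriv_eq] at this
  simp at this
  linarith

theorem smooth_approx {σ : EN N → ℝ} {T O : Set (EN N)} (hT : IsCompact T) (hO : IsOpen O) (hTO : T ⊆ O)
    {ε η : ℝ} (hε : 0 < ε) (hη : 0 < η)
    (h1 : ∀ z ∈ O, DifferentiableAt ℝ σ z) (h2 : ∀ z ∈ O, DifferentiableAt ℝ (fderiv ℝ σ) z)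
    (h3 : ∀ z ∈ O, ‖fderiv ℝ (fderiv ℝ σ) z‖ ≤ ε) (h4 : ∀ z ∈ O, ‖fderiv ℝ σ z‖ ≤ ε) :
    ∃ S : EN N → ℝ, ContDiff ℝ 2 S ∧ ∀ z ∈ T, |S z - σ z| ≤ η ∧ ‖fderiv ℝ S z‖ ≤ ε ∧
      ∀ v, -(ε * ‖v‖^2) ≤ Hess S z v v := by
  obtain ⟨b, hb, hbO⟩ := hT.exists_cthickening_subset_open hO hTO
  have hT'c : IsCompact (cthickening b T) := hT.cthickening
  set T' := cthickening b T with hT'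
  set f : EN N → ℝ := T'.indicator σ with hf
  have hσc : ContinuousOn σ T' := fun z hz => (h1 z (hbO hz)).continuousAt.continuousWithinAt
  have hfi : Integrable f (vol N) := (integrable_indicator_iff hT'c.isClosed.measurableSet).2 (hσc.integrableOn_compact hT'c)
  set δ := min (b/2) (η/ε) with hδd
  have hδ : 0 < δ := by positivity
  have hδb : δ ≤ b/2 := min_le_left _ _
  have hδη : ε * δ ≤ η := by
    have : δ ≤ η/ε := min_le_right _ _
    rw [le_div_iff₀ hε] at this; linarith
  set S : EN N → ℝ := fun x => ∫ y, kern N δ y * f (x - y) ∂(vol N) with hS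
  have hScd : ContDiff ℝ 2 S := by
    have := (kern_hcs (N := N) hδ).contDiff_convolution_left (μ := vol N) (n := ⊤) (ContinuousLinearMap.mul ℝ ℝ) kern_contDiff hfi.locallyIntegrable
    exact this.of_le two_le_infty
  obtain ⟨Mk, hMk⟩ : ∃ M, ∀ y : EN N, ‖kern N δ y‖ ≤ M := by
    obtain ⟨M, hM⟩ := (kern_hcs (N := N) hδ).exists_bound_of_continuous kern_contDiff.continuous
    exact ⟨M, hM⟩
  have hkerint : ∀ x, Integrable (fun y => kern N δ y * f (x - y)) (vol N) := fun x =>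
    (hfi.comp_sub_left x).bdd_mul (c := Mk) kern_contDiff.continuous.aestronglyMeasurable (Eventually.of_forall hMk)
  have hkc : ∀ c : ℝ, ∫ y, kern N δ y * c ∂(vol N) = c := fun c => by
    rw [integral_mul_const, kern_int hδ, one_mul]
  have hki : ∀ c : ℝ, Integrable (fun y => kern N δ y * c) (vol N) := fun c => (kern_integrable hδ).mul_const c
  refine ⟨S, hScd, fun z hz => ?_⟩
  have hball : ball z b ⊆ T' := ball_subset_closedBall.trans (closedBall_subset_cthickening hz b)
  have hmem : ∀ u y : EN N, ‖u‖ < b/2 → ‖y‖ < δ → z + u - y ∈ ball z b := by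
    intro u y hu hy
    rw [mem_ball, dist_eq_norm, show z + u - y - z = u - y by abel]
    linarith [norm_sub_le u y]
  have hfe : ∀ a ∈ ball z b, f a = σ a := fun a ha => indicator_of_mem (hball ha) σ
  have hconv := convex_ball z b
  have hOb : ball z b ⊆ O := hball.trans hbO
  have lip : ∀ a ∈ ball z b, ∀ c ∈ ball z b, |f a - f c| ≤ ε * ‖a - c‖ := by
    intro a ha c hc
    rw [hfe a ha, hfe c hc]
    exact hconv.norm_image_sub_le_of_norm_fderiv_le (𝕜 := ℝ) (fun z hz => h1 z (hOb hz)) (fun z hz => h4 z (hOb hz)) hc ha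
  have hkz : ∀ y, ¬ ‖y‖ < δ → kern N δ y = 0 := fun y hy => kern_zero hδ (not_lt.1 hy)
  refine ⟨?_, ?_, fun v => ?_⟩
  · have e1 : S z - σ z = ∫ y, (kern N δ y * f (z - y) - kern N δ y * σ z) ∂(vol N) := by
      rw [integral_sub (hkerint z) (hki _), hkc]
    rw [e1, ← Real.norm_eq_abs]
    refine (norm_integral_le_of_norm_le (hki η) (Eventually.of_forall fun y => ?_)).trans (hkc η).le
    by_cases hy : ‖y‖ < δ
    · rw [← mul_sub, norm_mul, Real.norm_of_nonneg (kern_nonneg y)]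
      refine mul_le_mul_of_nonneg_left ?_ (kern_nonneg y)
      have m1 : z - y ∈ ball z b := by simpa using hmem 0 y (by simpa using hb) hy
      have m2 : z ∈ ball z b := mem_ball_self hb
      have := lip _ m1 _ m2
      rw [hfe z m2] at this
      refine this.trans (le_trans ?_ hδη)
      rw [show z - y - z = -y by abel, norm_neg]
      gcongr
    · simp [hkz y hy]
  · have hε' : 0 ≤ ε := hε.le
    refine (hScd.differentiable (by norm_num) z).hasFDerivAt.le_of_lip' hε' ?_
    filter_upwards [ball_mem_nhds z (show 0 < b/2 by positivity)] with a ha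
    have e1 : S a - S z = ∫ y, (kern N δ y * f (a - y) - kern N δ y * f (z - y)) ∂(vol N) := by
      rw [integral_sub (hkerint a) (hkerint z)]
    rw [e1]
    refine (norm_integral_le_of_norm_le (hki (ε * ‖a - z‖)) (Eventually.of_forall fun y => ?_)).trans (hkc _).le
    by_cases hy : ‖y‖ < δ
    · rw [← mul_sub, norm_mul, Real.norm_of_nonneg (kern_nonneg y)]
      refine mul_le_mul_of_nonneg_left ?_ (kern_nonneg y)
      have m1 : z - y ∈ ball z b := by simpa using hmem 0 y (by simpa using hb) hy
      have m2 : a - y ∈ ball z b := by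
        have := hmem (a - z) y (by rw [← dist_eq_norm]; exact ha) hy
        simpa using this
      have := lip _ m2 _ m1
      rwa [show a - y - (z - y) = a - z by abel] at this
    · simp [hkz y hy]
  · refine hess_lower hScd ?_
    have hcont : Continuous fun t : ℝ => ‖t • v‖ := by fun_prop
    have hev : ∀ᶠ t : ℝ in 𝓝 0, ‖t • v‖ < b/2 :=
      hcont.continuousAt.eventually (gt_mem_nhds (by simpa using hb))
    filter_upwards [hev] with t ht
    set u := t • v with hu
    have e1 : S (z + u) + S (z - u) - 2 * S z + ε * ‖u‖^2 =
        ∫ y, (kern N δ y * f (z + u - y) + kern N δ y * f (z - u - y) - 2 * (kern N δ y * f (z - y)) + kern N δ y * (ε * ‖u‖^2)) ∂(vol N) := by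
      have i1 : Integrable (fun y => kern N δ y * f (z + u - y) + kern N δ y * f (z - u - y)) (vol N) := (hkerint _).add (hkerint _)
      have i2 : Integrable (fun y => kern N δ y * f (z + u - y) + kern N δ y * f (z - u - y) - 2 * (kern N δ y * f (z - y))) (vol N) :=
        i1.sub ((hkerint _).const_mul 2)
      rw [integral_add i2 (hki _),
        integral_sub i1 ((hkerint _).const_mul 2), integral_add (hkerint _) (hkerint _), integral_const_mul, hkc]
    rw [e1]
    refine integral_nonneg fun y => ?_
    by_cases hy : ‖y‖ < δ
    · have m1 := hmem u y ht hy
      have m2 := hmem (-u) y (by rwa [norm_neg]) hy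
      rw [← sub_eq_add_neg] at m2
      have m3 : z - y ∈ ball z b := by simpa using hmem 0 y (by simpa using hb) hy
      have := second_diff hconv (fun z hz => h1 z (hOb hz)) (fun z hz => h2 z (hOb hz)) (fun z hz => h3 z (hOb hz))
        (a := z - y) (u := u) (by rwa [show z - y + u = z + u - y by abel]) (by rwa [show z - y - u = z - u - y by abel])
      rw [show z - y + u = z + u - y by abel, show z - y - u = z - u - y by abel] at this
      simp only [Pi.zero_apply]
      rw [hfe _ m1, hfe _ m2, hfe _ m3]
      have := mul_nonneg (kern_nonneg (N := N) (δ := δ) y) this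
      linarith
    · simp [hkz y hy]
end smo
end

open Set Filter Topology Metric MeasureTheory
open scoped ENNReal NNReal InnerProductSpace ComplexConjugate ContDiff Manifold

noncomputable section
section bp2
variable {N : ℕ} {D V : Set (EN N)} {ρ : EN N → ℝ}

lemma hasDerivAt_posPow (n : ℕ) (t : ℝ) :
    HasDerivAt (fun t : ℝ => (max t 0)^(n+2)) ((n+2 : ℕ) * (max t 0)^(n+1)) t := by
  rcases lt_trichotomy t 0 with h | h | h
  · have : (fun t : ℝ => (max t 0)^(n+2)) =ᶠ[𝓝 t] fun _ => 0 := by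
      filter_upwards [Iio_mem_nhds h] with s hs
      simp [max_eq_right ((mem_Iio.1 hs).le)]
    rw [max_eq_right h.le]
    simpa using (hasDerivAt_const t (0:ℝ)).congr_of_eventuallyEq this
  · subst h
    simp only [max_self, ne_eq, Nat.add_eq_zero_iff, one_ne_zero, and_false, not_false_eq_true, zero_pow, mul_zero]
    rw [hasDerivAt_iff_isLittleO_nhds_zero]
    simp only [zero_add, max_self, smul_zero, sub_zero]
    have h1 : (fun h : ℝ => (max h 0)^(n+2) - 0^(n+2)) =O[𝓝 0] fun h : ℝ => h^(n+2) := by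
      refine Asymptotics.IsBigO.of_bound 1 (Eventually.of_forall fun h => ?_)
      simp only [ne_eq, Nat.add_eq_zero_iff, OfNat.ofNat_ne_zero, and_false, not_false_eq_true, zero_pow, sub_zero, one_mul, norm_pow]
      refine pow_le_pow_left₀ (norm_nonneg _) ?_ _
      rw [Real.norm_eq_abs, Real.norm_eq_abs, abs_of_nonneg (le_max_right _ _)]
      exact max_le (le_abs_self _) (abs_nonneg _)
    have h2 : (fun h : ℝ => h^(n+2)) =o[𝓝 0] fun h : ℝ => h := by
      simpa using Asymptotics.isLittleO_pow_pow (𝕜 := ℝ) (show 1 < n + 2 by omega)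
    simpa using h1.trans_isLittleO h2
  · have : (fun t : ℝ => (max t 0)^(n+2)) =ᶠ[𝓝 t] fun t => t^(n+2) := by
      filter_upwards [Ioi_mem_nhds h] with s hs
      simp [max_eq_left ((mem_Ioi.1 hs).le)]
    rw [max_eq_left h.le]
    simpa using (hasDerivAt_pow (n+2) t).congr_of_eventuallyEq this

/-- the convex increasing cutoff -/
def kap (m t : ℝ) : ℝ := (max (t - m) 0)^3

lemma kap_d1 (m t : ℝ) : HasDerivAt (kap m) (3 * (max (t - m) 0)^2) t := by
  have := (hasDerivAt_posPow 1 (t - m)).comp t ((hasDerivAt_id t).sub_const m)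
  refine HasDerivAt.congr_deriv this ?_
  norm_num

lemma kap_d2 (m t : ℝ) : HasDerivAt (fun t => 3 * (max (t - m) 0)^2) (6 * max (t - m) 0) t := by
  have := ((hasDerivAt_posPow 0 (t - m)).comp t ((hasDerivAt_id t).sub_const m)).const_mul 3
  refine HasDerivAt.congr_deriv this ?_
  norm_num
  ring

lemma kap_contDiff (m : ℝ) : ContDiff ℝ 2 (kap m) := by
  rw [show (2 : WithTop ℕ∞) = 1 + 1 by norm_num, contDiff_succ_iff_deriv]
  refine ⟨fun t => (kap_d1 m t).differentiableAt, by simp, ?_⟩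
  rw [show deriv (kap m) = fun t => 3 * (max (t - m) 0)^2 from funext fun t => (kap_d1 m t).deriv, contDiff_one_iff_deriv]
  refine ⟨fun t => (kap_d2 m t).differentiableAt, ?_⟩
  rw [show deriv (fun t => 3 * (max (t - m) 0)^2) = fun t => 6 * max (t - m) 0 from funext fun t => (kap_d2 m t).deriv]
  fun_prop

lemma tq_bound (u : EN N → ℝ) (x w : EN N) {e : ℝ} (h : ‖fderiv ℝ u x‖ ≤ e) : tq u x w ≤ e^2 * ‖w‖^2 / 2 := by
  have h1 := (fderiv ℝ u x).le_of_opNorm_le h w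
  have h2 := (fderiv ℝ u x).le_of_opNorm_le h (Complex.I • w)
  rw [norm_I_smul] at h2
  rw [Real.norm_eq_abs] at h1 h2
  have h3 := sq_le_sq' (by linarith [neg_abs_le (fderiv ℝ u x w)]) ((le_abs_self _).trans h1)
  have h4 := sq_le_sq' (by linarith [neg_abs_le (fderiv ℝ u x (Complex.I • w))]) ((le_abs_self _).trans h2)
  rw [tq]
  nlinarith

/-- pointwise Levi estimate for the peak exponent -/
lemma levi_peak {S : EN N → ℝ} {z p : EN N} {c A A1 ε c' : ℝ} (hρ : ContDiffAt ℝ 2 ρ z) (hS : ContDiff ℝ 2 S)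
    (hA1 : 2 * A ≤ A1) (hA1p : 0 < A1) (hε : 0 < ε) (hε1 : ε ≤ 1) (hεc : (1 + A1) * ε ≤ c)
    (hcol : ∀ w, c * ‖w‖^2 ≤ LeviForm ρ z w + A * tq ρ z w) 
    (hS1 : ‖fderiv ℝ S z‖ ≤ ε) (hS2 : ∀ v, -(ε * ‖v‖^2) ≤ Hess S z v v)
    (hc' : c' ≤ A1 * (c/2) * Real.exp (A1 * (ρ z + S z))) (w : EN N) :
    0 ≤ LeviForm (fun y => Real.exp (A1 * (ρ y + S y)) + (-c') * ‖y - p‖^2) z w := by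
  have hSa : ContDiffAt ℝ 2 S z := hS.contDiffAt
  have hr : ContDiffAt ℝ 2 (fun y => ρ y + S y) z := hρ.add hSa
  have e1 : LeviForm (fun y => Real.exp (A1 * (ρ y + S y))) z w =
      A1 * Real.exp (A1 * (ρ z + S z)) * LeviForm (fun y => ρ y + S y) z w
       + A1^2 * Real.exp (A1 * (ρ z + S z)) * tq (fun y => ρ y + S y) z w := by
    refine levi_comp (κ := fun t => Real.exp (A1 * t)) (κ1 := fun t => A1 * Real.exp (A1 * t)) hr
      (Eventually.of_forall fun t => ?_) ?_
    · refine HasDerivAt.congr_deriv (((hasDerivAt_id t).const_mul A1).exp) ?_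
      simp; ring
    · refine HasDerivAt.congr_deriv ((((hasDerivAt_id (ρ z + S z)).const_mul A1).exp).const_mul A1) ?_
      simp; ring
  rw [levi_add (u := fun y => Real.exp (A1 * (ρ y + S y))) ((contDiffAt_const.mul hr).exp) (contDiffAt_const.mul (nsq_contDiff p).contDiffAt),
    levi_const_mul _ (nsq_contDiff p).contDiffAt, nsq_levi, e1, levi_add hρ hSa]
  set E := Real.exp (A1 * (ρ z + S z)) with hE
  have hEp : 0 < E := Real.exp_pos _
  have hLS : -(ε/2 * ‖w‖^2) ≤ LeviForm S z w := by
    have q1 := hS2 w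
    have q2 := hS2 (Complex.I • w)
    rw [norm_I_smul] at q2
    rw [LeviForm]; linarith
  have htq : tq ρ z w / 2 - ε^2 * ‖w‖^2 / 2 ≤ tq (fun y => ρ y + S y) z w := by
    have q1 := tq_bound S z w hS1
    have q2 : fderiv ℝ (fun y => ρ y + S y) z = fderiv ℝ ρ z + fderiv ℝ S z :=
      fderiv_add (hρ.differentiableAt (by norm_num)) (hSa.differentiableAt (by norm_num))
    have q3 : tq ρ z w / 2 - tq S z w ≤ tq (fun y => ρ y + S y) z w := by
      simp only [tq, q2, add_apply]
      have aux : ∀ a b : ℝ, a^2/2 - b^2 ≤ (a+b)^2 := fun a b => by nlinarith [sq_nonneg (a + 2*b)]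
      linarith [aux (fderiv ℝ ρ z w) (fderiv ℝ S z w), aux (fderiv ℝ ρ z (Complex.I • w)) (fderiv ℝ S z (Complex.I • w))]
    linarith
  have ht0 := tq_nonneg (u := ρ) (x := z) (w := w)
  have hW : 0 ≤ ‖w‖^2 := by positivity
  have main : c/2 * ‖w‖^2 ≤ (LeviForm ρ z w + LeviForm S z w) + A1 * tq (fun y => ρ y + S y) z w := by
    have q1 : A1 * (tq ρ z w / 2 - ε^2 * ‖w‖^2 / 2) ≤ A1 * tq (fun y => ρ y + S y) z w := by gcongr
    have q2 : A * tq ρ z w ≤ A1 / 2 * tq ρ z w := by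
      apply mul_le_mul_of_nonneg_right _ ht0; linarith
    have q3 : (ε/2 + A1 * ε^2/2) * ‖w‖^2 ≤ c/2 * ‖w‖^2 := by
      apply mul_le_mul_of_nonneg_right _ hW
      have : A1 * ε^2 ≤ A1 * ε := by
        apply mul_le_mul_of_nonneg_left _ hA1p.le; nlinarith
      linarith
    linarith [hcol w]
  have m2 := mul_le_mul_of_nonneg_left main (show 0 ≤ A1 * E by positivity)
  have m3 := mul_le_mul_of_nonneg_right hc' hW
  nlinarith

lemma exists_tangent (hN : 2 ≤ N) (ℓ : EN N →L[ℝ] ℝ) : ∃ w : EN N, w ≠ 0 ∧ ℓ w = 0 ∧ ℓ (Complex.I • w) = 0 := by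
  let L : EN N →ₗ[ℝ] ℝ × ℝ :=
    { toFun := fun w => (ℓ w, ℓ (Complex.I • w))
      map_add' := fun a b => by simp
      map_smul' := fun t a => by simp [smul_comm Complex.I t a] }
  have hk : LinearMap.ker L ≠ ⊥ := by
    apply LinearMap.ker_ne_bot_of_finrank_lt
    rw [finrank_real_of_complex]
    simp
    omega
  obtain ⟨w, hw, hw0⟩ := Submodule.exists_mem_ne_zero_of_ne_bot hk
  have : L w = 0 := hw
  exact ⟨w, hw0, congrArg Prod.fst this, congrArg Prod.snd this⟩

lemma hess_norm (hN : 2 ≤ N) {z : EN N} {c A : ℝ} (hcol : ∀ w, c * ‖w‖^2 ≤ LeviForm ρ z w + A * tq ρ z w) :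
    c ≤ ‖fderiv ℝ (fderiv ℝ ρ) z‖ := by
  obtain ⟨w, hw, h1, h2⟩ := exists_tangent hN (fderiv ℝ ρ z)
  have h3 := hcol w
  rw [tq, h1, h2] at h3
  have h4 := (le_abs_self _).trans (levi_bound (ρ := ρ) z w)
  have h5 : 0 < ‖w‖^2 := by have := norm_pos_iff.2 hw; positivity
  have h6 : c * ‖w‖^2 ≤ ‖fderiv ℝ (fderiv ℝ ρ) z‖ * ‖w‖^2 := by linarith
  exact le_of_mul_le_mul_right h6 h5

end bp2
end

open Set Filter Topology Metric MeasureTheory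
open scoped ENNReal NNReal InnerProductSpace ComplexConjugate ContDiff Manifold

noncomputable section
section bp2b
variable {N : ℕ} {D V : Set (EN N)} {ρ : EN N → ℝ}

lemma levi_zero_fun (z w : EN N) : LeviForm (fun _ : EN N => (0:ℝ)) z w = 0 := by
  have : fderiv ℝ (fun _ : EN N => (0:ℝ)) = fun _ => 0 := by
    funext y; simp
  simp [LeviForm, Hess, this]

/-- regularity of `ρ'` forced by `C²`-closeness where the derivatives do not vanish -/
lemma close_diff {ρ ρ' : EN N → ℝ} {O : Set (EN N)} {ε : ℝ} (hO : IsOpen O)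
    (hρ : ∀ z ∈ O, ContDiffAt ℝ 2 ρ z) (hcl : C2DistLt O ρ' ρ ε)
    (h1 : ∀ z ∈ O, ε ≤ ‖fderiv ℝ ρ z‖) (h2 : ∀ z ∈ O, ε ≤ ‖fderiv ℝ (fderiv ℝ ρ) z‖) :
    (∀ z ∈ O, DifferentiableAt ℝ (fun y => ρ' y - ρ y) z) ∧
    (∀ z ∈ O, DifferentiableAt ℝ (fderiv ℝ (fun y => ρ' y - ρ y)) z) ∧
    (∀ z ∈ O, ‖fderiv ℝ (fderiv ℝ (fun y => ρ' y - ρ y)) z‖ ≤ ε) ∧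
    (∀ z ∈ O, ‖fderiv ℝ (fun y => ρ' y - ρ y) z‖ ≤ ε) := by
  have d1 : ∀ z ∈ O, DifferentiableAt ℝ ρ' z := by
    intro z hz
    by_contra hn
    have := hcl z hz
    rw [fderiv_zero_of_not_differentiableAt hn, zero_sub, norm_neg] at this
    linarith [h1 z hz, abs_nonneg (ρ' z - ρ z), norm_nonneg (fderiv ℝ (fderiv ℝ ρ') z - fderiv ℝ (fderiv ℝ ρ) z)]
  have d2 : ∀ z ∈ O, DifferentiableAt ℝ (fderiv ℝ ρ') z := by
    intro z hz
    by_contra hn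
    have := hcl z hz
    rw [fderiv_zero_of_not_differentiableAt (f := fderiv ℝ ρ') hn, zero_sub] at this
    have hnn : ‖-fderiv ℝ (fderiv ℝ ρ) z‖ = ‖fderiv ℝ (fderiv ℝ ρ) z‖ :=
      norm_neg (E := EN N →L[ℝ] EN N →L[ℝ] ℝ) _
    rw [hnn] at this
    linarith [h2 z hz, abs_nonneg (ρ' z - ρ z), norm_nonneg (fderiv ℝ ρ' z - fderiv ℝ ρ z)]
  have e1 : ∀ z ∈ O, fderiv ℝ (fun y => ρ' y - ρ y) z = fderiv ℝ ρ' z - fderiv ℝ ρ z := fun z hz =>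
    fderiv_sub (d1 z hz) ((hρ z hz).differentiableAt (by norm_num))
  have e2 : ∀ z ∈ O, fderiv ℝ (fun y => ρ' y - ρ y) =ᶠ[𝓝 z] fun y => fderiv ℝ ρ' y - fderiv ℝ ρ y := by
    intro z hz
    filter_upwards [hO.mem_nhds hz] with y hy using e1 y hy
  refine ⟨fun z hz => (d1 z hz).sub ((hρ z hz).differentiableAt (by norm_num)), fun z hz => ?_, fun z hz => ?_, fun z hz => ?_⟩
  · exact ((d2 z hz).sub (c2_dd (hρ z hz))).congr_of_eventuallyEq (e2 z hz)
  · rw [(e2 z hz).fderiv_eq, fderiv_fun_sub (d2 z hz) (c2_dd (hρ z hz))]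
    have := hcl z hz
    linarith [abs_nonneg (ρ' z - ρ z), norm_nonneg (fderiv ℝ ρ' z - fderiv ℝ ρ z)]
  · rw [e1 z hz]
    have := hcl z hz
    linarith [abs_nonneg (ρ' z - ρ z), norm_nonneg (fderiv ℝ (fderiv ℝ ρ') z - fderiv ℝ (fderiv ℝ ρ) z)]

lemma kap_lt {m a b : ℝ} (hb : m < b) (hab : a < b) : kap m a < kap m b := by
  unfold kap
  rw [max_eq_left (a := b - m) (by linarith)]
  exact pow_lt_pow_left₀ (max_lt (by linarith) (by linarith)) (le_max_right _ _) (by norm_num)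

lemma kap_zero {m a : ℝ} (h : a ≤ m) : kap m a = 0 := by
  unfold kap
  rw [max_eq_right (by linarith)]; norm_num

lemma neg_bound {K : Set (EN N)} (h : Geo D V ρ) (hK : IsCompact K) (hKD : K ⊆ D) :
    ∃ κ > 0, ∀ z ∈ K, ρ z ≤ -κ := by
  rcases K.eq_empty_or_nonempty with rfl | hne
  · exact ⟨1, one_pos, by simp⟩
  · obtain ⟨z, hz, hm⟩ := hK.exists_isMaxOn hne ((h.cd.continuousOn).mono (hKD.trans h.DV))
    exact ⟨-ρ z, by linarith [h.neg (hKD hz)], fun y hy => by have := hm hy; simp at this; linarith⟩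

theorem Bprime2 (hN : 2 ≤ N) (h : Geo D V ρ) {W : Set (EN N)} (hW : IsOpen W) (hDW : closure D ⊆ W)
    {K : Set (EN N)} (hK : IsCompact K) (hKD : K ⊆ D) :
    ∃ ε > 0, ∀ (ρ' : EN N → ℝ) (Y : Set (EN N)), C2DistLt W ρ' ρ ε → IsCompact Y → Y ⊆ D → (∀ y ∈ Y, ρ' y = 0) →
      ∀ p ∈ Y, ∀ U, IsOpen U → p ∈ U → ∃ Ψ : EN N → ℂ, DifferentiableOn ℂ Ψ D ∧ Ψ p = 1 ∧
        ∀ x ∈ (Y \ U) ∪ K, ‖Ψ x‖ ≤ 1/2 := by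
  obtain ⟨G, θ, HB⟩ := h.base
  obtain ⟨c, hc, A, hA, hcol⟩ := h.collar
  obtain ⟨κ, hκ, hKκ⟩ := neg_bound h hK hKD
  set A1 := 2 * A + 1 with hA1
  have hA1p : 0 < A1 := by linarith
  obtain ⟨c0, hc0, hc0c, hc0κ⟩ : ∃ c0 > 0, c0 < c ∧ c0 < κ := by
    refine ⟨min c κ / 2, by have := lt_min hc hκ; positivity, ?_, ?_⟩
    · have := min_le_left c κ; have := lt_min hc hκ; linarith
    · have := min_le_right c κ; have := lt_min hc hκ; linarith
  obtain ⟨ε, hε, e1, e2, e3, e4⟩ : ∃ ε > 0, ε ≤ 1 ∧ ε ≤ c0/4 ∧ ε ≤ c/2 ∧ ε ≤ c/(1+A1) := by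
    refine ⟨min (min 1 (c0/4)) (min (c/2) (c/(1+A1))), by positivity, ?_, ?_, ?_, ?_⟩
    · exact (min_le_left _ _).trans (min_le_left _ _)
    · exact (min_le_left _ _).trans (min_le_right _ _)
    · exact (min_le_right _ _).trans (min_le_left _ _)
    · exact (min_le_right _ _).trans (min_le_right _ _)
  have e5 : (1 + A1) * ε ≤ c := by
    rw [le_div_iff₀ (by linarith)] at e4; linarith
  refine ⟨ε, hε, fun ρ' Y hcl hY hYD hY0 p hp U hU hpU => ?_⟩
  have hρc : ContinuousOn ρ V := h.cd.continuousOn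
  set T := {z ∈ closure D | -c ≤ ρ z} with hT
  have hTc : IsCompact T := by
    have : IsClosed (closure D ∩ ρ ⁻¹' Ici (-c)) :=
      (hρc.mono h.sub).preimage_isClosed_of_isClosed isClosed_closure isClosed_Ici
    exact h.cpt.of_isClosed_subset this inter_subset_left
  have hn1 : ContinuousOn (fun z => ‖fderiv ℝ ρ z‖) V := h.c1.norm
  have hn2 : ContinuousOn (fun z => ‖fderiv ℝ (fderiv ℝ ρ) z‖) V := ContinuousOn.norm (E := EN N →L[ℝ] EN N →L[ℝ] ℝ) h.c2
  set O := ((V ∩ (fun z => ‖fderiv ℝ ρ z‖) ⁻¹' Ioi (c/2)) ∩ (V ∩ (fun z => ‖fderiv ℝ (fderiv ℝ ρ) z‖) ⁻¹' Ioi (c/2))) ∩ W with hO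
  have hOo : IsOpen O := ((hn1.isOpen_inter_preimage h.opV isOpen_Ioi).inter (hn2.isOpen_inter_preimage h.opV isOpen_Ioi)).inter hW
  have hTO : T ⊆ O := by
    rintro z ⟨hz, hz'⟩
    obtain ⟨q1, q2⟩ := hcol z hz hz'
    have q3 := hess_norm hN q2
    have hzV := h.sub hz
    refine ⟨⟨⟨hzV, ?_⟩, ⟨hzV, ?_⟩⟩, hDW hz⟩ <;> simp only [mem_preimage, mem_Ioi] <;> linarith
  obtain ⟨s1, s2, s3, s4⟩ := close_diff (ρ := ρ) (ρ' := ρ') (ε := ε) hOo (fun z hz => h.cat hz.1.1.1) (fun z hz => hcl z hz.2)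
    (fun z hz => by have : c/2 < ‖fderiv ℝ ρ z‖ := hz.1.1.2
                    linarith)
    (fun z hz => by have : c/2 < ‖fderiv ℝ (fderiv ℝ ρ) z‖ := hz.1.2.2
                    linarith)
  obtain ⟨d, hd, hdU⟩ := Metric.isOpen_iff.1 hU p hpU
  set c' := A1 * (c/2) * Real.exp (A1 * (-c - 2)) with hc'
  have hc'p : 0 < c' := by positivity
  obtain ⟨η, hη, n1, n2, n3⟩ : ∃ η > 0, η ≤ 1 ∧ η ≤ c0/4 ∧ Real.exp (A1*η) - Real.exp (-(A1*η)) < c' * d^2 := by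
    have hcont : Tendsto (fun η : ℝ => Real.exp (A1*η) - Real.exp (-(A1*η))) (𝓝[>] 0) (𝓝 0) := by
      have : Continuous (fun η : ℝ => Real.exp (A1*η) - Real.exp (-(A1*η))) := by fun_prop
      have := (this.tendsto 0).mono_left (nhdsWithin_le_nhds (s := Ioi 0))
      simpa using this
    have q : ∀ᶠ η in 𝓝[>] (0:ℝ), Real.exp (A1*η) - Real.exp (-(A1*η)) < c' * d^2 :=
      hcont.eventually (gt_mem_nhds (by positivity))
    have q2 : ∀ᶠ η in 𝓝[>] (0:ℝ), η < min 1 (c0/4) :=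
      mem_nhdsWithin_of_mem_nhds (gt_mem_nhds (by positivity))
    obtain ⟨η, ⟨a1, a2⟩, a3⟩ := ((q.and q2).and self_mem_nhdsWithin).exists
    exact ⟨η, a3, a2.le.trans (min_le_left _ _), a2.le.trans (min_le_right _ _), a1⟩
  obtain ⟨S, hS, hST⟩ := smooth_approx hTc hOo hTO hε hη s1 s2 s3 s4
  set m := Real.exp (-(A1 * (c0/2))) with hm
  set τ : EN N → ℝ := fun z => Real.exp (A1 * (ρ z + S z)) + (-c') * ‖z - p‖^2 with hτ
  set ψ : EN N → ℝ := fun z => if -c < ρ z then kap m (τ z) else 0 with hψ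
  have hSb : ∀ z ∈ T, |S z| ≤ ε + η := by
    intro z hz
    have q1 := (hST z hz).1
    have q2 := hcl z (hTO hz).2
    have q3 : |ρ' z - ρ z| ≤ ε := by
      linarith [norm_nonneg (fderiv ℝ ρ' z - fderiv ℝ ρ z), norm_nonneg (fderiv ℝ (fderiv ℝ ρ') z - fderiv ℝ (fderiv ℝ ρ) z)]
    rw [abs_le] at *
    constructor <;> linarith
  have ha : ∀ z ∈ T, ρ z ≤ -c0 → τ z ≤ m := by
    intro z hz hz0
    have q1 := (abs_le.1 (hSb z hz)).2
    have q2 : Real.exp (A1 * (ρ z + S z)) ≤ m := by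
      apply Real.exp_le_exp.2
      rw [← mul_neg]
      exact mul_le_mul_of_nonneg_left (by linarith) hA1p.le
    have q3 : 0 ≤ c' * ‖z - p‖^2 := by positivity
    simp only [hτ]; linarith
  have hYc : ∀ y ∈ Y, -c < ρ y ∧ y ∈ T ∧ |ρ y + S y| ≤ η := by
    intro y hy
    have hyD := subset_closure (hYD hy)
    have q2 := hcl y (hDW hyD)
    rw [hY0 y hy] at q2
    have q3 : |0 - ρ y| < ε := by
      linarith [norm_nonneg (fderiv ℝ ρ' y - fderiv ℝ ρ y), norm_nonneg (fderiv ℝ (fderiv ℝ ρ') y - fderiv ℝ (fderiv ℝ ρ) y)]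
    have q4 : -c < ρ y := by rw [abs_lt] at q3; linarith
    have hyT : y ∈ T := ⟨hyD, q4.le⟩
    refine ⟨q4, hyT, ?_⟩
    have := (hST y hyT).1
    rw [hY0 y hy] at this
    rwa [show ρ y + S y = S y - (0 - ρ y) by ring]
  have hτp : Real.exp (-(A1*η)) ≤ τ p := by
    simp only [hτ, sub_self, norm_zero]
    norm_num
    have := (abs_le.1 (hYc p hp).2.2).1
    nlinarith
  have hτm : m < τ p := by
    refine lt_of_lt_of_le ?_ hτp
    apply Real.exp_lt_exp.2
    nlinarith
  have hψp : ψ p = kap m (τ p) := if_pos (hYc p hp).1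
  have hψp0 : 0 < ψ p := by
    rw [hψp, ← kap_zero (le_refl m)]
    exact kap_lt hτm hτm
  have hev0 : ∀ z ∈ D, ρ z < -c0 → ψ =ᶠ[𝓝 z] fun _ => 0 := by
    intro z hz hz0
    have hca : ContinuousAt ρ z := (h.cat (h.DV hz)).continuousAt
    filter_upwards [h.opD.mem_nhds hz, hca.eventually (gt_mem_nhds hz0)] with y hy hy0
    simp only [hψ]
    split_ifs with hif
    · exact kap_zero (ha y ⟨subset_closure hy, hif.le⟩ hy0.le)
    · rfl
  have hev1 : ∀ z ∈ D, -c < ρ z → ψ =ᶠ[𝓝 z] fun y => kap m (τ y) := by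
    intro z hz hz0
    have hca : ContinuousAt ρ z := (h.cat (h.DV hz)).continuousAt
    filter_upwards [hca.eventually (lt_mem_nhds hz0)] with y hy0
    exact if_pos hy0
  have hτ2 : ∀ z ∈ D, ContDiffAt ℝ 2 τ z := fun z hz =>
    ((contDiffAt_const.mul ((h.cat (h.DV hz)).add hS.contDiffAt)).exp).add (contDiffAt_const.mul (nsq_contDiff p).contDiffAt)
  refine Bpp HB (ψ0 := ψ) (p := p) (X := (Y \ U) ∪ K) ?_ ?_ (hYD hp) ((hY.diff hU).union hK) ?_ ?_
  · intro z hz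
    apply ContDiffAt.contDiffWithinAt
    rcases lt_or_ge (-c) (ρ z) with hz0 | hz0
    · exact ((kap_contDiff m).contDiffAt.comp z (hτ2 z hz)).congr_of_eventuallyEq (hev1 z hz hz0)
    · exact contDiffAt_const.congr_of_eventuallyEq (hev0 z hz (by linarith))
  · intro z hz w
    rcases lt_or_ge (-c) (ρ z) with hz0 | hz0
    · rw [levi_congr (hev1 z hz hz0) w, levi_comp (hτ2 z hz) (Eventually.of_forall fun t => kap_d1 m t) (kap_d2 m _)]
      have hzT : z ∈ T := ⟨subset_closure hz, hz0.le⟩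
      have hL : 0 ≤ LeviForm τ z w := by
        refine levi_peak (A := A) (ε := ε) (c := c) (h.cat (h.DV hz)) hS (by linarith) hA1p hε e1 e5 (hcol z hzT.1 hz0.le).2
          (hST z hzT).2.1 (hST z hzT).2.2 ?_ w
        apply mul_le_mul_of_nonneg_left _ (by positivity)
        apply Real.exp_le_exp.2
        apply mul_le_mul_of_nonneg_left _ hA1p.le
        have := (abs_le.1 (hSb z hzT)).1
        linarith
      have ht := tq_nonneg (u := τ) (x := z) (w := w)
      have hM : 0 ≤ max (τ z - m) 0 := le_max_right _ _
      positivity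
    · rw [levi_congr (hev0 z hz (by linarith)) w, levi_zero_fun]
  · exact union_subset (diff_subset.trans hYD) hKD
  · rintro x (⟨hxY, hxU⟩ | hxK)
    · obtain ⟨q1, q2, q3⟩ := hYc x hxY
      rw [hψp, show ψ x = kap m (τ x) from if_pos q1]
      refine kap_lt hτm (lt_of_lt_of_le ?_ hτp)
      have q4 : d ≤ ‖x - p‖ := by
        by_contra hlt
        exact hxU (hdU (by rw [mem_ball, dist_eq_norm]; exact not_le.1 hlt))
      have q5 : c' * d^2 ≤ c' * ‖x - p‖^2 := by gcongr
      have q6 : Real.exp (A1 * (ρ x + S x)) ≤ Real.exp (A1 * η) := by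
        apply Real.exp_le_exp.2
        exact mul_le_mul_of_nonneg_left (abs_le.1 q3).2 hA1p.le
      simp only [hτ]; linarith
    · rw [(hev0 x (hKD hxK) (by linarith [hKκ x hxK])).eq_of_nhds]
      exact hψp0

end bp2b
end

open Set Filter Topology Metric MeasureTheory
open scoped ENNReal NNReal InnerProductSpace ComplexConjugate ContDiff Manifold

noncomputable section
section appr
variable {N : ℕ} {D X : Set (EN N)} {f g u v : EN N → ℂ}

/-- bounded on `X` and uniformly approximable on `X` by holomorphic functions on `D` -/
def App (D X : Set (EN N)) (f : EN N → ℂ) : Prop :=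
  (∃ R : ℝ, ∀ x ∈ X, ‖f x‖ ≤ R) ∧ ∀ ε > 0, ∃ F : EN N → ℂ, DifferentiableOn ℂ F D ∧ ∀ x ∈ X, ‖F x - f x‖ ≤ ε

lemma App.of_hol (hX : IsCompact X) (hXD : X ⊆ D) (hf : DifferentiableOn ℂ f D) : App D X f :=
  ⟨hX.exists_bound_of_continuousOn (hf.continuousOn.mono hXD), fun ε hε => ⟨f, hf, by simp [hε.le]⟩⟩

lemma App.const (c : ℂ) : App D X (fun _ => c) :=
  ⟨⟨‖c‖, by simp⟩, fun ε hε => ⟨fun _ => c, differentiableOn_const c, by simp [hε.le]⟩⟩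

lemma App.lim (h : ∀ ε > 0, ∃ g, App D X g ∧ ∀ x ∈ X, ‖g x - f x‖ ≤ ε) : App D X f := by
  constructor
  · obtain ⟨g, ⟨⟨R, hR⟩, -⟩, hg⟩ := h 1 one_pos
    refine ⟨R + 1, fun x hx => ?_⟩
    have := norm_sub_norm_le (f x) (g x)
    rw [norm_sub_rev] at this
    linarith [hg x hx, hR x hx]
  · intro ε hε
    obtain ⟨g, ⟨-, h2⟩, hg⟩ := h (ε/2) (by positivity)
    obtain ⟨F, hF, hF2⟩ := h2 (ε/2) (by positivity)
    refine ⟨F, hF, fun x hx => ?_⟩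
    have := norm_sub_le_norm_sub_add_norm_sub (F x) (g x) (f x)
    linarith [hF2 x hx, hg x hx]

lemma App.congr (h : App D X f) (he : ∀ x ∈ X, f x = g x) : App D X g :=
  App.lim fun ε hε => ⟨f, h, fun x hx => by simp [he x hx, hε.le]⟩

lemma App.add (hf : App D X f) (hg : App D X g) : App D X (fun x => f x + g x) := by
  obtain ⟨⟨R, hR⟩, h1⟩ := hf
  obtain ⟨⟨R', hR'⟩, h2⟩ := hg
  refine ⟨⟨R + R', fun x hx => (norm_add_le _ _).trans (add_le_add (hR x hx) (hR' x hx))⟩, fun ε hε => ?_⟩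
  obtain ⟨F, hF, hF2⟩ := h1 (ε/2) (by positivity)
  obtain ⟨G, hG, hG2⟩ := h2 (ε/2) (by positivity)
  refine ⟨fun x => F x + G x, hF.add hG, fun x hx => ?_⟩
  rw [add_sub_add_comm]
  linarith [norm_add_le (F x - f x) (G x - g x), hF2 x hx, hG2 x hx]

lemma App.mul (hf : App D X f) (hg : App D X g) : App D X (fun x => f x * g x) := by
  obtain ⟨⟨R, hR⟩, h1⟩ := hf
  obtain ⟨⟨R', hR'⟩, h2⟩ := hg
  have hb : ∀ x ∈ X, ‖f x * g x‖ ≤ |R| * |R'| := fun x hx => by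
    rw [norm_mul]
    exact mul_le_mul ((hR x hx).trans (le_abs_self _)) ((hR' x hx).trans (le_abs_self _)) (norm_nonneg _) (abs_nonneg _)
  refine ⟨⟨|R| * |R'|, hb⟩, fun ε hε => ?_⟩
  set B := |R| + |R'| + 1 with hB
  have hBp : 0 < B := by positivity
  set η := min 1 (ε / B) with hη
  have hηp : 0 < η := by positivity
  obtain ⟨F, hF, hF2⟩ := h1 η hηp
  obtain ⟨G, hG, hG2⟩ := h2 η hηp
  refine ⟨fun x => F x * G x, hF.mul hG, fun x hx => ?_⟩
  have e : F x * G x - f x * g x = (F x - f x) * (G x - g x) + f x * (G x - g x) + (F x - f x) * g x := by ring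
  rw [e]
  have a1 : ‖(F x - f x) * (G x - g x)‖ ≤ η * 1 := by
    rw [norm_mul]; exact mul_le_mul (hF2 x hx) ((hG2 x hx).trans (min_le_left _ _)) (norm_nonneg _) hηp.le
  have a2 : ‖f x * (G x - g x)‖ ≤ |R| * η := by
    rw [norm_mul]; exact mul_le_mul ((hR x hx).trans (le_abs_self _)) (hG2 x hx) (norm_nonneg _) (abs_nonneg _)
  have a3 : ‖(F x - f x) * g x‖ ≤ η * |R'| := by
    rw [norm_mul]; exact mul_le_mul (hF2 x hx) ((hR' x hx).trans (le_abs_self _)) (norm_nonneg _) hηp.le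
  have a4 : η * B ≤ ε := by
    rw [← le_div_iff₀ hBp]; exact min_le_right _ _
  refine (norm_add₃_le).trans ?_
  rw [hB] at a4
  linarith

lemma App.sub (hf : App D X f) (hg : App D X g) : App D X (fun x => f x - g x) :=
  (hf.add ((App.const (-1)).mul hg)).congr fun x _ => by ring

lemma App.pow (hf : App D X f) (n : ℕ) : App D X (fun x => f x ^ n) := by
  induction n with
  | zero => simpa using App.const 1
  | succ n ih => exact (ih.mul hf).congr fun x _ => by ring

lemma App.sum {ι : Type*} (s : Finset ι) {F : ι → EN N → ℂ} (h : ∀ i ∈ s, App D X (F i)) :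
    App D X (fun x => ∑ i ∈ s, F i x) := by
  classical
  induction s using Finset.induction_on with
  | empty => simpa using App.const 0
  | insert i s hi ih =>
    refine ((h i (Finset.mem_insert_self _ _)).add (ih fun j hj => h j (Finset.mem_insert_of_mem hj))).congr fun x _ => ?_
    rw [Finset.sum_insert hi]

lemma App.mprod (s : Multiset ℂ) {F : ℂ → EN N → ℂ} (h : ∀ i ∈ s, App D X (F i)) :
    App D X (fun x => (s.map fun i => F i x).prod) := by
  induction s using Multiset.induction_on with
  | empty => simpa using App.const 1
  | cons i s ih =>
    refine ((h i (Multiset.mem_cons_self _ _)).mul (ih fun j hj => h j (Multiset.mem_cons_of_mem hj))).congr fun x _ => ?_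
    rw [Multiset.map_cons, Multiset.prod_cons]

lemma App.geom (hf : App D X f) {r : ℝ} (hr : r < 1) (hfr : ∀ x ∈ X, ‖f x‖ ≤ r) :
    App D X (fun x => (1 - f x)⁻¹) := by
  rcases X.eq_empty_or_nonempty with rfl | ⟨x0, hx0⟩
  · exact ⟨⟨0, by simp⟩, fun ε _ => ⟨fun _ => 0, differentiableOn_const _, by simp⟩⟩
  have hr0 : 0 ≤ r := (norm_nonneg _).trans (hfr x0 hx0)
  refine App.lim fun ε hε => ?_
  obtain ⟨n, hn⟩ := exists_pow_lt_of_lt_one (show 0 < ε * (1 - r) by nlinarith) hr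
  refine ⟨fun x => ∑ k ∈ Finset.range n, f x ^ k, App.sum _ fun k _ => hf.pow k, fun x hx => ?_⟩
  have h1 : ‖f x‖ ≤ r := hfr x hx
  have h2 : 1 - r ≤ ‖1 - f x‖ := by
    have := norm_sub_norm_le (1:ℂ) (f x)
    rw [norm_one] at this; linarith
  have h3 : 1 - f x ≠ 0 := by
    intro h0; rw [h0, norm_zero] at h2; linarith
  have h4 : (∑ k ∈ Finset.range n, f x ^ k) - (1 - f x)⁻¹ = -(f x ^ n) / (1 - f x) := by
    have := geom_sum_mul_neg (f x) n
    field_simp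
    rw [this]; ring
  rw [h4, norm_div, norm_neg, norm_pow, div_le_iff₀ (by linarith)]
  calc ‖f x‖^n ≤ r^n := by gcongr
    _ ≤ ε * (1 - r) := hn.le
    _ ≤ ε * ‖1 - f x‖ := by gcongr

lemma App.step {a b : ℂ} {δ : ℝ} (hb : App D X (fun x => (u x - b)⁻¹))
    (hd : ∀ x ∈ X, δ ≤ ‖u x - b‖) (hab : ‖a - b‖ < δ) : App D X (fun x => (u x - a)⁻¹) := by
  have hδ : 0 < δ := (norm_nonneg _).trans_lt hab
  have q : App D X (fun x => (a - b) * (u x - b)⁻¹) := (App.const (a - b)).mul hb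
  have q2 := q.geom (r := ‖a - b‖ / δ) ((div_lt_one hδ).2 hab) fun x hx => by
    rw [norm_mul, norm_inv, div_eq_mul_inv]
    exact mul_le_mul_of_nonneg_left (inv_anti₀ hδ (hd x hx)) (norm_nonneg _)
  refine (hb.mul q2).congr fun x hx => ?_
  have h1 : u x - b ≠ 0 := fun h0 => by
    have := hd x hx; rw [h0, norm_zero] at this; linarith
  rw [← mul_inv]
  congr 1
  field_simp
  ring

lemma App.seg {a b : ℂ} {δ : ℝ} (hδ : 0 < δ) (hb : App D X (fun x => (u x - b)⁻¹))
    (hd : ∀ x ∈ X, ∀ t ∈ Icc (0:ℝ) 1, δ ≤ ‖u x - (b + t * (a - b))‖) : App D X (fun x => (u x - a)⁻¹) := by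
  obtain ⟨n, hn⟩ := exists_nat_gt (‖a - b‖ / δ)
  have hn0 : (0:ℝ) < n := lt_of_le_of_lt (by positivity) hn
  have key : ∀ k : ℕ, k ≤ n → App D X (fun x => (u x - (b + ((k / n : ℝ) : ℂ) * (a - b)))⁻¹) := by
    intro k
    induction k with
    | zero => intro _; simpa using hb
    | succ k ih =>
      intro hk
      refine (ih (by omega)).step (δ := δ) (fun x hx => hd x hx _ ⟨by positivity, ?_⟩) ?_
      · rw [div_le_one hn0]; exact_mod_cast (by omega : k ≤ n)
      · have e : b + (((k+1:ℕ) / n : ℝ) : ℂ) * (a - b) - (b + ((k / n : ℝ) : ℂ) * (a - b)) = ((1 / n : ℝ) : ℂ) * (a - b) := by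
          push_cast; ring
        rw [e, norm_mul, Complex.norm_real, Real.norm_of_nonneg (by positivity), one_div, inv_mul_lt_iff₀ hn0]
        rwa [div_lt_iff₀ hδ] at hn
  have := key n le_rfl
  rw [div_self hn0.ne'] at this
  simpa using this

lemma App.far {b : ℂ} {R : ℝ} (hu : App D X u) (hR : ∀ x ∈ X, ‖u x‖ ≤ R) (hb : R < ‖b‖) (hR0 : 0 ≤ R):
    App D X (fun x => (u x - b)⁻¹) := by
  have hb0 : 0 < ‖b‖ := by linarith
  have hbn : b ≠ 0 := norm_pos_iff.1 hb0
  have q : App D X (fun x => b⁻¹ * u x) := (App.const b⁻¹).mul hu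
  have q2 := q.geom (r := ‖b‖⁻¹ * R) (by rwa [inv_mul_lt_iff₀ hb0, mul_one]) fun x hx => by
    rw [norm_mul, norm_inv]
    exact mul_le_mul_of_nonneg_left (hR x hx) (by positivity)
  refine ((App.const (-b⁻¹)).mul q2).congr fun x hx => ?_
  rw [← inv_neg, ← mul_inv]
  congr 1
  field_simp
  ring

lemma App.ray {a e : ℂ} {δ : ℝ} (hδ : 0 < δ) (hu : App D X u) (he : e ≠ 0)
    (hd : ∀ x ∈ X, ∀ t : ℝ, 0 ≤ t → δ ≤ ‖u x - (a + t * e)‖) : App D X (fun x => (u x - a)⁻¹) := by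
  obtain ⟨R, hR⟩ := hu.1
  have he0 : 0 < ‖e‖ := norm_pos_iff.2 he
  set s := (|R| + ‖a‖ + 1) / ‖e‖ with hs
  have hs0 : 0 ≤ s := by positivity
  have hfar : App D X (fun x => (u x - (a + s * e))⁻¹) := by
    refine hu.far (R := |R|) (fun x hx => (hR x hx).trans (le_abs_self _)) ?_ (abs_nonneg _)
    have h1 : ‖(s:ℂ) * e‖ = |R| + ‖a‖ + 1 := by
      rw [norm_mul, Complex.norm_real, Real.norm_of_nonneg hs0, hs]; field_simp
    have h2 := norm_sub_le (a + s * e) a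
    rw [add_sub_cancel_left, h1] at h2
    linarith
  refine hfar.seg hδ fun x hx t ht => ?_
  have := hd x hx (s * (1 - t)) (mul_nonneg hs0 (by linarith [ht.2]))
  convert this using 3
  push_cast; ring

/-- indicator of a half plane -/
lemma App.ind (hu : App D X u) {d : ℝ} (hd : 0 < d) (hX : ∀ x ∈ X, d ≤ |(u x).re|) :
    App D X (fun x => if 0 < (u x).re then 1 else 0) := by
  obtain ⟨R0, hR0⟩ := hu.1
  set R := |R0| + 1 with hRd
  have hR : ∀ x ∈ X, ‖u x‖ ≤ R - 1 := fun x hx => by rw [hRd, add_sub_cancel_right]; exact (hR0 x hx).trans (le_abs_self _)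
  have hRp : 1 ≤ R := by rw [hRd]; linarith [abs_nonneg R0]
  set T := R^2 / d with hT
  have hTp : 0 < T := by positivity
  -- resolvents
  have hres : ∀ a : ℂ, ‖a‖^2 = 2 * T * a.re → App D X (fun x => (u x - a)⁻¹) := by
    intro a ha
    rcases le_or_gt a.re (d/2) with h1 | h1
    · refine hu.ray (e := Complex.I) (δ := d/2) (by positivity) Complex.I_ne_zero fun x hx t ht => ?_
      have h2 := Complex.abs_re_le_norm (u x - (a + t * Complex.I))
      have h3 : (u x - (a + t * Complex.I)).re = (u x).re - a.re := by simp
      rw [h3] at h2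
      have h4 := hX x hx
      have h5 : 0 ≤ a.re := by
        have : 0 ≤ 2 * T * a.re := by rw [← ha]; positivity
        exact nonneg_of_mul_nonneg_right this (by positivity)
      have h6 : |(u x).re| ≤ |(u x).re - a.re| + |a.re| := by
        have := abs_add_le ((u x).re - a.re) a.re
        rwa [sub_add_cancel] at this
      rw [abs_of_nonneg h5] at h6
      linarith
    · have h2 : R < ‖a‖ := by
        have : R^2 < ‖a‖^2 := by
          rw [ha, hT]
          have : R^2 / d * d = R^2 := by field_simp
          have h7 : 0 < R^2 / d := by positivity
          nlinarith
        exact lt_of_pow_lt_pow_left₀ 2 (norm_nonneg _) this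
      exact hu.far hR (by linarith) (by linarith)
  -- the base function
  set v : EN N → ℂ := fun x => 1 - (T:ℂ)⁻¹ * u x with hv
  have hvA : App D X v := (App.const 1).sub ((App.const _).mul hu)
  have hTc : (T:ℂ) ≠ 0 := by exact_mod_cast hTp.ne'
  have hresv : ∀ ζ : ℂ, ‖ζ‖ = 1 → App D X (fun x => (v x - ζ)⁻¹) := by
    intro ζ hζ
    have h1 := hres (T * (1 - ζ)) (by
      have h2 : ζ.re^2 + ζ.im^2 = 1 := by
        have : ‖ζ‖^2 = 1 := by rw [hζ]; norm_num
        rw [← Complex.normSq_eq_norm_sq, Complex.normSq_apply] at this; linarith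
      rw [← Complex.normSq_eq_norm_sq, Complex.normSq_apply]
      simp
      linear_combination T^2 * h2)
    refine ((App.const (-T)).mul h1).congr fun x hx => ?_
    have : v x - ζ = -(T:ℂ)⁻¹ * (u x - T * (1 - ζ)) := by simp only [hv]; field_simp; ring
    rw [this, mul_inv, inv_neg, inv_inv]
  have hprod : ∀ n : ℕ, n ≠ 0 → App D X (fun x => (1 + v x ^ n)⁻¹) := by
    intro n hn
    set P : Polynomial ℂ := Polynomial.X ^ n + Polynomial.C 1 with hP
    have hm : P.Monic := Polynomial.monic_X_pow_add_C 1 hn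
    have hroot : ∀ ζ ∈ P.roots, ‖ζ‖ = 1 := by
      intro ζ hζ
      have := (Polynomial.mem_roots'.1 hζ).2
      simp [hP, Polynomial.IsRoot] at this
      have h2 : ζ^n = -1 := by linear_combination this
      have h3 : ‖ζ‖^n = 1 := by rw [← norm_pow, h2]; simp
      exact (pow_eq_one_iff_of_nonneg (norm_nonneg _) hn).1 h3
    refine (App.mprod P.roots (F := fun ζ x => (v x - ζ)⁻¹) fun ζ hζ => hresv ζ (hroot ζ hζ)).congr fun x hx => ?_
    have e1 : 1 + v x ^ n = P.eval (v x) := by simp [hP]; ring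
    rw [e1, (IsAlgClosed.splits P).eval_eq_prod_roots, hm.leadingCoeff, one_mul]
    rw [Multiset.prod_map_inv]
  -- norms of v
  set q := 1 - d / T with hq
  have hnv : ∀ x ∈ X, T^2 * ‖v x‖^2 = T^2 - 2 * T * (u x).re + ‖u x‖^2 := by
    intro x hx
    have e : (T:ℂ) * v x = T - u x := by simp only [hv]; field_simp
    have e2 : T^2 * ‖v x‖^2 = ‖(T:ℂ) - u x‖^2 := by
      rw [← e, norm_mul, mul_pow, Complex.norm_real, Real.norm_eq_abs, sq_abs]
    rw [e2, ← Complex.normSq_eq_norm_sq, ← Complex.normSq_eq_norm_sq, Complex.normSq_apply, Complex.normSq_apply]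
    simp
    ring
  have hub : ∀ x ∈ X, ‖u x‖^2 ≤ T * d := by
    intro x hx
    have : T * d = R^2 := by rw [hT]; field_simp
    rw [this]
    exact pow_le_pow_left₀ (norm_nonneg _) (by linarith [hR x hx]) 2
  set r := Real.sqrt (1 - d/T) with hr
  have hdT : 0 < d / T := by positivity
  have hr1 : r < 1 := by
    rw [hr, Real.sqrt_lt' one_pos]; linarith
  have hr0 : 0 ≤ r := Real.sqrt_nonneg _
  set r' := Real.sqrt (1 + d/T) with hr'
  have hr'1 : 1 < r' := by
    rw [hr', Real.lt_sqrt (by norm_num)]; linarith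
  have hsm : ∀ x ∈ X, 0 < (u x).re → ‖v x‖ ≤ r := by
    intro x hx h0
    have h1 := hX x hx
    rw [abs_of_pos h0] at h1
    apply Real.le_sqrt_of_sq_le
    have h2 := hnv x hx
    have h3 := hub x hx
    have h4 : T^2 * ‖v x‖^2 ≤ T^2 * (1 - d/T) := by
      have : T^2 * (1 - d/T) = T^2 - T * d := by field_simp
      rw [this, h2]; nlinarith
    exact le_of_mul_le_mul_left h4 (by positivity)
  have hbg : ∀ x ∈ X, ¬ 0 < (u x).re → r' ≤ ‖v x‖ := by
    intro x hx h0
    have h1 := hX x hx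
    rw [abs_of_nonpos (not_lt.1 h0)] at h1
    apply Real.sqrt_le_iff.2
    refine ⟨norm_nonneg _, ?_⟩
    have h2 := hnv x hx
    have h4 : T^2 * (1 + d/T) ≤ T^2 * ‖v x‖^2 := by
      have : T^2 * (1 + d/T) = T^2 + T * d := by field_simp
      rw [this, h2]; nlinarith [sq_nonneg ‖u x‖]
    exact le_of_mul_le_mul_left h4 (by positivity)
  refine App.lim fun ε hε => ?_
  obtain ⟨n1, hn1⟩ := exists_pow_lt_of_lt_one (show 0 < min (1/2) (ε/2) by positivity) hr1
  obtain ⟨n2, hn2⟩ := pow_unbounded_of_one_lt (1 + ε⁻¹) hr'1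
  set n := max (max n1 n2) 1 with hnn
  have hn0 : n ≠ 0 := by omega
  have hrn : r^n < min (1/2) (ε/2) := lt_of_le_of_lt (pow_le_pow_of_le_one hr0 hr1.le (by omega)) hn1
  have hrn' : 1 + ε⁻¹ < r'^n := lt_of_lt_of_le hn2 (pow_le_pow_right₀ hr'1.le (by omega))
  refine ⟨_, hprod n hn0, fun x hx => ?_⟩
  split_ifs with h0
  · have h1 : ‖v x ^ n‖ ≤ r^n := by rw [norm_pow]; exact pow_le_pow_left₀ (norm_nonneg _) (hsm x hx h0) n
    have h2 : ‖v x ^ n‖ < 1/2 := h1.trans_lt (hrn.trans_le (min_le_left _ _))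
    have h3 : ‖v x ^ n‖ < ε/2 := h1.trans_lt (hrn.trans_le (min_le_right _ _))
    have h4 : 1/2 ≤ ‖1 + v x ^ n‖ := by
      have := norm_sub_norm_le (1:ℂ) (-(v x ^ n))
      rw [norm_one, norm_neg, sub_neg_eq_add] at this; linarith
    have h5 : 1 + v x ^ n ≠ 0 := fun h => by rw [h, norm_zero] at h4; linarith
    have h6 : (1 + v x ^ n)⁻¹ - 1 = -(v x ^ n) / (1 + v x ^ n) := by field_simp; ring
    rw [h6, norm_div, norm_neg, div_le_iff₀ (by linarith)]
    nlinarith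
  · have h1 : r'^n ≤ ‖v x ^ n‖ := by rw [norm_pow]; exact pow_le_pow_left₀ (by linarith) (hbg x hx h0) n
    have h4 : ε⁻¹ ≤ ‖1 + v x ^ n‖ := by
      have := norm_sub_norm_le (v x ^ n) (-1)
      rw [norm_neg, norm_one, sub_neg_eq_add, add_comm (v x ^ n)] at this; linarith
    rw [sub_zero, norm_inv]
    exact inv_le_of_inv_le₀ hε h4

end appr
end

open Set Filter Topology Metric MeasureTheory
open scoped ENNReal NNReal InnerProductSpace ComplexConjugate ContDiff Manifold

noncomputable section
section bp1

lemma ray_growth {N : ℕ} {g : EN N → ℝ} {p n : EN N} {s k : ℝ}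
    (hd : ∀ t ∈ Icc (0:ℝ) s, DifferentiableAt ℝ g (p + t • n))
    (hk : ∀ t ∈ Icc (0:ℝ) s, k ≤ fderiv ℝ g (p + t • n) n) :
    ∀ t ∈ Icc (0:ℝ) s, g p + k * t ≤ g (p + t • n) := by
  have hder : ∀ t ∈ Icc (0:ℝ) s, HasDerivAt (fun t : ℝ => g (p + t • n)) (fderiv ℝ g (p + t • n) n) t := by
    intro t ht
    have h1 : HasDerivAt (fun t : ℝ => p + t • n) n t := by
      simpa using ((hasDerivAt_id t).smul_const n).const_add p
    exact (hd t ht).hasFDerivAt.comp_hasDerivAt t h1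
  intro t ht
  have := (convex_Icc (0:ℝ) s).mul_sub_le_image_sub_of_le_deriv (f := fun t : ℝ => g (p + t • n)) (C := k)
    (fun t ht => (hder t ht).continuousAt.continuousWithinAt)
    (fun t ht => (hder t (interior_subset ht)).differentiableAt.differentiableWithinAt)
    (fun t ht => by rw [(hder t (interior_subset ht)).deriv]; exact hk t (interior_subset ht))
    0 ⟨le_rfl, ht.1.trans ht.2⟩ t ht ht.1
  simp at this
  linarith

variable {D V : Set (EN 1)} {ρ : EN 1 → ℝ}

lemma norm_one_coord (z : EN 1) : ‖z‖ = ‖z 0‖ := by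
  rw [EuclideanSpace.norm_eq]; simp

theorem exists_segment {N : ℕ} {D V : Set (EN N)} {ρ : EN N → ℝ} (h : Geo D V ρ) {W : Set (EN N)} (hW : IsOpen W) (hDW : closure D ⊆ W)
    {K : Set (EN N)} (hK : IsCompact K) (hKD : K ⊆ D) :
    ∃ ε > 0, ∃ s0 > 0, ∀ (ρ' : EN N → ℝ) (Y : Set (EN N)), C2DistLt W ρ' ρ ε → Y ⊆ D → (∀ y ∈ Y, ρ' y = 0) →
      ∀ p ∈ Y, ∃ n : EN N, n ≠ 0 ∧ ‖n‖ < 1 ∧ (∀ t ∈ Icc (0:ℝ) s0, 0 < t → p + t • n ∉ Y) ∧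
       (∀ t ∈ Icc (0:ℝ) s0, p + t • n ∉ K) ∧ p + s0 • n ∉ D := by
  obtain ⟨c, hc, A, hA, hcol⟩ := h.collar
  obtain ⟨κ, hκ, hKκ⟩ := neg_bound h hK hKD
  have hρc : ContinuousOn ρ V := h.cd.continuousOn
  set T := {z ∈ closure D | -c ≤ ρ z} with hT
  have hTc : IsCompact T := by
    have : IsClosed (closure D ∩ ρ ⁻¹' Ici (-c)) :=
      (hρc.mono h.sub).preimage_isClosed_of_isClosed isClosed_closure isClosed_Ici
    exact h.cpt.of_isClosed_subset this inter_subset_left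
  obtain ⟨s1, hs1, hs1O⟩ := hTc.exists_cthickening_subset_open (h.opV.inter hW) (fun z hz => ⟨h.sub hz.1, hDW hz.1⟩)
  have huc : UniformContinuousOn (fderiv ℝ ρ) (cthickening s1 T) :=
    (hTc.cthickening).uniformContinuousOn_of_continuous (h.c1.mono fun z hz => (hs1O hz).1)
  rw [Metric.uniformContinuousOn_iff] at huc
  obtain ⟨s2, hs2, huc⟩ := huc (c/4) (by positivity)
  set s0 := min s1 (s2/2) with hs0
  have hs0p : 0 < s0 := by positivity
  obtain ⟨ε, hε, e1, e2, e3⟩ : ∃ ε > 0, ε ≤ c/4 ∧ ε ≤ κ ∧ ε ≤ s0 * c/2 := by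
    refine ⟨min (c/4) (min κ (s0*c/2)), by positivity, min_le_left _ _, (min_le_right _ _).trans (min_le_left _ _), (min_le_right _ _).trans (min_le_right _ _)⟩
  refine ⟨ε, hε, s0, hs0p, fun ρ' Y hcl hYD hY0 p hp => ?_⟩
  have hpD := hYD hp
  have hpρ : -ε < ρ p := by
    have q2 := hcl p (hDW (subset_closure hpD))
    rw [hY0 p hp] at q2
    have q3 : |0 - ρ p| < ε := by
      linarith [norm_nonneg (fderiv ℝ ρ' p - fderiv ℝ ρ p), norm_nonneg (fderiv ℝ (fderiv ℝ ρ') p - fderiv ℝ (fderiv ℝ ρ) p)]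
    rw [abs_lt] at q3; linarith
  have hpT : p ∈ T := ⟨subset_closure hpD, by linarith⟩
  obtain ⟨n, hn1, hn⟩ : ∃ n : EN N, ‖n‖ < 1 ∧ 3*c/4 < fderiv ℝ ρ p n := by
    obtain ⟨x, hx1, hx⟩ := (fderiv ℝ ρ p).exists_lt_apply_of_lt_opNorm (show 3*c/4 < ‖fderiv ℝ ρ p‖ by linarith [(hcol p hpT.1 hpT.2).1])
    rw [Real.norm_eq_abs] at hx
    rcases le_total 0 (fderiv ℝ ρ p x) with h0 | h0
    · rw [abs_of_nonneg h0] at hx; exact ⟨x, hx1, hx⟩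
    · rw [abs_of_nonpos h0] at hx; exact ⟨-x, by rwa [norm_neg], by rwa [map_neg]⟩
  have hn0 : n ≠ 0 := by rintro rfl; simp at hn; linarith
  have hnp : 0 < ‖n‖ := norm_pos_iff.2 hn0
  have hdist : ∀ t ∈ Icc (0:ℝ) s0, dist (p + t • n) p ≤ s0 := by
    intro t ht
    rw [dist_eq_norm, add_sub_cancel_left, norm_smul, Real.norm_of_nonneg ht.1]
    nlinarith [ht.1, ht.2]
  have hth : ∀ t ∈ Icc (0:ℝ) s0, p + t • n ∈ cthickening s1 T := fun t ht =>
    mem_cthickening_of_dist_le _ p _ _ hpT ((hdist t ht).trans (min_le_left _ _))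
  have hdd : ∀ t ∈ Icc (0:ℝ) s0, ‖fderiv ℝ ρ (p + t • n) - fderiv ℝ ρ p‖ ≤ c/4 := by
    intro t ht
    have := huc (p + t • n) (hth t ht) p (self_subset_cthickening _ hpT) ((hdist t ht).trans_lt (by
      have := min_le_right s1 (s2/2); linarith))
    rw [dist_eq_norm] at this
    exact this.le
  have hbig : ∀ t ∈ Icc (0:ℝ) s0, c/2 ≤ fderiv ℝ ρ (p + t • n) n := by
    intro t ht
    have h1 := (fderiv ℝ ρ (p + t • n) - fderiv ℝ ρ p).le_of_opNorm_le (hdd t ht) n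
    rw [Real.norm_eq_abs, sub_apply, abs_le] at h1
    nlinarith [h1.1]
  have hbign : ∀ t ∈ Icc (0:ℝ) s0, c/2 ≤ ‖fderiv ℝ ρ (p + t • n)‖ := by
    intro t ht
    have h1 := (fderiv ℝ ρ (p + t • n)).le_opNorm n
    have h2 := le_abs_self (fderiv ℝ ρ (p + t • n) n)
    rw [Real.norm_eq_abs] at h1
    have h3 : ‖fderiv ℝ ρ (p + t • n)‖ * ‖n‖ ≤ ‖fderiv ℝ ρ (p + t • n)‖ * 1 := by gcongr
    linarith [hbig t ht]
  have hcl' : ∀ t ∈ Icc (0:ℝ) s0, ‖fderiv ℝ ρ' (p + t • n) - fderiv ℝ ρ (p + t • n)‖ < ε := by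
    intro t ht
    have := hcl _ (hs1O (hth t ht)).2
    linarith [abs_nonneg (ρ' (p + t • n) - ρ (p + t • n)), norm_nonneg (fderiv ℝ (fderiv ℝ ρ') (p + t • n) - fderiv ℝ (fderiv ℝ ρ) (p + t • n))]
  have hd' : ∀ t ∈ Icc (0:ℝ) s0, DifferentiableAt ℝ ρ' (p + t • n) := by
    intro t ht
    by_contra hnd
    have := hcl' t ht
    rw [fderiv_zero_of_not_differentiableAt hnd, zero_sub, norm_neg] at this
    linarith [hbign t ht]
  have hbig' : ∀ t ∈ Icc (0:ℝ) s0, c/4 ≤ fderiv ℝ ρ' (p + t • n) n := by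
    intro t ht
    have h1 := (fderiv ℝ ρ' (p + t • n) - fderiv ℝ ρ (p + t • n)).le_of_opNorm_le (hcl' t ht).le n
    rw [Real.norm_eq_abs, sub_apply, abs_le] at h1
    nlinarith [h1.1, hbig t ht]
  have g1 := ray_growth (fun t ht => (h.cat (hs1O (hth t ht)).1).differentiableAt (by norm_num)) hbig
  have g2 := ray_growth hd' hbig'
  -- avoiding sets
  have avY : ∀ t ∈ Icc (0:ℝ) s0, 0 < t → p + t • n ∉ Y := by
    intro t ht ht0 hy
    have := g2 t ht
    rw [hY0 _ hy, hY0 p hp] at this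
    nlinarith
  have avK : ∀ t ∈ Icc (0:ℝ) s0, p + t • n ∉ K := by
    intro t ht hy
    have := g1 t ht
    have := hKκ _ hy
    nlinarith [ht.1]
  have avD : p + s0 • n ∉ D := by
    intro hy
    have := g1 s0 ⟨hs0p.le, le_rfl⟩
    have := h.neg hy
    nlinarith
  exact ⟨n, hn0, hn1, avY, avK, avD⟩

lemma segment_dist {N : ℕ} {X : Set (EN N)} {p n : EN N} {t1 s0 : ℝ} (hX : IsCompact X) (hne : X.Nonempty)
    (h1 : t1 ≤ s0) (av : ∀ t ∈ Icc t1 s0, p + t • n ∉ X) :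
    ∃ δ > 0, ∀ x ∈ X, ∀ t ∈ Icc t1 s0, δ ≤ ‖x - (p + t • n)‖ := by
  have hcc : IsCompact (X ×ˢ Icc t1 s0) := hX.prod isCompact_Icc
  have hcont : ContinuousOn (fun q : EN N × ℝ => ‖q.1 - (p + q.2 • n)‖) (X ×ˢ Icc t1 s0) := by fun_prop
  obtain ⟨y, hy⟩ := hne
  obtain ⟨q, hq, hqm⟩ := hcc.exists_isMinOn ⟨(y, t1), mk_mem_prod hy (left_mem_Icc.2 h1)⟩ hcont
  refine ⟨‖q.1 - (p + q.2 • n)‖, ?_, fun x hx t ht => isMinOn_iff.1 hqm (x, t) (mk_mem_prod hx ht)⟩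
  rw [gt_iff_lt, norm_pos_iff, sub_ne_zero]
  intro heq
  exact av _ hq.2 (heq ▸ hq.1)

lemma resolvent_peak {X : Set (EN 1)} {p n : EN 1} {s0 : ℝ} (hs0p : 0 < s0) (hn0 : n ≠ 0) (hn1 : ‖n‖ < 1)
    (hXc : IsCompact X) (hXD : X ⊆ D) (hpD : p ∈ D) (hpX : p ∉ X)
    (av : ∀ t ∈ Icc (0:ℝ) s0, 0 < t → p + t • n ∉ X) (avD : p + s0 • n ∉ D) :
    ∃ Ψ : EN 1 → ℂ, DifferentiableOn ℂ Ψ D ∧ Ψ p = 1 ∧ ∀ x ∈ X, ‖Ψ x‖ ≤ 1/2 := by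
  have hnp : 0 < ‖n‖ := norm_pos_iff.2 hn0
  obtain ⟨dd, hdd0, hddX⟩ := Metric.isOpen_iff.1 hXc.isClosed.isOpen_compl p hpX
  set t1 := min s0 (dd/4) with ht1
  have ht1p : 0 < t1 := by positivity
  have ht1s : t1 ≤ s0 := min_le_left _ _
  have ht1d : t1 ≤ dd/4 := min_le_right _ _
  set X' := insert p X with hX'
  have hX'c : IsCompact X' := hXc.insert p
  have hX'D : X' ⊆ D := insert_subset hpD hXD
  obtain ⟨δ, hδ, hδX⟩ := segment_dist (X := X') hX'c ⟨p, mem_insert _ _⟩ ht1s (n := n) (p := p) (by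
    intro t ht hx
    have ht0 : 0 < t := ht1p.trans_le ht.1
    rcases mem_insert_iff.1 hx with hx | hx
    · have : t • n = 0 := by simpa using hx
      rcases smul_eq_zero.1 this with h0 | h0
      · linarith
      · exact hn0 h0
    · exact av _ ⟨ht0.le, ht.2⟩ ht0 hx)
  -- the resolvent
  have hcoord : DifferentiableOn ℂ (fun z : EN 1 => z 0) D := fun z _ =>
    ((EuclideanSpace.proj (𝕜 := ℂ) (0 : Fin 1)).differentiableAt).differentiableWithinAt
  have hco : ∀ x y : EN 1, ‖x 0 - y 0‖ = ‖x - y‖ := fun x y => by rw [norm_one_coord (x - y)]; simp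
  have hb : App D X' (fun z => (z 0 - (p + s0 • n) 0)⁻¹) := by
    refine App.of_hol hX'c hX'D ((hcoord.sub (differentiableOn_const _)).inv fun z hz => ?_)
    change z 0 - (p + s0 • n) 0 ≠ 0
    rw [← norm_ne_zero_iff, hco, norm_ne_zero_iff, sub_ne_zero]
    rintro rfl; exact avD hz
  have ha : App D X' (fun z => (z 0 - (p + t1 • n) 0)⁻¹) := by
    refine App.seg (u := fun z => z 0) hδ hb fun x hx t ht => ?_
    have e : (p + s0 • n) 0 + (t:ℂ) * ((p + t1 • n) 0 - (p + s0 • n) 0) = (p + (s0 + t * (t1 - s0)) • n) 0 := by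
      simp; ring
    rw [e, hco]
    refine hδX x hx _ ⟨?_, ?_⟩
    · nlinarith [ht.1, ht.2]
    · nlinarith [ht.1, ht.2]
  have htn : 0 < t1 * ‖n‖ := by positivity
  have hgp : ‖(p 0 - (p + t1 • n) 0)⁻¹‖ = (t1 * ‖n‖)⁻¹ := by
    rw [norm_inv, hco, sub_add_cancel_left, norm_neg, norm_smul, Real.norm_of_nonneg ht1p.le]
  set M := (t1 * ‖n‖)⁻¹ with hM
  have hMp : 0 < M := by positivity
  have hgx : ∀ x ∈ X, ‖(x 0 - (p + t1 • n) 0)⁻¹‖ ≤ M/3 := by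
    intro x hx
    rw [norm_inv, hco, hM, div_eq_mul_inv, ← mul_inv]
    apply inv_anti₀ (by positivity)
    have h1 : dd ≤ dist x p := by
      by_contra hlt
      exact hddX (mem_ball.2 (not_le.1 hlt)) hx
    have h2 := dist_triangle x (p + t1 • n) p
    have h3 : dist (p + t1 • n) p = t1 * ‖n‖ := by
      rw [dist_eq_norm, add_sub_cancel_left, norm_smul, Real.norm_of_nonneg ht1p.le]
    rw [h3, dist_eq_norm x (p + t1 • n)] at h2
    nlinarith
  obtain ⟨F, hF, hFX⟩ := ha.2 (M/20) (by positivity)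
  have hFp := hFX p (mem_insert _ _)
  have hFp2 : 19*M/20 ≤ ‖F p‖ := by
    have := norm_sub_norm_le ((p 0 - (p + t1 • n) 0)⁻¹) (F p)
    rw [norm_sub_rev, hgp] at this
    linarith
  have hFp0 : F p ≠ 0 := norm_pos_iff.1 (by linarith)
  refine ⟨fun z => F z * (F p)⁻¹, hF.mul_const _, mul_inv_cancel₀ hFp0, fun x hx => ?_⟩
  have h1 := hFX x (mem_insert_of_mem _ hx)
  have h2 := norm_sub_norm_le (F x) ((x 0 - (p + t1 • n) 0)⁻¹)
  have h3 := hgx x hx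
  rw [norm_mul, norm_inv, ← div_eq_mul_inv, div_le_iff₀ (by linarith)]
  linarith

theorem Bprime1 (h : Geo D V ρ) {W : Set (EN 1)} (hW : IsOpen W) (hDW : closure D ⊆ W)
    {K : Set (EN 1)} (hK : IsCompact K) (hKD : K ⊆ D) :
    ∃ ε > 0, ∀ (ρ' : EN 1 → ℝ) (Y : Set (EN 1)), C2DistLt W ρ' ρ ε → IsCompact Y → Y ⊆ D → (∀ y ∈ Y, ρ' y = 0) →
      ∀ p ∈ Y, ∀ U, IsOpen U → p ∈ U → ∃ Ψ : EN 1 → ℂ, DifferentiableOn ℂ Ψ D ∧ Ψ p = 1 ∧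
        ∀ x ∈ (Y \ U) ∪ K, ‖Ψ x‖ ≤ 1/2 := by
  obtain ⟨ε, hε, s0, hs0, H⟩ := exists_segment h hW hDW hK hKD
  refine ⟨ε, hε, fun ρ' Y hcl hY hYD hY0 p hp U hU hpU => ?_⟩
  obtain ⟨n, hn0, hn1, avY, avK, avD⟩ := H ρ' Y hcl hYD hY0 p hp
  refine resolvent_peak hs0 hn0 hn1 ((hY.diff hU).union hK) (union_subset (diff_subset.trans hYD) hKD) (hYD hp) ?_ ?_ avD
  · rintro (hx | hx)
    · exact hx.2 hpU
    · exact avK 0 ⟨le_rfl, hs0.le⟩ (by simpa using hx)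
  · rintro t ht ht0 (hx | hx)
    · exact avY t ht ht0 hx.1
    · exact avK t ht hx

theorem Bprime {N : ℕ} (hN : 1 ≤ N) {D V : Set (EN N)} {ρ : EN N → ℝ} (h : Geo D V ρ) {W : Set (EN N)} (hW : IsOpen W) (hDW : closure D ⊆ W)
    {K : Set (EN N)} (hK : IsCompact K) (hKD : K ⊆ D) :
    ∃ ε > 0, ∀ (ρ' : EN N → ℝ) (Y : Set (EN N)), C2DistLt W ρ' ρ ε → IsCompact Y → Y ⊆ D → (∀ y ∈ Y, ρ' y = 0) →
      ∀ p ∈ Y, ∀ U, IsOpen U → p ∈ U → ∃ Ψ : EN N → ℂ, DifferentiableOn ℂ Ψ D ∧ Ψ p = 1 ∧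
        ∀ x ∈ (Y \ U) ∪ K, ‖Ψ x‖ ≤ 1/2 := by
  rcases hN.eq_or_lt with h1 | h1
  · subst h1
    exact Bprime1 h hW hDW hK hKD
  · exact Bprime2 h1 h hW hDW hK hKD

end bp1
end

open Set Filter Topology Metric MeasureTheory
open scoped ENNReal NNReal InnerProductSpace ComplexConjugate ContDiff Manifold

noncomputable section
section asm
variable {N : ℕ}

/-- strips around a null level have small measure -/
lemma strip_small (μ : Measure (EN N)) [IsFiniteMeasure μ] {B : Set (EN N)} (hB : IsCompact B)
    {k : EN N → ℝ} (hk : ContinuousOn k B) {c : ℝ} (h0 : μ (B ∩ k ⁻¹' {c}) = 0) :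
    Tendsto (fun n : ℕ => μ (B ∩ k ⁻¹' (closedBall c (1/((n:ℝ)+1))))) atTop (𝓝 0) := by
  have h1 := tendsto_measure_iInter_atTop (μ := μ) (s := fun n : ℕ => B ∩ k ⁻¹' (closedBall c (1/((n:ℝ)+1))))
    (fun n => (hk.preimage_isClosed_of_isClosed hB.isClosed isClosed_closedBall).measurableSet.nullMeasurableSet)
    (fun a b hab => inter_subset_inter_right _ (preimage_mono (closedBall_subset_closedBall (Nat.one_div_le_one_div hab))))
    ⟨0, measure_ne_top _ _⟩
  have h2 : (⋂ n : ℕ, B ∩ k ⁻¹' (closedBall c (1/((n:ℝ)+1)))) = B ∩ k ⁻¹' {c} := by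
    ext x
    simp only [mem_iInter, mem_inter_iff, mem_preimage, mem_closedBall, mem_singleton_iff]
    constructor
    · intro h
      refine ⟨(h 0).1, ?_⟩
      have h3 : dist (k x) c ≤ 0 := ge_of_tendsto' (tendsto_one_div_add_atTop_nhds_zero_nat (𝕜 := ℝ)) fun n => (h n).2
      exact dist_le_zero.1 h3
    · rintro ⟨h, h'⟩ n
      refine ⟨h, ?_⟩
      rw [h', dist_self]; positivity
  rw [h2, h0] at h1
  exact h1

lemma exists_level (μ : Measure (EN N)) [IsFiniteMeasure μ] {B : Set (EN N)} (hB : IsCompact B)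
    {k : EN N → ℝ} (hk : ContinuousOn k B) {a b : ℝ} (hab : a < b) : ∃ c ∈ Ioo a b, μ (B ∩ k ⁻¹' {c}) = 0 := by
  have h1 : {c : ℝ | 0 < μ (B ∩ k ⁻¹' {c})}.Countable := by
    refine Measure.countable_meas_pos_of_disjoint_iUnion
      (fun c => (hk.preimage_isClosed_of_isClosed hB.isClosed isClosed_singleton).measurableSet) ?_
    intro c c' hcc
    rw [Function.onFun, Set.disjoint_left]
    rintro x ⟨-, hx⟩ ⟨-, hx'⟩
    exact hcc (hx.symm.trans hx')
  obtain ⟨c, hc, hc'⟩ := (h1.dense_compl ℝ).exists_between hab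
  exact ⟨c, hc', by simpa using hc⟩

theorem G8 (μ : Measure (EN N)) [IsFiniteMeasure μ] {D B K : Set (EN N)} (hD : IsOpen D) (hB : IsCompact B)
    (hK : IsCompact K) (hKD : K ⊆ D) {g : EN N → EN N} (hg : ContinuousOn g B) (hgD : ∀ x ∈ B, g x ∈ D)
    (peak : ∀ p ∈ g '' B, ∀ U, IsOpen U → p ∈ U → ∃ Ψ : EN N → ℂ, DifferentiableOn ℂ Ψ D ∧ Ψ p = 1 ∧
        ∀ x ∈ (g '' B \ U) ∪ K, ‖Ψ x‖ ≤ 1/2)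
    {Φ : EN N → ℂ} (hΦ : ContinuousOn Φ D) {ε : ℝ} (hε : 0 < ε) :
    ∃ (E : Set (EN N)) (F : EN N → ℂ), IsCompact E ∧ E ⊆ B ∧ DifferentiableOn ℂ F D ∧
      μ (B \ E) < ENNReal.ofReal ε ∧ (∀ x ∈ E, ‖F (g x) - Φ (g x)‖ < ε) ∧ ∀ z ∈ K, ‖F z‖ < ε := by
  classical
  set Y := g '' B with hY
  have hYD : Y ⊆ D := by rintro _ ⟨x, hx, rfl⟩; exact hgD x hx
  have hYc : IsCompact Y := hB.image_of_continuousOn hg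
  have hΨ : ∀ p : EN N, ∃ Ψ : EN N → ℂ, ∃ c : ℝ, p ∈ Y → DifferentiableOn ℂ Ψ D ∧ Ψ p = 1 ∧
      (∀ z ∈ K, ‖Ψ z‖ ≤ 1/2) ∧ (∀ y ∈ Y, 1/2 < ‖Ψ y‖ → ‖Φ y - Φ p‖ < ε/4) ∧ c ∈ Ioo (1/2 : ℝ) 1 ∧
      μ (B ∩ (fun x => (Ψ (g x)).re) ⁻¹' {c}) = 0 := by
    intro p
    by_cases hp : p ∈ Y
    swap
    · exact ⟨0, 0, fun h => absurd h hp⟩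
    have hU : IsOpen (D ∩ Φ ⁻¹' (ball (Φ p) (ε/4))) := hΦ.isOpen_inter_preimage hD isOpen_ball
    obtain ⟨Ψ, h1, h2, h3⟩ := peak p hp _ hU ⟨hYD hp, mem_ball_self (by positivity)⟩
    have hcont : ContinuousOn (fun x => (Ψ (g x)).re) B :=
      Complex.continuous_re.comp_continuousOn (h1.continuousOn.comp hg hgD)
    obtain ⟨c, hc, hc0⟩ := exists_level μ hB hcont (show (1/2 : ℝ) < 1 by norm_num)
    refine ⟨Ψ, c, fun _ => ⟨h1, h2, fun z hz => h3 z (Or.inr hz), fun y hy hy' => ?_, hc, hc0⟩⟩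
    by_contra hcon
    have : y ∉ D ∩ Φ ⁻¹' (ball (Φ p) (ε/4)) := fun hm => hcon (by
      have := hm.2
      rwa [mem_preimage, mem_ball, dist_eq_norm] at this)
    linarith [h3 y (Or.inl ⟨hy, this⟩)]
  choose Ψ c hΨ using hΨ
  obtain ⟨t, htY, htc⟩ := hYc.elim_nhds_subcover (fun p => {z | c p < (Ψ p z).re}) (by
    intro p hp
    obtain ⟨h1, h2, -, -, h5, -⟩ := hΨ p hp
    have hca : ContinuousAt (fun z => (Ψ p z).re) p :=
      Complex.continuous_re.continuousAt.comp (h1.continuousOn.continuousAt (hD.mem_nhds (hYD hp)))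
    exact hca.eventually (lt_mem_nhds (by simpa [h2] using h5.2)))
  have hcont : ∀ p ∈ t, ContinuousOn (fun x => (Ψ p (g x)).re) B := fun p hp =>
      Complex.continuous_re.comp_continuousOn ((hΨ p (htY p hp)).1.continuousOn.comp hg hgD)
  have hsum : Tendsto (fun n : ℕ => ∑ p ∈ t, μ (B ∩ (fun x => (Ψ p (g x)).re) ⁻¹' (closedBall (c p) (1/((n:ℝ)+1))))) atTop (𝓝 0) := by
    have := tendsto_finset_sum t fun p hp => strip_small μ hB (hcont p hp) (hΨ p (htY p hp)).2.2.2.2.2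
    simpa using this
  have hev1 := hsum.eventually (gt_mem_nhds (show (0:ℝ≥0∞) < ENNReal.ofReal ε by simpa using hε))
  have hev2 : ∀ᶠ n : ℕ in atTop, ∀ p ∈ t, 1/((n:ℝ)+1) < c p - 1/2 := by
    rw [Filter.eventually_all_finset]
    intro p hp
    exact (tendsto_one_div_add_atTop_nhds_zero_nat (𝕜 := ℝ)).eventually (gt_mem_nhds (by
      have := (hΨ p (htY p hp)).2.2.2.2.1.1; linarith))
  obtain ⟨n, hn1, hn2⟩ := (hev1.and hev2).exists
  set d : ℝ := 1/((n:ℝ)+1) with hd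
  have hdp : 0 < d := by positivity
  set E := {x ∈ B | ∀ p ∈ t, d ≤ |(Ψ p (g x)).re - c p|} with hE
  have hEc : IsCompact E := by
    have : E = B ∩ ⋂ p ∈ t, (B ∩ (fun x => (Ψ p (g x)).re) ⁻¹' {s | d ≤ |s - c p|}) := by
      ext x
      simp only [hE, mem_setOf_eq, mem_inter_iff, mem_iInter, mem_preimage]
      exact ⟨fun h => ⟨h.1, fun p hp => ⟨h.1, h.2 p hp⟩⟩, fun h => ⟨h.1, fun p hp => (h.2 p hp).2⟩⟩
    rw [this]
    refine hB.inter_right (isClosed_biInter fun p hp => (hcont p hp).preimage_isClosed_of_isClosed hB.isClosed ?_)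
    exact isClosed_le continuous_const (by fun_prop)
  have hEB : E ⊆ B := fun x hx => hx.1
  set X := g '' E ∪ K with hX
  have hXc : IsCompact X := (hEc.image_of_continuousOn (hg.mono hEB)).union hK
  have hXD : X ⊆ D := union_subset ((image_mono hEB).trans hYD) hKD
  have hind : ∀ p ∈ t, App D X (fun x => if c p < (Ψ p x).re then 1 else 0) := by
    intro p hp
    obtain ⟨h1, h2, h3, h4, h5, -⟩ := hΨ p (htY p hp)
    have hu : App D X (fun x => Ψ p x - (c p : ℂ)) := (App.of_hol hXc hXD h1).sub (App.const _)
    refine (hu.ind hdp ?_).congr fun x _ => ?_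
    · rintro x (⟨y, hy, rfl⟩ | hx)
      · simpa using hy.2 p hp
      · have q1 := (Complex.abs_re_le_norm (Ψ p x)).trans (h3 x hx)
        rw [abs_le] at q1
        have q2 := hn2 p hp
        simp only [Complex.sub_re, Complex.ofReal_re]
        rw [abs_of_nonpos (by linarith)]
        linarith
    · simp
  have key : ∀ s : Finset (EN N), s ⊆ t → ∃ F : EN N → ℂ, App D X F ∧ (∀ z ∈ K, F z = 0) ∧
      ∀ x ∈ Y, ((∃ p ∈ s, c p < (Ψ p x).re) → ‖F x - Φ x‖ < ε/4) ∧ ((∀ p ∈ s, ¬ c p < (Ψ p x).re) → F x = 0) := by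
    intro s
    induction s using Finset.induction_on with
    | empty =>
      intro _
      exact ⟨fun _ => 0, App.const 0, by simp, by simp⟩
    | insert p s hps ih =>
      intro hst
      have hpt : p ∈ t := hst (Finset.mem_insert_self _ _)
      obtain ⟨F, hF, hFK, hFY⟩ := ih ((Finset.subset_insert _ _).trans hst)
      obtain ⟨h1, h2, h3, h4, h5, -⟩ := hΨ p (htY p hpt)
      have ha := hind p hpt
      refine ⟨fun x => (if c p < (Ψ p x).re then 1 else 0) * Φ p + (1 - (if c p < (Ψ p x).re then 1 else 0)) * F x,
        (ha.mul (App.const _)).add (((App.const 1).sub ha).mul hF), fun z hz => ?_, fun x hx => ?_⟩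
      · have q1 := (Complex.re_le_norm (Ψ p z)).trans (h3 z hz)
        have q2 : ¬ c p < (Ψ p z).re := by linarith [h5.1]
        simp [q2, hFK z hz]
      · by_cases hc : c p < (Ψ p x).re
        · simp only [if_pos hc]
          constructor
          · intro _
            have := h4 x hx (by linarith [Complex.re_le_norm (Ψ p x), h5.1])
            rw [norm_sub_rev] at this
            simpa using this
          · intro hall
            exact absurd hc (hall p (Finset.mem_insert_self _ _))
        · simp only [if_neg hc, zero_mul, zero_add, sub_zero, one_mul]
          constructor
          · rintro ⟨q, hq, hq'⟩
            rcases Finset.mem_insert.1 hq with rfl | hq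
            · exact absurd hq' hc
            · exact (hFY x hx).1 ⟨q, hq, hq'⟩
          · intro hall
            exact (hFY x hx).2 fun q hq => hall q (Finset.mem_insert_of_mem hq)
  obtain ⟨F, hF, hFK, hFY⟩ := key t (Finset.Subset.refl _)
  obtain ⟨f, hf, hfX⟩ := hF.2 (ε/4) (by positivity)
  refine ⟨E, f, hEc, hEB, hf, ?_, fun x hx => ?_, fun z hz => ?_⟩
  · refine lt_of_le_of_lt ((measure_mono ?_).trans (measure_biUnion_finset_le t _)) hn1
    rintro x ⟨hxB, hxE⟩
    have : ∃ p ∈ t, |(Ψ p (g x)).re - c p| < d := by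
      by_contra hcon
      push Not at hcon
      exact hxE ⟨hxB, hcon⟩
    obtain ⟨p, hp, hlt⟩ := this
    refine mem_biUnion hp ⟨hxB, ?_⟩
    rw [mem_preimage, mem_closedBall, Real.dist_eq]
    exact hlt.le
  · have hxY : g x ∈ Y := mem_image_of_mem g (hEB hx)
    have h1 := hfX (g x) (Or.inl (mem_image_of_mem g hx))
    have h2 := (hFY (g x) hxY).1 (by simpa using htc hxY)
    have := norm_sub_le_norm_sub_add_norm_sub (f (g x)) (F (g x)) (Φ (g x))
    linarith
  · have h1 := hfX z (Or.inr hz)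
    rw [hFK z hz, sub_zero] at h1
    linarith

instance surfMeasureNorm_finite (D : Set (EN N)) : IsFiniteMeasure (surfMeasureNorm D) := by
  constructor
  have : surfMeasureNorm D univ ≤ 1 := by
    simp only [surfMeasureNorm, surfMeasure, Measure.smul_apply, Measure.restrict_apply_univ, smul_eq_mul]
    exact ENNReal.inv_mul_le_one _
  exact this.trans_lt ENNReal.one_lt_top

lemma Geo.fr_zero {D V : Set (EN N)} {ρ : EN N → ℝ} (h : Geo D V ρ) {y : EN N} (hy : y ∈ frontier D) : ρ y = 0 := by
  have hyc : y ∈ closure D := frontier_subset_closure hy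
  have hyV := h.sub hyc
  have hyD : y ∉ D := by
    rw [h.opD.frontier_eq] at hy; exact hy.2
  apply le_antisymm
  · have hca : ContinuousWithinAt ρ D y := (h.cat hyV).continuousAt.continuousWithinAt
    have := mem_closure_iff_nhdsWithin_neBot.1 hyc
    exact le_of_tendsto hca (eventually_mem_nhdsWithin.mono fun z hz => (h.neg hz).le)
  · by_contra hlt
    rw [h.eqD] at hyD
    exact hyD ⟨hyV, not_le.1 hlt⟩

end asm
end

theorem approximation_corollary {N : ℕ} (D : Set (EN N)) (ρ : EN N → ℝ)
    (hD : StrictPSCWith D ρ)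
    (γ : EN N × ℝ → EN N) (hγ : GammaMap D ρ γ 1) (hdag : Dagger D ρ γ)
    (ε : ℝ) (hε : 0 < ε) (K : Set (EN N)) (hK : IsCompact K) (hKc : HolConvexIn D K)
    (h : EN N → ℂ) (hh : DifferentiableOn ℂ h D)
    (φ : EN N → ℂ) (hφ : ContinuousOn φ (frontier D)) :
    ∃ r₀ ∈ Ioo (0:ℝ) 1, ∀ r ∈ Ioo r₀ 1,
      ∃ (E : Set (EN N)) (f : EN N → ℂ), IsCompact E ∧ E ⊆ frontier D ∧
        DifferentiableOn ℂ f D ∧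
        surfMeasureNorm D (frontier D \ E) < ENNReal.ofReal ε ∧
        (∀ x ∈ E, ‖f (γ (x, r)) - φ x‖ < ε) ∧
        (∀ z ∈ K, ‖f z - h z‖ < ε) := by
  obtain ⟨V, hG⟩ := hD.geo
  have hKD : K ⊆ D := hKc.1
  have hBc : IsCompact (frontier D) := hG.cpt.of_isClosed_subset isClosed_frontier frontier_subset_closure
  rcases Nat.eq_zero_or_pos N with hN | hN
  · subst hN
    have hfr : frontier D = ∅ := by
      rcases D.eq_empty_or_nonempty with h0 | h0
      · simp [h0]
      · rw [Subsingleton.eq_univ_of_nonempty h0, frontier_univ]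
    refine ⟨1/2, by norm_num, fun r hr => ⟨∅, h, isCompact_empty, empty_subset _, hh, ?_, by simp, by simp [hε]⟩⟩
    rw [hfr]; simpa using hε
  obtain ⟨W, hW, hDW, Dr, ρr, hdag⟩ := hdag
  obtain ⟨ε1, hε1, hB⟩ := Bprime hN hG hW hDW hK hKD
  obtain ⟨r1, hr1, hdag⟩ := hdag ε1 hε1
  obtain ⟨hγc, hγD, hγ1, -⟩ := hγ
  -- Tietze
  obtain ⟨Φ, hΦ⟩ : ∃ Φ : EN N → ℂ, Continuous Φ ∧ ∀ x ∈ frontier D, Φ x = φ x := by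
    obtain ⟨G, hGe⟩ := ContinuousMap.exists_restrict_eq (s := frontier D) isClosed_frontier ⟨_, hφ.restrict⟩
    refine ⟨G, G.continuous, fun x hx => ?_⟩
    exact congrArg (fun f => f ⟨x, hx⟩) hGe
  obtain ⟨r2, hr2, hu⟩ : ∃ r2 < (1:ℝ), ∀ r ∈ Ioo r2 1, 0 ≤ r → ∀ x ∈ frontier D, ‖Φ (γ (x, r)) - φ x‖ < ε/2 := by
    have hc : ContinuousOn (fun q => Φ (γ q)) (frontier D ×ˢ Icc (0:ℝ) 1) := hΦ.1.comp_continuousOn hγc.continuousOn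
    have huc := (hBc.prod isCompact_Icc).uniformContinuousOn_of_continuous hc
    rw [Metric.uniformContinuousOn_iff] at huc
    obtain ⟨δ, hδ, huc⟩ := huc (ε/2) (by positivity)
    refine ⟨1 - δ, by linarith, fun r hr hr0 x hx => ?_⟩
    have := huc (x, r) ⟨hx, hr0, hr.2.le⟩ (x, 1) ⟨hx, by norm_num, le_rfl⟩ (by
      rw [Prod.dist_eq, dist_self, Real.dist_eq]
      have : |r - 1| < δ := by rw [abs_lt]; constructor <;> linarith [hr.1, hr.2]
      simp [hδ, this])
    simp only [hγ1 x hx, hΦ.2 x hx] at this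
    rwa [dist_eq_norm] at this
  refine ⟨max (max r1 r2) (1/2), ⟨by positivity, max_lt (max_lt hr1.2 hr2) (by norm_num)⟩, fun r hr => ?_⟩
  have hrr1 : r1 < r := lt_of_le_of_lt ((le_max_left _ _).trans (le_max_left _ _)) hr.1
  have hrr2 : r2 < r := lt_of_le_of_lt ((le_max_right _ _).trans (le_max_left _ _)) hr.1
  have hr0 : 0 ≤ r := by have := lt_of_le_of_lt (le_max_right _ _) hr.1; linarith
  obtain ⟨hpsc, -, hfr, hclose⟩ := hdag r ⟨hrr1, hr.2⟩
  obtain ⟨V2, hG2⟩ := hpsc.geo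
  have hgc : ContinuousOn (fun x => γ (x, r)) (frontier D) :=
    hγc.continuousOn.comp (f := fun x => (x, r)) (by fun_prop) fun x hx => ⟨hx, hr0, hr.2.le⟩
  have hgD : ∀ x ∈ frontier D, γ (x, r) ∈ D := fun x hx => hγD x hx r ⟨hr0, hr.2⟩
  obtain ⟨E, F, hE, hEB, hF, hm, hFE, hFK⟩ := G8 (surfMeasureNorm D) hG.opD hBc hK hKD hgc hgD
    (hB (ρr r) _ hclose (hBc.image_of_continuousOn hgc) (by rintro _ ⟨x, hx, rfl⟩; exact hgD x hx)
      (fun y hy => hG2.fr_zero (hfr ▸ hy)))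
    (Φ := fun z => Φ z - h z) (hΦ.1.continuousOn.sub hh.continuousOn) (show 0 < ε/2 by positivity)
  refine ⟨E, fun z => h z + F z, hE, hEB, hh.add hF, hm.trans_le (ENNReal.ofReal_le_ofReal (by linarith)), fun x hx => ?_, fun z hz => ?_⟩
  · have h1 := hFE x hx
    have h2 := hu r ⟨hrr2, hr.2⟩ hr0 x (hEB hx)
    have e : h (γ (x, r)) + F (γ (x, r)) - φ x = (F (γ (x, r)) - (Φ (γ (x, r)) - h (γ (x, r)))) + (Φ (γ (x, r)) - φ x) := by ring
    rw [e]
    linarith [norm_add_le (F (γ (x, r)) - (Φ (γ (x, r)) - h (γ (x, r)))) (Φ (γ (x, r)) - φ x)]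
  · rw [add_sub_cancel_left]
    linarith [hFK z hz]
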